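/- Let A be a hyperplane arrangement in K^ℓ admitting a locally heavy flag {X_i}_{i=1}^ℓ with X_i of codimension i. Then A is free with exponents (1, m^{X_1}(X_2), ..., m^{X_{ℓ-1}}(X_ℓ)) if and only if b_2(A) = Σ_{0 ≤ i < j ≤ ℓ−1} m^{X_i}(X_{i+1}) · m^{X_j}(X_{j+1}), where m^{X_0}(X_1) := 1. In particular, the freeness of any arrangement admitting a locally heavy flag depends only on its intersection lattice. -/

import Mathlib

open scoped Classical
open MvPolynomial

namespace ArrPaper

variable {K : Type*} [Field K] {ℓ : ℕ}

/-- The coordinate ring `S = K[x₁,…,x_ℓ]`. -/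
noncomputable abbrev S (K : Type*) [Field K] (ℓ : ℕ) := MvPolynomial (Fin ℓ) K

/-- The linear form associated to a covector `c`. -/
noncomputable def linForm (c : Fin ℓ → K) : S K ℓ :=
  ∑ i, MvPolynomial.C (c i) * MvPolynomial.X i

/-- The linear functional associated to a covector. -/
noncomputable def toFunc (c : Fin ℓ → K) : (Fin ℓ → K) →ₗ[K] K :=
  ∑ i, c i • LinearMap.proj i

/-- A (central) hyperplane arrangement, given by a finite set of nonzero,
pairwise non-proportional covectors (defining linear forms). -/
structure Arrangement (K : Type*) [Field K] (ℓ : ℕ) where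
  hyps : Finset (Fin ℓ → K)
  ne_zero : ∀ c ∈ hyps, c ≠ 0
  nonparallel : ∀ c ∈ hyps, ∀ c' ∈ hyps, c ≠ c' → ∀ t : K, c' ≠ t • c

/-- Derivations of the polynomial ring `S`. -/
abbrev Der (K : Type*) [Field K] (ℓ : ℕ) := Derivation K (S K ℓ) (S K ℓ)

/-- `θ` is a logarithmic derivation of the multiarrangement `(A, m)`, i.e.
`θ(α_H) ∈ α_H^{m(H)}·S` for all `H ∈ A`. -/
def IsLogDer (A : Arrangement K ℓ) (m : (Fin ℓ → K) → ℕ) (θ : Der K ℓ) : Prop :=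
  ∀ c ∈ A.hyps, (linForm c) ^ (m c) ∣ θ (linForm c)

/-- `θ` is homogeneous of polynomial degree `d`: `θ(α)` is homogeneous of degree `d`
for every linear form `α`. -/
def IsHomogOfDeg (θ : Der K ℓ) (d : ℕ) : Prop :=
  ∀ c : Fin ℓ → K, (θ (linForm c)).IsHomogeneous d

/-- `θ₁, …, θ_ℓ` form a basis of the `S`-module `D(A,m)`. -/
def IsDerBasis (A : Arrangement K ℓ) (m : (Fin ℓ → K) → ℕ) (θ : Fin ℓ → Der K ℓ) : Prop :=
  (∀ i, IsLogDer A m (θ i)) ∧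
  ∀ η : Der K ℓ, IsLogDer A m η → ∃! f : Fin ℓ → S K ℓ, η = ∑ i, f i • θ i

/-- `(A,m)` is free with a homogeneous basis of degrees (exponents) `d`. -/
def IsFreeWithExp (A : Arrangement K ℓ) (m : (Fin ℓ → K) → ℕ) (d : Fin ℓ → ℕ) : Prop :=
  ∃ θ : Fin ℓ → Der K ℓ, (∀ i, IsHomogOfDeg (θ i) (d i)) ∧ IsDerBasis A m θ

/-- `(A,m)` is a free multiarrangement. -/
def IsFree (A : Arrangement K ℓ) (m : (Fin ℓ → K) → ℕ) : Prop :=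
  ∃ d : Fin ℓ → ℕ, IsFreeWithExp A m d

/-- `|m|`, the total multiplicity. -/
def msum (A : Arrangement K ℓ) (m : (Fin ℓ → K) → ℕ) : ℕ := ∑ c ∈ A.hyps, m c

/-- The rank of an arrangement: the dimension of the span of its covectors. -/
noncomputable def rank (A : Arrangement K ℓ) : ℕ :=
  Module.finrank K (Submodule.span K (A.hyps : Set (Fin ℓ → K)))

/-- `A` is reducible: after a linear change of coordinates it is a product of two
arrangements in complementary (nonzero) subspaces.  In terms of covectors: the
covectors split between two complementary nonzero subspaces of the dual space. -/
def Reducible (A : Arrangement K ℓ) : Prop :=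
  ∃ W₁ W₂ : Submodule K (Fin ℓ → K), W₁ ≠ ⊥ ∧ W₂ ≠ ⊥ ∧ W₁ ⊓ W₂ = ⊥ ∧ W₁ ⊔ W₂ = ⊤ ∧
    ∀ c ∈ A.hyps, c ∈ W₁ ∨ c ∈ W₂

/-- The hyperplanes of the localization at a flat; the flat of codimension `r` is
encoded by the `r`-dimensional subspace `U` of the dual space spanned by the
covectors of the hyperplanes containing it. -/
noncomputable def locHyps (A : Arrangement K ℓ) (U : Submodule K (Fin ℓ → K)) :
    Finset (Fin ℓ → K) :=
  A.hyps.filter (· ∈ U)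

/-- `U` encodes a flat of `A` of codimension `r` (an element of `L_r(A)`). -/
def IsFlatOfRank (A : Arrangement K ℓ) (U : Submodule K (Fin ℓ → K)) (r : ℕ) : Prop :=
  Module.finrank K U = r ∧ Submodule.span K (locHyps A U : Set (Fin ℓ → K)) = U

/-- The localization `A_X` of `A` at the flat encoded by `U`. -/
noncomputable def localize (A : Arrangement K ℓ) (U : Submodule K (Fin ℓ → K)) :
    Arrangement K ℓ where
  hyps := locHyps A U
  ne_zero := fun c hc => A.ne_zero c (Finset.mem_filter.mp hc).1
  nonparallel := fun c hc c' hc' =>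
    A.nonparallel c (Finset.mem_filter.mp hc).1 c' (Finset.mem_filter.mp hc').1

/-- `H₀` (given by covector `c₀`) is a heavy hyperplane of `(A,m)`. -/
def IsHeavy (A : Arrangement K ℓ) (m : (Fin ℓ → K) → ℕ) (c₀ : Fin ℓ → K) : Prop :=
  c₀ ∈ A.hyps ∧ (∑ c ∈ A.hyps.erase c₀, m c) ≤ m c₀

/-- `H₀` (given by covector `c₀`) is a locally heavy hyperplane of `(A,m)`. -/
def IsLocallyHeavy (A : Arrangement K ℓ) (m : (Fin ℓ → K) → ℕ) (c₀ : Fin ℓ → K) : Prop :=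
  c₀ ∈ A.hyps ∧ ∀ U : Submodule K (Fin ℓ → K), IsFlatOfRank A U 2 → c₀ ∈ U →
    3 ≤ (locHyps A U).card → (∑ c ∈ (locHyps A U).erase c₀, m c) ≤ m c₀

/-- `b` is the second Betti number of the rank-2 localization of `(A,m)` at `U`:
the product of the nonzero exponents of this free rank-2 multiarrangement. -/
def IsLocalB2 (A : Arrangement K ℓ) (m : (Fin ℓ → K) → ℕ)
    (U : Submodule K (Fin ℓ → K)) (b : ℕ) : Prop :=
  ∃ d : Fin ℓ → ℕ, IsFreeWithExp (localize A U) m d ∧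
    b = ∏ i ∈ Finset.univ.filter (fun i => d i ≠ 0), d i

/-- `b` is the second Betti number `b₂(A,m)` of the multiarrangement `(A,m)`. -/
def IsB2 (A : Arrangement K ℓ) (m : (Fin ℓ → K) → ℕ) (b : ℕ) : Prop :=
  ∃ bloc : Submodule K (Fin ℓ → K) → ℕ,
    (∀ U, IsFlatOfRank A U 2 → IsLocalB2 A m U (bloc U)) ∧
    b = ∑ᶠ U ∈ {U : Submodule K (Fin ℓ → K) | IsFlatOfRank A U 2}, bloc U

/-- The second Betti number of a simple arrangement:
`b₂(A) = Σ_{X ∈ L₂(A)} (|A_X| - 1)`. -/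
noncomputable def b2Simple (A : Arrangement K ℓ) : ℕ :=
  ∑ᶠ U ∈ {U : Submodule K (Fin ℓ → K) | IsFlatOfRank A U 2}, ((locHyps A U).card - 1)

/-- The Euler–Ziegler multiplicity of the restricted hyperplane `H₀ ∩ ker(c)` of
`A^{H₀}`: `m^{H₀}(X) = |m_X| - m(H₀)`. -/
noncomputable def EZmult (A : Arrangement K ℓ) (m : (Fin ℓ → K) → ℕ)
    (c₀ c : Fin ℓ → K) : ℕ :=
  (∑ c' ∈ A.hyps.filter (· ∈ Submodule.span K ({c₀, c} : Set (Fin ℓ → K))), m c') - m c₀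

/-- Two covectors are parallel (define the same hyperplane). -/
def Parallel {n : ℕ} (b b' : Fin n → K) : Prop := ∃ t : K, t ≠ 0 ∧ b' = t • b

/-- The covector on `K^n` obtained by restricting the covector `c` on `K^{n+1}` to the
hyperplane `ker c₀`, transported by the linear isomorphism `e : ker c₀ ≃ K^n`. -/
noncomputable def resCov {n : ℕ} (c₀ : Fin (n+1) → K)
    (e : ↥(LinearMap.ker (toFunc c₀)) ≃ₗ[K] (Fin n → K)) (c : Fin (n+1) → K) :
    Fin n → K :=
  fun j => toFunc c ((e.symm (Pi.single j 1) : ↥(LinearMap.ker (toFunc c₀))) : Fin (n+1) → K)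

/-- `(B, mB)` is (a model, in coordinates, of) the Euler–Ziegler restriction
`(A^{H₀}, m^{H₀})` of `(A,m)` to the hyperplane `H₀ = ker c₀ ∈ A`. -/
def IsEZRes {n : ℕ} (A : Arrangement K (n+1)) (m : (Fin (n+1) → K) → ℕ)
    (c₀ : Fin (n+1) → K) (B : Arrangement K n) (mB : (Fin n → K) → ℕ) : Prop :=
  c₀ ∈ A.hyps ∧
  ∃ e : ↥(LinearMap.ker (toFunc c₀)) ≃ₗ[K] (Fin n → K),
    (∀ c ∈ A.hyps.erase c₀, ∃ b ∈ B.hyps,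
        Parallel b (resCov c₀ e c) ∧ mB b = EZmult A m c₀ c) ∧
    (∀ b ∈ B.hyps, ∃ c ∈ A.hyps.erase c₀, Parallel b (resCov c₀ e c))

/-- A combinatorial equivalence between two arrangements: a bijection between the
hyperplanes inducing an isomorphism of intersection lattices (it preserves the rank
of every subset of hyperplanes). -/
def CombEquiv (A A' : Arrangement K ℓ) : Prop :=
  ∃ φ : (Fin ℓ → K) → (Fin ℓ → K), Set.BijOn φ ↑A.hyps ↑A'.hyps ∧
    ∀ T : Finset (Fin ℓ → K), T ⊆ A.hyps →
      Module.finrank K (Submodule.span K (T : Set (Fin ℓ → K))) =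
      Module.finrank K (Submodule.span K ((T.image φ) : Set (Fin ℓ → K)))

section

/-- Homogeneous polynomials of degree `d - a`, zero if `d < a`. -/
noncomputable def shiftHom (K : Type*) [Field K] (n a d : ℕ) : Submodule K (S K n) :=
  if a ≤ d then homogeneousSubmodule (Fin n) K (d - a) else ⊥

/-- The projection onto `shiftHom`. -/
noncomputable def shiftComp (n a d : ℕ) : S K n →ₗ[K] S K n :=
  if a ≤ d then homogeneousComponent (d - a) else 0

/-- The dimension of `shiftHom`. -/
def hs (n a d : ℕ) : ℕ := if a ≤ d then n.multichoose (d - a) else 0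

instance finite_homogeneousSubmodule (n d : ℕ) :
    Module.Finite K (homogeneousSubmodule (Fin n) K d) :=
  Module.Finite.iff_fg.2 (homogeneousSubmodule_fg (Fin n) K d)

theorem finrank_homogeneousSubmodule (n d : ℕ) :
    Module.finrank K (homogeneousSubmodule (Fin n) K d) = n.multichoose d := by
  rw [homogeneousSubmodule_eq_finsupp_supported]
  refine (AddMonoidAlgebra.supportedEquivFinsupp (S := K) (R := K)
    {u : Fin n →₀ ℕ | u.degree = d}).finrank_eq.trans ?_
  have h3 : {u : Fin n →₀ ℕ | u.degree = d}
      = ((Finset.univ : Finset (Fin n)).finsuppAntidiag d : Set (Fin n →₀ ℕ)) := by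
    ext u
    simp [Finset.mem_finsuppAntidiag, Finsupp.degree_eq_sum]
  rw [h3, Module.finrank_finsupp_self]
  simp [Finset.card_finsuppAntidiag_nat_eq_multichoose]

instance finite_shiftHom (n a d : ℕ) : Module.Finite K (shiftHom K n a d) := by
  by_cases h : a ≤ d
  · rw [shiftHom, if_pos h]; infer_instance
  · rw [shiftHom, if_neg h]; infer_instance

theorem finrank_shiftHom (n a d : ℕ) : Module.finrank K (shiftHom K n a d) = hs n a d := by
  by_cases h : a ≤ d
  · rw [shiftHom, hs, if_pos h, if_pos h]; exact finrank_homogeneousSubmodule _ _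
  · rw [shiftHom, hs, if_neg h, if_neg h]; exact finrank_bot K _

theorem shiftHom_zero (n d : ℕ) : shiftHom K n 0 d = homogeneousSubmodule (Fin n) K d := by
  simp [shiftHom]

theorem shiftComp_mem (n a d : ℕ) (f : S K n) : shiftComp n a d f ∈ shiftHom K n a d := by
  unfold shiftComp shiftHom
  split_ifs
  · exact homogeneousComponent_mem _ _
  · simp

theorem shiftComp_of_mem {n a d : ℕ} {f : S K n} (h : f ∈ shiftHom K n a d) :
    shiftComp n a d f = f := by
  unfold shiftComp; unfold shiftHom at h
  split_ifs at h ⊢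
  · exact homogeneousComponent_eq_self h
  · simp at h; simp [h]

theorem mul_mem_shiftHom {n a d b : ℕ} {p f : S K n} (hp : p.IsHomogeneous b)
    (h : f ∈ shiftHom K n (a + b) d) : p * f ∈ shiftHom K n a d := by
  unfold shiftHom at *
  split_ifs at h with h1
  · rw [if_pos (by omega)]
    have := hp.mul (h : f.IsHomogeneous _)
    rw [mem_homogeneousSubmodule]
    convert this using 1; omega
  · simp at h; simp [h]

theorem homogeneousComponent_mul_left {n a : ℕ} (d : ℕ) {p : S K n} (hp : p.IsHomogeneous a)
    (q : S K n) : homogeneousComponent d (p * q) = p * shiftComp n a d q := by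
  conv_lhs => rw [← sum_homogeneousComponent q, Finset.mul_sum, map_sum]
  have h : ∀ i, homogeneousComponent d (p * homogeneousComponent i q)
      = if a + i = d then p * homogeneousComponent i q else 0 := by
    intro i
    rw [homogeneousComponent_of_mem (hp.mul (homogeneousComponent_isHomogeneous i q))]
    split_ifs with h1 h2 h2 <;> first | rfl | (exfalso; omega)
  simp_rw [h]
  unfold shiftComp
  split_ifs with had
  · rw [Finset.sum_eq_single (d - a)]
    · rw [if_pos (by omega)]
    · intro b _ hb; rw [if_neg (by omega)]
    · intro hb
      rw [if_pos (by omega), homogeneousComponent_eq_zero _ _ (by simp at hb; omega), mul_zero]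
  · rw [Finset.sum_eq_zero]
    · simp
    · intro i _; rw [if_neg (by omega)]

theorem shiftComp_mul_left {n a b : ℕ} (d : ℕ) {p : S K n} (hp : p.IsHomogeneous b)
    (q : S K n) : shiftComp n a d (p * q) = p * shiftComp n (a + b) d q := by
  unfold shiftComp
  by_cases h : a ≤ d
  · rw [if_pos h, homogeneousComponent_mul_left _ hp]
    unfold shiftComp
    by_cases h' : a + b ≤ d
    · rw [if_pos h', if_pos (by omega), Nat.sub_sub]
    · rw [if_neg h', if_neg (by omega)]
  · rw [if_neg h, if_neg (by omega)]; simp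

theorem dvd_homogeneousComponent {n a : ℕ} {p q : S K n} (hp : p.IsHomogeneous a)
    (h : p ∣ q) (d : ℕ) : p ∣ homogeneousComponent d q := by
  obtain ⟨r, rfl⟩ := h
  rw [homogeneousComponent_mul_left d hp]
  exact dvd_mul_right _ _

/-! ### Linear forms -/

variable {n : ℕ}

theorem linForm_add (c c' : Fin n → K) : linForm (c + c') = linForm c + linForm c' := by
  simp [linForm, add_mul, Finset.sum_add_distrib]

theorem linForm_smul (a : K) (c : Fin n → K) : linForm (a • c) = C a * linForm c := by
  simp [linForm, Finset.mul_sum, mul_assoc]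

theorem coeff_linForm (c : Fin n → K) (i : Fin n) :
    coeff (Finsupp.single i 1) (linForm c) = c i := by
  simp only [linForm, coeff_sum, coeff_C_mul, coeff_X]
  rw [Finset.sum_eq_single i]
  · simp
  · intro j _ hj
    rw [if_neg, mul_zero]
    intro h
    exact hj (Finsupp.single_left_injective one_ne_zero h)
  · simp

theorem linForm_injective : Function.Injective (linForm : (Fin n → K) → S K n) := by
  intro c c' h
  ext i
  rw [← coeff_linForm c i, h, coeff_linForm]

theorem linForm_zero : linForm (0 : Fin n → K) = 0 := by simp [linForm]

theorem linForm_ne_zero {c : Fin n → K} (h : c ≠ 0) : linForm c ≠ 0 := by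
  rw [← linForm_zero]; exact fun h' => h (linForm_injective h')

theorem linForm_isHomogeneous (c : Fin n → K) : (linForm c).IsHomogeneous 1 :=
  IsHomogeneous.sum _ _ _ fun _ _ => isHomogeneous_C_mul_X _ _

theorem linForm_pow_isHomogeneous (c : Fin n → K) (k : ℕ) : (linForm c ^ k).IsHomogeneous k := by
  simpa using (linForm_isHomogeneous c).pow k

theorem linForm_prime {c : Fin n → K} (h : c ≠ 0) : Prime (linForm c) := by
  apply Irreducible.prime
  apply irreducible_of_totalDegree_eq_one
  · exact (linForm_isHomogeneous c).totalDegree (linForm_ne_zero h)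
  · intro a ha
    obtain ⟨i, hi⟩ := Function.ne_iff.1 h
    have := ha (Finsupp.single i 1)
    rw [coeff_linForm] at this
    by_contra hu
    have h0 : a = 0 := by simpa using hu
    rw [h0, zero_dvd_iff] at this
    exact hi this

theorem linForm_dvd_linForm {c c' : Fin n → K} (h : linForm c ∣ linForm c') :
    ∃ t : K, c' = t • c := by
  obtain ⟨q, hq⟩ := h
  by_cases h0 : linForm c' = 0
  · exact ⟨0, by rw [zero_smul]; exact linForm_injective (by rw [h0, linForm_zero])⟩
  have hdeg : q.totalDegree = 0 := by
    have h1 := (linForm_isHomogeneous c').totalDegree h0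
    have hc : linForm c ≠ 0 := fun h => h0 (by rw [hq, h, zero_mul])
    have hq0 : q ≠ 0 := fun h => h0 (by rw [hq, h, mul_zero])
    rw [hq, totalDegree_mul_of_isDomain hc hq0,
      (linForm_isHomogeneous c).totalDegree hc] at h1
    omega
  rw [totalDegree_eq_zero_iff_eq_C] at hdeg
  refine ⟨coeff 0 q, linForm_injective ?_⟩
  rw [linForm_smul, hq]
  conv_lhs => rw [hdeg]
  ring

theorem isRelPrime_linForm {c c' : Fin n → K} (hc : c ≠ 0) (h : ∀ t : K, c' ≠ t • c) :
    IsRelPrime (linForm c) (linForm c') := by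
  rw [(linForm_prime hc).irreducible.isRelPrime_iff_not_dvd]
  intro hd
  obtain ⟨t, ht⟩ := linForm_dvd_linForm hd
  exact h t ht

theorem isRelPrime_linForm_pow {c c' : Fin n → K} (hc : c ≠ 0) (h : ∀ t : K, c' ≠ t • c)
    (a b : ℕ) : IsRelPrime (linForm c ^ a) (linForm c' ^ b) :=
  (isRelPrime_linForm hc h).pow

/-! ### Vector fields -/

/-- The value on a covector of a vector field, given by its coefficients. -/
noncomputable def ev (c : Fin n → K) : (Fin n → S K n) →ₗ[S K n] S K n :=
  ∑ i, (C (c i) : S K n) • LinearMap.proj (R := S K n) (φ := fun _ : Fin n => S K n) i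

theorem ev_apply (c : Fin n → K) (θ : Fin n → S K n) : ev c θ = ∑ i, C (c i) * θ i := by
  simp [ev]

theorem ev_add (c c' : Fin n → K) (θ : Fin n → S K n) : ev (c + c') θ = ev c θ + ev c' θ := by
  simp [ev_apply, add_mul, Finset.sum_add_distrib]

theorem ev_smul (a : K) (c : Fin n → K) (θ : Fin n → S K n) :
    ev (a • c) θ = C a * ev c θ := by
  simp [ev_apply, Finset.mul_sum, mul_assoc]

theorem ev_X (c : Fin n → K) : ev c (fun i => X i) = linForm c := by
  simp [ev_apply, linForm]

theorem ev_single (i : Fin n) (θ : Fin n → S K n) : ev (Pi.single i 1) θ = θ i := by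
  rw [ev_apply, Finset.sum_eq_single i]
  · simp
  · intro j _ hj; simp [hj]
  · simp

/-- The module of logarithmic vector fields. -/
noncomputable def Dm (T : Finset (Fin n → K)) (m : (Fin n → K) → ℕ) :
    Submodule (S K n) (Fin n → S K n) where
  carrier := {θ | ∀ c ∈ T, linForm c ^ m c ∣ ev c θ}
  add_mem' := fun ha hb c hc => by rw [map_add]; exact dvd_add (ha c hc) (hb c hc)
  zero_mem' := fun c _ => by simp
  smul_mem' := fun s a ha c hc => by
    rw [map_smul, smul_eq_mul]; exact Dvd.dvd.mul_left (ha c hc) s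

theorem mem_Dm {T : Finset (Fin n → K)} {m : (Fin n → K) → ℕ} {θ : Fin n → S K n} :
    θ ∈ Dm T m ↔ ∀ c ∈ T, linForm c ^ m c ∣ ev c θ := Iff.rfl

/-- Homogeneous vectors of degree `d`. -/
noncomputable def homV (K : Type*) [Field K] (k n d : ℕ) : Submodule K (Fin k → S K n) :=
  Submodule.pi Set.univ fun _ => homogeneousSubmodule (Fin n) K d

theorem mem_homV {k d : ℕ} {θ : Fin k → S K n} :
    θ ∈ homV K k n d ↔ ∀ i, (θ i).IsHomogeneous d := by
  simp [homV, Submodule.mem_pi]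

instance finite_homV (k n d : ℕ) : Module.Finite K (homV K k n d) := by
  let f : homV K k n d →ₗ[K] (Fin k → homogeneousSubmodule (Fin n) K d) :=
    { toFun := fun θ i => ⟨θ.1 i, mem_homV.1 θ.2 i⟩
      map_add' := fun _ _ => rfl
      map_smul' := fun _ _ => rfl }
  apply Module.Finite.of_injective f
  intro a b h
  ext1; funext i
  exact congrArg Subtype.val (congrFun h i)

/-- The homogeneous component of a vector. -/
noncomputable def compV (k n d : ℕ) : (Fin k → S K n) →ₗ[K] (Fin k → S K n) :=
  LinearMap.pi fun i => homogeneousComponent d ∘ₗ LinearMap.proj i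

theorem compV_apply {k : ℕ} (d : ℕ) (θ : Fin k → S K n) (i : Fin k) :
    compV k n d θ i = homogeneousComponent d (θ i) := rfl

theorem compV_mem {k : ℕ} (d : ℕ) (θ : Fin k → S K n) : compV k n d θ ∈ homV K k n d :=
  mem_homV.2 fun _ => homogeneousComponent_isHomogeneous d _

theorem compV_of_mem {k d : ℕ} {θ : Fin k → S K n} (h : θ ∈ homV K k n d) :
    compV k n d θ = θ := by
  funext i
  exact homogeneousComponent_eq_self (mem_homV.1 h i)

theorem compV_smul_mem {k a : ℕ} (d : ℕ) {θ : Fin k → S K n} (h : θ ∈ homV K k n a)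
    (f : S K n) : compV k n d (f • θ) = shiftComp n a d f • θ := by
  funext i
  rw [compV_apply, Pi.smul_apply, smul_eq_mul, mul_comm,
    homogeneousComponent_mul_left d (mem_homV.1 h i), mul_comm]; rfl

theorem compV_hom_smul {k a : ℕ} (d : ℕ) {p : S K n} (hp : p.IsHomogeneous a)
    (θ : Fin k → S K n) :
    compV k n d (p • θ) = if a ≤ d then p • compV k n (d - a) θ else 0 := by
  funext i
  rw [compV_apply, Pi.smul_apply, smul_eq_mul, homogeneousComponent_mul_left d hp]
  unfold shiftComp
  split_ifs <;> simp [compV_apply]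

theorem exists_sum_compV {k : ℕ} (θ : Fin k → S K n) :
    ∃ N, ∀ N', N ≤ N' → θ = ∑ d ∈ Finset.range N', compV k n d θ := by
  refine ⟨(Finset.univ.sup fun i => (θ i).totalDegree) + 1, fun N' hN => ?_⟩
  funext i
  rw [Finset.sum_apply]
  simp only [compV_apply]
  have h1 := sum_homogeneousComponent (θ i)
  conv_lhs => rw [← h1]
  apply Finset.sum_subset
  · intro j hj
    have := Finset.le_sup (f := fun i => (θ i).totalDegree) (Finset.mem_univ i)
    simp at hj ⊢
    omega
  · intro j _ hj
    exact homogeneousComponent_eq_zero _ _ (by simpa using hj)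

theorem ev_homogeneousComponent (c : Fin n → K) (d : ℕ) (θ : Fin n → S K n) :
    ev c (compV n n d θ) = homogeneousComponent d (ev c θ) := by
  simp [ev_apply, compV_apply, homogeneousComponent_C_mul]

theorem ev_isHomogeneous (c : Fin n → K) {d : ℕ} {θ : Fin n → S K n}
    (h : θ ∈ homV K n n d) : (ev c θ).IsHomogeneous d := by
  rw [ev_apply]
  exact IsHomogeneous.sum _ _ _ fun i _ => (mem_homV.1 h i).C_mul _

theorem compV_mem_Dm {T : Finset (Fin n → K)} {m : (Fin n → K) → ℕ} {θ : Fin n → S K n}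
    (h : θ ∈ Dm T m) (d : ℕ) : compV n n d θ ∈ Dm T m := by
  intro c hc
  rw [ev_homogeneousComponent]
  exact dvd_homogeneousComponent (linForm_pow_isHomogeneous c _) (h c hc) d

/-- The homogeneous part of a module of vectors. -/
noncomputable def grV {k : ℕ} (W : Submodule (S K n) (Fin k → S K n)) (d : ℕ) :
    Submodule K (Fin k → S K n) := W.restrictScalars K ⊓ homV K k n d

instance finite_grV {k : ℕ} (W : Submodule (S K n) (Fin k → S K n)) (d : ℕ) :
    Module.Finite K (grV W d) :=
  Module.Finite.of_injective (Submodule.inclusion (inf_le_right : grV W d ≤ homV K k n d))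
    (Submodule.inclusion_injective _)

/-- The Hilbert function. -/
noncomputable def HF {k : ℕ} (W : Submodule (S K n) (Fin k → S K n)) (d : ℕ) : ℕ :=
  Module.finrank K (grV W d)

/-- `b` is a homogeneous basis of `W` with degrees `a`. -/
def IsHBasis {k : ℕ} {ι : Type*} [Fintype ι] (W : Submodule (S K n) (Fin k → S K n))
    (a : ι → ℕ) (b : ι → Fin k → S K n) : Prop :=
  (∀ i, b i ∈ W ∧ b i ∈ homV K k n (a i)) ∧
    ∀ v ∈ W, ∃! f : ι → S K n, v = ∑ i, f i • b i

theorem IsHBasis.HF_eq {k : ℕ} {ι : Type*} [Fintype ι] {W : Submodule (S K n) (Fin k → S K n)}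
    {a : ι → ℕ} {b : ι → Fin k → S K n} (h : IsHBasis W a b) (d : ℕ) :
    HF W d = ∑ i, hs n (a i) d := by
  let F : ((i : ι) → shiftHom K n (a i) d) →ₗ[K] grV W d :=
    { toFun := fun f => ⟨∑ i, (f i : S K n) • b i, by
        refine ⟨W.sum_mem fun i _ => W.smul_mem _ (h.1 i).1, mem_homV.2 fun j => ?_⟩
        rw [Finset.sum_apply]
        refine IsHomogeneous.sum _ _ _ fun i _ => ?_
        rw [Pi.smul_apply, smul_eq_mul, mul_comm]
        have := mul_mem_shiftHom (a := 0) (d := d) (mem_homV.1 (h.1 i).2 j)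
          (by rw [zero_add]; exact (f i).2)
        rwa [shiftHom_zero] at this⟩
      map_add' := fun f g => by
        ext1; simp [add_smul, Finset.sum_add_distrib]
      map_smul' := fun c f => by
        ext1; simp [Finset.smul_sum] }
  have hinj : Function.Injective F := by
    intro f g hfg
    obtain ⟨u, _, hu⟩ := h.2 _ (F f).2.1
    have h1 := hu (fun i => f i) rfl
    have h2 := hu (fun i => g i) (by rw [hfg]; rfl)
    funext i
    ext1
    exact (congrFun h1 i).trans (congrFun h2 i).symm
  have hsurj : Function.Surjective F := by
    rintro ⟨v, hv, hvd⟩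
    obtain ⟨u, hu, _⟩ := h.2 v hv
    refine ⟨fun i => ⟨shiftComp n (a i) d (u i), shiftComp_mem _ _ _ _⟩, ?_⟩
    ext1
    change ∑ i, shiftComp n (a i) d (u i) • b i = v
    rw [← compV_of_mem hvd, hu, map_sum]
    exact Finset.sum_congr rfl fun i _ => (compV_smul_mem d (h.1 i).2 _).symm
  have := (LinearEquiv.ofBijective F ⟨hinj, hsurj⟩).finrank_eq
  rw [HF, ← this, Module.finrank_pi_fintype]
  exact Finset.sum_congr rfl fun i _ => finrank_shiftHom _ _ _

end

section

variable {n : ℕ}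

/-- The coefficient vector of a derivation. -/
noncomputable def derVec (θ : Der K n) : Fin n → S K n := fun i => θ (X i)

theorem der_linForm (θ : Der K n) (c : Fin n → K) : θ (linForm c) = ev c (derVec θ) := by
  simp [linForm, ev_apply, derVec, Derivation.leibniz]

theorem derVec_mkDerivation (v : Fin n → S K n) : derVec (mkDerivation K v) = v := by
  funext i; simp [derVec]

theorem derVec_injective : Function.Injective (derVec : Der K n → _) := by
  intro θ η h
  exact derivation_ext fun i => congrFun h i

theorem derVec_sum_smul {ι : Type*} (s : Finset ι) (f : ι → S K n) (θ : ι → Der K n) :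
    derVec (∑ i ∈ s, f i • θ i) = ∑ i ∈ s, f i • derVec (θ i) := by
  funext j
  induction s using Finset.induction_on with
  | empty => simp [derVec]
  | insert a s ha ih =>
    rw [Finset.sum_insert ha, Finset.sum_insert ha, Pi.add_apply, ← ih]
    simp [derVec]

theorem isLogDer_iff (A : Arrangement K n) (m : (Fin n → K) → ℕ) (θ : Der K n) :
    IsLogDer A m θ ↔ derVec θ ∈ Dm A.hyps m := by
  simp [IsLogDer, mem_Dm, der_linForm]

theorem isHomogOfDeg_iff (θ : Der K n) (d : ℕ) : IsHomogOfDeg θ d ↔ derVec θ ∈ homV K n n d := by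
  rw [mem_homV]
  constructor
  · intro h i
    have := h (Pi.single i 1)
    rwa [der_linForm, ev_single] at this
  · intro h c
    rw [der_linForm]
    exact ev_isHomogeneous c (mem_homV.2 h)

theorem isFreeWithExp_iff (A : Arrangement K n) (m : (Fin n → K) → ℕ) (d : Fin n → ℕ) :
    IsFreeWithExp A m d ↔ ∃ b, IsHBasis (Dm A.hyps m) d b := by
  constructor
  · rintro ⟨θ, hd, hl, hu⟩
    refine ⟨fun i => derVec (θ i), fun i => ⟨(isLogDer_iff A m _).1 (hl i),
      (isHomogOfDeg_iff _ _).1 (hd i)⟩, fun v hv => ?_⟩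
    obtain ⟨f, hf, hf'⟩ := hu (mkDerivation K v)
      ((isLogDer_iff A m _).2 (by rwa [derVec_mkDerivation]))
    refine ⟨f, ?_, fun g hg => hf' g (derVec_injective ?_)⟩
    · have := congrArg derVec hf
      rwa [derVec_mkDerivation, derVec_sum_smul] at this
    · rw [derVec_mkDerivation, derVec_sum_smul]; exact hg
  · rintro ⟨b, hb, hu⟩
    refine ⟨fun i => mkDerivation K (b i), fun i => ?_, fun i => ?_, fun η hη => ?_⟩
    · rw [isHomogOfDeg_iff, derVec_mkDerivation]; exact (hb i).2
    · rw [isLogDer_iff, derVec_mkDerivation]; exact (hb i).1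
    · obtain ⟨f, hf, hf'⟩ := hu _ ((isLogDer_iff A m _).1 hη)
      refine ⟨f, derVec_injective ?_, fun g hg => hf' g ?_⟩
      · rw [derVec_sum_smul]; simpa [derVec_mkDerivation] using hf
      · have := congrArg derVec hg
        simpa [derVec_sum_smul, derVec_mkDerivation] using this

/-! ### Restriction to a hyperplane -/

/-- Coordinates adapted to the hyperplane `ker c₀`. -/
structure StepData (c₀ : Fin (n+1) → K) where
  emb : Fin n → Fin (n+1) → K
  crd : Fin n → Fin (n+1) → K
  vec : Fin (n+1) → K
  emb_ker : ∀ j, ∑ i, c₀ i * emb j i = 0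
  vec_one : ∑ i, c₀ i * vec i = 1
  crd_vec : ∀ j, ∑ i, crd j i * vec i = 0
  crd_emb : ∀ j k, ∑ i, crd j i * emb k i = if j = k then 1 else 0
  split : ∀ i k, ∑ j, emb j i * crd j k + vec i * c₀ k = if i = k then 1 else 0

namespace StepData

variable {c₀ : Fin (n+1) → K} (D : StepData c₀)

/-- Restriction of covectors. -/
def res (c : Fin (n+1) → K) : Fin n → K := fun j => ∑ i, c i * D.emb j i

theorem res_add (c c' : Fin (n+1) → K) : D.res (c + c') = D.res c + D.res c' := by
  funext j; simp [res, add_mul, Finset.sum_add_distrib]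

theorem res_smul (a : K) (c : Fin (n+1) → K) : D.res (a • c) = a • D.res c := by
  funext j; simp [res, Finset.mul_sum, mul_assoc]

theorem res_self : D.res c₀ = 0 := by
  funext j; exact D.emb_ker j

theorem res_crd (j : Fin n) : D.res (D.crd j) = Pi.single j 1 := by
  funext k
  rw [res, D.crd_emb, Pi.single_apply]
  simp [eq_comm]

/-- A covector is recovered from its restriction up to a multiple of `c₀`. -/
theorem eq_sum_res (c : Fin (n+1) → K) :
    c = ∑ j, D.res c j • D.crd j + (∑ i, c i * D.vec i) • c₀ := by
  funext k
  have h : c k = ∑ i, c i * (if i = k then 1 else 0) := by simp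
  rw [h]
  simp_rw [← D.split, mul_add, Finset.sum_add_distrib, Finset.mul_sum]
  simp only [Pi.add_apply, Finset.sum_apply, Pi.smul_apply, smul_eq_mul, res, Finset.sum_mul]
  rw [Finset.sum_comm]
  simp [mul_assoc]

theorem res_eq_zero_iff (c : Fin (n+1) → K) : D.res c = 0 ↔ ∃ a : K, c = a • c₀ := by
  constructor
  · intro h
    refine ⟨∑ i, c i * D.vec i, ?_⟩
    have := D.eq_sum_res c
    rw [h] at this
    simpa using this
  · rintro ⟨a, rfl⟩
    rw [res_smul, res_self, smul_zero]

/-- Restriction of polynomials. -/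
noncomputable def r : S K (n+1) →ₐ[K] S K n := aeval fun i => ∑ j, C (D.emb j i) * X j

/-- The section of `r`. -/
noncomputable def sec : S K n →ₐ[K] S K (n+1) := aeval fun j => linForm (D.crd j)

theorem r_C (a : K) : D.r (C a) = C a := by simp [r, algHom_C]

theorem r_linForm (c : Fin (n+1) → K) : D.r (linForm c) = linForm (D.res c) := by
  simp only [linForm, map_sum, map_mul, r, algHom_C, aeval_X, res, algebraMap_eq,
    Finset.sum_mul, Finset.mul_sum]
  rw [Finset.sum_comm]
  simp [mul_assoc]

theorem r_self : D.r (linForm c₀) = 0 := by rw [r_linForm, res_self, linForm_zero]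

theorem linForm_single (j : Fin n) : linForm (Pi.single j 1 : Fin n → K) = X j := by
  rw [linForm, Finset.sum_eq_single j]
  · simp
  · intro k _ hk; simp [hk]
  · simp

theorem r_sec (p : S K n) : D.r (D.sec p) = p := by
  have : D.r.comp D.sec = AlgHom.id K _ := by
    apply algHom_ext
    intro j
    simp [sec, r_linForm, res_crd, linForm_single]
  exact congrArg (fun f => f p) this

theorem self_dvd_sub (f : S K (n+1)) : linForm c₀ ∣ f - D.sec (D.r f) := by
  rw [← Ideal.mem_span_singleton, ← Ideal.Quotient.eq]
  have : (Ideal.Quotient.mkₐ K (Ideal.span {linForm c₀})).comp (AlgHom.id K (S K (n+1)))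
      = (Ideal.Quotient.mkₐ K (Ideal.span {linForm c₀})).comp (D.sec.comp D.r) := by
    apply algHom_ext
    intro i
    change Ideal.Quotient.mk _ _ = Ideal.Quotient.mk _ _
    rw [Ideal.Quotient.eq, Ideal.mem_span_singleton]
    refine ⟨C (D.vec i), ?_⟩
    have h := D.eq_sum_res (Pi.single i 1)
    have h2 : ∀ s : Finset (Fin n), linForm (∑ j ∈ s, D.res (Pi.single i 1) j • D.crd j) =
        ∑ j ∈ s, C (D.emb j i) * linForm (D.crd j) := by
      intro s
      induction s using Finset.induction_on with
      | empty => simp [linForm_zero]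
      | insert a s ha ih =>
        rw [Finset.sum_insert ha, Finset.sum_insert ha, linForm_add, ih, linForm_smul]
        congr 3
        simp [res, Pi.single_apply]
    have h3 := congrArg linForm h
    rw [linForm_add, h2, linForm_single, linForm_smul] at h3
    change X i - D.sec (D.r (X i)) = _
    have h4 : D.sec (D.r (X i)) = ∑ j, C (D.emb j i) * linForm (D.crd j) := by
      simp [r, sec, algHom_C]
    rw [h4, h3]
    simp [Pi.single_apply, mul_comm]
  exact congrArg (fun g => g f) this

theorem r_eq_zero_iff (f : S K (n+1)) : D.r f = 0 ↔ linForm c₀ ∣ f := by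
  constructor
  · intro h
    simpa [h] using D.self_dvd_sub f
  · rintro ⟨g, rfl⟩
    rw [map_mul, r_self, zero_mul]

theorem r_isHomogeneous {f : S K (n+1)} {d : ℕ} (h : f.IsHomogeneous d) :
    (D.r f).IsHomogeneous d := by
  have := h.aeval (fun i => ∑ j, C (D.emb j i) * X j : Fin (n+1) → S K n) (n := 1)
    fun i => IsHomogeneous.sum _ _ _ fun j _ => isHomogeneous_C_mul_X _ _
  simpa [r] using this

theorem sec_isHomogeneous {f : S K n} {d : ℕ} (h : f.IsHomogeneous d) :
    (D.sec f).IsHomogeneous d := by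
  have := h.aeval (fun j => linForm (D.crd j)) (n := 1) fun j => linForm_isHomogeneous _
  simpa [sec] using this

theorem r_homogeneousComponent (d : ℕ) (f : S K (n+1)) :
    D.r (homogeneousComponent d f) = homogeneousComponent d (D.r f) := by
  conv_rhs => rw [← sum_homogeneousComponent f, map_sum, map_sum]
  have : ∀ i, homogeneousComponent d (D.r (homogeneousComponent i f)) =
      if i = d then D.r (homogeneousComponent i f) else 0 := by
    intro i
    rw [homogeneousComponent_of_mem (D.r_isHomogeneous (homogeneousComponent_isHomogeneous i f))]
    split_ifs with h1 h2 h2 <;> first | rfl | (exfalso; omega)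
  simp_rw [this]
  rw [Finset.sum_ite_eq' (Finset.range (f.totalDegree + 1)) d]
  split_ifs with h
  · rfl
  · rw [homogeneousComponent_eq_zero _ _ (by simpa using h), map_zero]

/-- Restriction of vector fields (tangential part). -/
noncomputable def π (θ : Fin (n+1) → S K (n+1)) : Fin n → S K n :=
  fun j => D.r (ev (D.crd j) θ)

theorem π_add (θ η : Fin (n+1) → S K (n+1)) : D.π (θ + η) = D.π θ + D.π η := by
  funext j; simp [π]

theorem π_smul (f : S K (n+1)) (θ : Fin (n+1) → S K (n+1)) : D.π (f • θ) = D.r f • D.π θ := by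
  funext j; simp [π]

theorem π_sub (θ η : Fin (n+1) → S K (n+1)) : D.π (θ - η) = D.π θ - D.π η := by
  funext j; simp [π]

theorem ev_sum_smul {ι : Type*} (s : Finset ι) (a : ι → K) (c : ι → Fin n → K)
    (θ : Fin n → S K n) : ev (∑ j ∈ s, a j • c j) θ = ∑ j ∈ s, C (a j) * ev (c j) θ := by
  induction s using Finset.induction_on with
  | empty => simp [ev_apply]
  | insert a s ha ih => rw [Finset.sum_insert ha, Finset.sum_insert ha, ev_add, ih, ev_smul]

theorem r_ev (c : Fin (n+1) → K) (θ : Fin (n+1) → S K (n+1)) :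
    D.r (ev c θ) = ev (D.res c) (D.π θ) + C (∑ i, c i * D.vec i) * D.r (ev c₀ θ) := by
  conv_lhs => rw [D.eq_sum_res c]
  rw [ev_add, ev_smul, ev_sum_smul, map_add, map_mul, map_sum, ev_apply (D.res c)]
  simp only [π, map_mul, r_C]

end StepData

theorem toFunc_apply (c v : Fin n → K) : toFunc c v = ∑ i, c i * v i := by
  simp [toFunc]

theorem exists_stepData {c₀ : Fin (n+1) → K} (h0 : c₀ ≠ 0)
    (e : ↥(LinearMap.ker (toFunc c₀)) ≃ₗ[K] (Fin n → K)) :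
    ∃ D : StepData c₀, ∀ c, D.res c = resCov c₀ e c := by
  obtain ⟨i₀, hi₀⟩ := Function.ne_iff.1 h0
  let w : Fin (n+1) → K := Pi.single i₀ (c₀ i₀)⁻¹
  have hw : toFunc c₀ w = 1 := by
    rw [toFunc_apply, Finset.sum_eq_single i₀]
    · simp [w, mul_inv_cancel₀ hi₀]
    · intro j _ hj; simp [w, hj]
    · simp
  let pr : (Fin (n+1) → K) →ₗ[K] ↥(LinearMap.ker (toFunc c₀)) :=
    LinearMap.codRestrict _ (LinearMap.id - (toFunc c₀).smulRight w) (by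
      intro v; simp [hw])
  have hprv : ∀ v, (pr v : Fin (n+1) → K) = v - toFunc c₀ v • w := fun v => rfl
  have hpr : ∀ v : ↥(LinearMap.ker (toFunc c₀)), pr v = v := by
    intro v
    ext1
    have := v.2
    rw [LinearMap.mem_ker] at this
    simp [hprv, this]
  have hprw : pr w = 0 := by ext1; simp [hprv, hw]
  let F : (Fin (n+1) → K) →ₗ[K] (Fin n → K) := e.toLinearMap ∘ₗ pr
  have hF : ∀ v j, ∑ i, F (Pi.single i 1) j * v i = F v j := by
    intro v j
    have : v = ∑ i, v i • (Pi.single i 1 : Fin (n+1) → K) := by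
      rw [← pi_eq_sum_univ' v]
    conv_rhs => rw [this]
    rw [map_sum, Finset.sum_apply]
    exact Finset.sum_congr rfl fun i _ => by simp [mul_comm]
  refine ⟨{
    emb := fun j => (e.symm (Pi.single j 1) : ↥(LinearMap.ker (toFunc c₀)))
    crd := fun j i => F (Pi.single i 1) j
    vec := w
    emb_ker := fun j => ?_
    vec_one := by rw [← toFunc_apply]; exact hw
    crd_vec := fun j => ?_
    crd_emb := fun j k => ?_
    split := fun i k => ?_ }, fun c => ?_⟩
  · rw [← toFunc_apply]
    exact (e.symm (Pi.single j 1)).2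
  · rw [hF]; simp [F, hprw]
  · rw [hF]
    simp [F, hpr, Pi.single_apply]
  · have h1 : ∀ u : Fin n → K, ∑ j, ((e.symm (Pi.single j 1) :
        ↥(LinearMap.ker (toFunc c₀))) : Fin (n+1) → K) i * u j = (e.symm u).1 i := by
      intro u
      have : u = ∑ i, u i • (Pi.single i 1 : Fin n → K) := by
        rw [← pi_eq_sum_univ' u]
      conv_rhs => rw [this]
      rw [map_sum, Submodule.coe_sum, Finset.sum_apply]
      exact Finset.sum_congr rfl fun i _ => by simp [mul_comm]
    rw [h1]
    simp only [F, LinearMap.comp_apply, LinearEquiv.coe_coe, LinearEquiv.symm_apply_apply]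
    rw [hprv]
    simp [toFunc_apply, Pi.single_apply, mul_comm]
  · funext j
    simp [StepData.res, resCov, toFunc_apply]

theorem ker_toFunc_equiv {c₀ : Fin (n+1) → K} (h0 : c₀ ≠ 0) :
    Nonempty (↥(LinearMap.ker (toFunc c₀)) ≃ₗ[K] (Fin n → K)) := by
  apply FiniteDimensional.nonempty_linearEquiv_of_finrank_eq
  have h1 := LinearMap.finrank_range_add_finrank_ker (toFunc c₀)
  have h2 : LinearMap.range (toFunc c₀) = ⊤ := by
    rw [LinearMap.range_eq_top]
    apply LinearMap.surjective
    intro h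
    apply h0
    funext i
    have := LinearMap.congr_fun h (Pi.single i 1)
    rw [toFunc_apply] at this
    simpa [Pi.single_apply] using this
  rw [h2] at h1
  simp at h1 ⊢
  omega

end

section

variable {n : ℕ}

/-! ### Pairs consisting of a polynomial and a vector -/

/-- Homogeneous pairs, the first entry being shifted by `a`. -/
noncomputable def homP (K : Type*) [Field K] (k n a d : ℕ) :
    Submodule K (S K n × (Fin k → S K n)) :=
  (shiftHom K n a d).prod (homV K k n d)

/-- Homogeneous components of pairs. -/
noncomputable def compP (k n a d : ℕ) :
    (S K n × (Fin k → S K n)) →ₗ[K] (S K n × (Fin k → S K n)) :=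
  (shiftComp n a d).prodMap (compV k n d)

theorem compP_mem {k : ℕ} (a d : ℕ) (v : S K n × (Fin k → S K n)) :
    compP k n a d v ∈ homP K k n a d :=
  ⟨shiftComp_mem _ _ _ _, compV_mem _ _⟩

theorem compP_of_mem {k a d : ℕ} {v : S K n × (Fin k → S K n)} (h : v ∈ homP K k n a d) :
    compP k n a d v = v :=
  Prod.ext (shiftComp_of_mem h.1) (compV_of_mem h.2)

theorem exists_sum_compP {k : ℕ} (a : ℕ) (v : S K n × (Fin k → S K n)) :
    ∃ N, ∀ N', N ≤ N' → v = ∑ d ∈ Finset.range N', compP k n a d v := by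
  obtain ⟨N, hN⟩ := exists_sum_compV v.2
  refine ⟨max N (v.1.totalDegree + 1 + a), fun N' hN' => Prod.ext ?_ ?_⟩
  · have h1 := sum_homogeneousComponent v.1
    rw [Prod.fst_sum]
    change v.1 = ∑ d ∈ Finset.range N', shiftComp n a d v.1
    obtain ⟨t, rfl⟩ : ∃ t, N' = a + t := ⟨N' - a, by omega⟩
    rw [Finset.sum_range_add]
    rw [Finset.sum_eq_zero (s := Finset.range a)]
    · rw [zero_add]
      have : ∀ i, shiftComp n a (a + i) v.1 = homogeneousComponent i v.1 := by
        intro i; simp [shiftComp]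
      simp_rw [this]
      conv_lhs => rw [← h1]
      apply Finset.sum_subset
      · intro j hj; simp at hj ⊢; omega
      · intro j _ hj; exact homogeneousComponent_eq_zero _ _ (by simpa using hj)
    · intro d hd
      simp at hd
      simp [shiftComp, Nat.not_le.2 hd]
  · rw [Prod.snd_sum]
    exact hN N' (le_trans (le_max_left _ _) hN')

/-- The homogeneous parts of a module of pairs. -/
noncomputable def grP {k : ℕ} (W : Submodule (S K n) (S K n × (Fin k → S K n))) (a d : ℕ) :
    Submodule K (S K n × (Fin k → S K n)) := W.restrictScalars K ⊓ homP K k n a d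

/-- A product of submodules is the product of the underlying modules. -/
def prodSubEquiv {M N : Type*} [AddCommGroup M] [Module K M] [AddCommGroup N] [Module K N]
    (p : Submodule K M) (q : Submodule K N) : p.prod q ≃ₗ[K] p × q where
  toFun v := (⟨v.1.1, v.2.1⟩, ⟨v.1.2, v.2.2⟩)
  invFun v := ⟨(v.1.1, v.2.1), v.1.2, v.2.2⟩
  map_add' _ _ := rfl
  map_smul' _ _ := rfl

instance finite_homP (k n a d : ℕ) : Module.Finite K (homP K k n a d) :=
  Module.Finite.equiv (prodSubEquiv (shiftHom K n a d) (homV K k n d)).symm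

instance finite_grP {k : ℕ} (W : Submodule (S K n) (S K n × (Fin k → S K n))) (a d : ℕ) :
    Module.Finite K (grP W a d) :=
  Module.Finite.of_injective (Submodule.inclusion (inf_le_right : grP W a d ≤ homP K k n a d))
    (Submodule.inclusion_injective _)

theorem finrank_grP_prod {k : ℕ} (W : Submodule (S K n) (Fin k → S K n)) (a d : ℕ) :
    Module.finrank K (grP ((⊤ : Submodule (S K n) (S K n)).prod W) a d) = hs n a d + HF W d := by
  have h : grP ((⊤ : Submodule (S K n) (S K n)).prod W) a d
      = (shiftHom K n a d).prod (grV W d) := by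
    ext v
    constructor
    · rintro ⟨h1, h2⟩
      exact ⟨h2.1, h1.2, h2.2⟩
    · rintro ⟨h1, h2⟩
      exact ⟨⟨trivial, h2.1⟩, h1, h2.2⟩
  rw [h, (prodSubEquiv _ _).finrank_eq, Module.finrank_prod, finrank_shiftHom, HF]

/-- The data of a restriction step: a multiarrangement, a hyperplane, its restriction, and
auxiliary elements describing the restriction map of logarithmic vector fields. -/
structure Step (T : Finset (Fin (n+1) → K)) (m : (Fin (n+1) → K) → ℕ) (c₀ : Fin (n+1) → K)
    (TB : Finset (Fin n → K)) (mB : (Fin n → K) → ℕ) where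
  D : StepData c₀
  mem : c₀ ∈ T
  pos : 0 < m c₀
  ne_zero : ∀ c ∈ T, c ≠ 0
  nonparallel : ∀ c ∈ T, ∀ c' ∈ T, c ≠ c' → ∀ t : K, c' ≠ t • c
  τ : Fin (n+1) → S K (n+1)
  q : (Fin (n+1) → K) → S K (n+1)
  τ_hom : τ ∈ homV K (n+1) (n+1) (m c₀)
  τ_self : linForm c₀ ∣ ev c₀ τ
  q_mod : ∀ c ∈ T.erase c₀, linForm c₀ ∣ q c - ev c τ
  q_dvd : ∀ c ∈ T.erase c₀, ∀ c' ∈ T.erase c₀, ∀ u a : K, c' = u • c + a • c₀ →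
    linForm c' ^ m c' ∣ C u * q c + C a * linForm c₀ ^ m c₀
  restr : ∀ b ∈ TB, ∃ c ∈ T.erase c₀, ∃ t : K, t ≠ 0 ∧ D.res c = t • b ∧
    mB b = ∑ c' ∈ (T.erase c₀).filter (· ∈ Submodule.span K ({c₀, c} : Set (Fin (n+1) → K))), m c'

namespace Step

variable {T : Finset (Fin (n+1) → K)} {m : (Fin (n+1) → K) → ℕ} {c₀ : Fin (n+1) → K}
  {TB : Finset (Fin n → K)} {mB : (Fin n → K) → ℕ} (P : Step T m c₀ TB mB)

theorem x_prime (P : Step T m c₀ TB mB) : Prime (linForm c₀) :=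
  linForm_prime (P.ne_zero _ P.mem)

/-- Logarithmic vector fields `θ` together with `θ(α₀) / α₀ ^ m(α₀)`. -/
noncomputable def M (T : Finset (Fin (n+1) → K)) (m : (Fin (n+1) → K) → ℕ)
    (c₀ : Fin (n+1) → K) :
    Submodule (S K (n+1)) (S K (n+1) × (Fin (n+1) → S K (n+1))) where
  carrier := {v | v.2 ∈ Dm T m ∧ linForm c₀ ^ m c₀ * v.1 = ev c₀ v.2}
  add_mem' := fun ha hb => ⟨Submodule.add_mem _ ha.1 hb.1, by
    simp [mul_add, ha.2, hb.2]⟩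
  zero_mem' := ⟨Submodule.zero_mem _, by simp⟩
  smul_mem' := fun s a ha => ⟨Submodule.smul_mem _ _ ha.1, by
    simp [← ha.2, mul_left_comm]⟩

theorem mem_M {v : S K (n+1) × (Fin (n+1) → S K (n+1))} :
    v ∈ M T m c₀ ↔ v.2 ∈ Dm T m ∧ linForm c₀ ^ m c₀ * v.1 = ev c₀ v.2 := Iff.rfl

theorem exists_mem_M (P : Step T m c₀ TB mB) {θ : Fin (n+1) → S K (n+1)} (h : θ ∈ Dm T m) :
    ∃ f, (f, θ) ∈ M T m c₀ := by
  obtain ⟨f, hf⟩ := h c₀ P.mem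
  exact ⟨f, h, hf.symm⟩

theorem compP_mem_M {v : S K (n+1) × (Fin (n+1) → S K (n+1))} (h : v ∈ M T m c₀) (d : ℕ) :
    compP (n+1) (n+1) (m c₀) d v ∈ M T m c₀ := by
  refine ⟨compV_mem_Dm h.1 d, ?_⟩
  change linForm c₀ ^ m c₀ * shiftComp (n+1) (m c₀) d v.1 = ev c₀ (compV _ _ d v.2)
  rw [ev_homogeneousComponent, ← h.2,
    homogeneousComponent_mul_left d (linForm_pow_isHomogeneous c₀ _)]

theorem M_fst_eq (P : Step T m c₀ TB mB) {v w : S K (n+1) × (Fin (n+1) → S K (n+1))}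
    (hv : v ∈ M T m c₀) (hw : w ∈ M T m c₀) (h : v.2 = w.2) : v = w := by
  refine Prod.ext (mul_left_cancel₀ (pow_ne_zero (m c₀) P.x_prime.ne_zero) ?_) h
  rw [hv.2, hw.2, h]

theorem finrank_grP_M (P : Step T m c₀ TB mB) (d : ℕ) :
    Module.finrank K (grP (M T m c₀) (m c₀) d) = HF (Dm T m) d := by
  let F : grP (M T m c₀) (m c₀) d →ₗ[K] grV (Dm T m) d :=
    { toFun := fun v => ⟨v.1.2, v.2.1.1, v.2.2.2⟩
      map_add' := fun _ _ => rfl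
      map_smul' := fun _ _ => rfl }
  refine (LinearEquiv.ofBijective F ⟨?_, ?_⟩).finrank_eq
  · intro v w h
    ext1
    exact P.M_fst_eq v.2.1 w.2.1 (congrArg Subtype.val h)
  · rintro ⟨θ, hθ, hd⟩
    obtain ⟨f, hf⟩ := P.exists_mem_M hθ
    refine ⟨⟨compP _ _ (m c₀) d (f, θ), compP_mem_M hf d, compP_mem _ _ _⟩, ?_⟩
    ext1
    exact compV_of_mem hd

/-- The restriction map. -/
noncomputable def ρ : (S K (n+1) × (Fin (n+1) → S K (n+1))) →ₗ[K] (S K n × (Fin n → S K n)) where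
  toFun v := (P.D.r v.1, P.D.π (v.2 - v.1 • P.τ))
  map_add' v w := Prod.ext (map_add _ _ _) (by
    change P.D.π (v.2 + w.2 - (v.1 + w.1) • P.τ) =
      P.D.π (v.2 - v.1 • P.τ) + P.D.π (w.2 - w.1 • P.τ)
    rw [← P.D.π_add, add_smul]; congr 1; abel)
  map_smul' a v := Prod.ext (map_smul _ _ _) (by
    change P.D.π (a • v.2 - (a • v.1) • P.τ) = a • P.D.π (v.2 - v.1 • P.τ)
    have : a • v.2 - (a • v.1) • P.τ = (C a : S K (n+1)) • (v.2 - v.1 • P.τ) := by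
      rw [smul_sub, smul_smul, ← C_mul']
      congr 1
      funext i; simp [C_mul']
    rw [this, P.D.π_smul, P.D.r_C]
    funext i; simp [C_mul'])

theorem ρ_smul (s : S K (n+1)) (v : S K (n+1) × (Fin (n+1) → S K (n+1))) :
    P.ρ (s • v) = P.D.r s • P.ρ v := by
  refine Prod.ext (map_mul _ _ _) ?_
  change P.D.π (s • v.2 - (s * v.1) • P.τ) = P.D.r s • P.D.π (v.2 - v.1 • P.τ)
  rw [← P.D.π_smul, smul_sub, smul_smul]

theorem π_compV (D : StepData c₀) (d : ℕ) (θ : Fin (n+1) → S K (n+1)) :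
    D.π (compV _ _ d θ) = compV _ _ d (D.π θ) := by
  funext j
  simp [StepData.π, compV_apply, ev_homogeneousComponent, D.r_homogeneousComponent]

theorem ρ_compP (d : ℕ) (v : S K (n+1) × (Fin (n+1) → S K (n+1))) :
    P.ρ (compP _ _ (m c₀) d v) = compP _ _ (m c₀) d (P.ρ v) := by
  have h1 : P.D.r (shiftComp (n+1) (m c₀) d v.1) = shiftComp n (m c₀) d (P.D.r v.1) := by
    unfold shiftComp
    split_ifs
    · exact P.D.r_homogeneousComponent _ _
    · simp
  refine Prod.ext h1 ?_
  change P.D.π (compV _ _ d v.2 - (shiftComp _ _ d v.1) • P.τ) =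
    compV _ _ d (P.D.π (v.2 - v.1 • P.τ))
  rw [← compV_smul_mem d P.τ_hom, ← map_sub, π_compV]

theorem ρ_mem_homP {d : ℕ} {v : S K (n+1) × (Fin (n+1) → S K (n+1))}
    (h : v ∈ homP K (n+1) (n+1) (m c₀) d) : P.ρ v ∈ homP K n n (m c₀) d := by
  rw [← compP_of_mem h, ρ_compP]; exact compP_mem _ _ _

/-- The target of the restriction map. -/
noncomputable def G (TB : Finset (Fin n → K)) (mB : (Fin n → K) → ℕ) :
    Submodule (S K n) (S K n × (Fin n → S K n)) := (⊤ : Submodule _ _).prod (Dm TB mB)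

theorem mem_span_pair_iff {c c' : Fin (n+1) → K} :
    c' ∈ Submodule.span K ({c₀, c} : Set (Fin (n+1) → K)) ↔ ∃ u a : K, c' = u • c + a • c₀ := by
  rw [Submodule.mem_span_pair]
  constructor
  · rintro ⟨a, u, h⟩; exact ⟨u, a, by rw [← h]; abel⟩
  · rintro ⟨u, a, h⟩; exact ⟨a, u, by rw [h]; abel⟩

theorem coeff_ne_zero (P : Step T m c₀ TB mB) {c c' : Fin (n+1) → K} (hc' : c' ∈ T.erase c₀)
    {u a : K} (h : c' = u • c + a • c₀) : u ≠ 0 := by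
  rintro rfl
  refine P.nonparallel c₀ P.mem c' (Finset.mem_of_mem_erase hc')
    (Finset.ne_of_mem_erase hc').symm a ?_
  rw [h, zero_smul, zero_add]

theorem ρ_mem_G {v : S K (n+1) × (Fin (n+1) → S K (n+1))} (hv : v ∈ M T m c₀) :
    P.ρ v ∈ G TB mB := by
  refine ⟨trivial, fun b hb => ?_⟩
  obtain ⟨c, hc, t, ht, hres, hm⟩ := P.restr b hb
  obtain ⟨hθ, hf⟩ := mem_M.1 hv
  set θ := v.2
  set f := v.1
  set L := (T.erase c₀).filter (· ∈ Submodule.span K ({c₀, c} : Set (Fin (n+1) → K))) with hL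
  have hdvd : ∏ c' ∈ L, linForm c' ^ m c' ∣ ev c θ - f * P.q c := by
    apply Finset.prod_dvd_of_isRelPrime
    · intro c' hc' c'' hc'' hne
      have h1 := Finset.mem_of_mem_erase (Finset.mem_filter.1 hc').1
      have h2 := Finset.mem_of_mem_erase (Finset.mem_filter.1 hc'').1
      exact isRelPrime_linForm_pow (P.ne_zero _ h1) (P.nonparallel _ h1 _ h2 hne) _ _
    · intro c' hc'
      obtain ⟨hc'e, hsp⟩ := Finset.mem_filter.1 hc'
      obtain ⟨u, a, hua⟩ := mem_span_pair_iff.1 hsp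
      have hu := P.coeff_ne_zero hc'e hua
      have h1 := hθ c' (Finset.mem_of_mem_erase hc'e)
      have h2 := P.q_dvd c hc c' hc'e u a hua
      have h3 : ev c' θ = C u * ev c θ + C a * (linForm c₀ ^ m c₀ * f) := by
        rw [hf, ← ev_smul, ← ev_smul, ← ev_add, ← hua]
      have h4 : linForm c' ^ m c' ∣ C u * (ev c θ - f * P.q c) := by
        have := dvd_sub h1 (h2.mul_left f)
        rw [h3] at this
        convert this using 1; ring
      have h5 : ev c θ - f * P.q c = C u⁻¹ * (C u * (ev c θ - f * P.q c)) := by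
        rw [← mul_assoc, ← C_mul, inv_mul_cancel₀ hu, C_1, one_mul]
      rw [h5]
      exact h4.mul_left _
  have hr : P.D.r (ev c (θ - f • P.τ)) = P.D.r (ev c θ - f * P.q c) := by
    rw [← sub_eq_zero, ← map_sub, P.D.r_eq_zero_iff, map_sub, map_smul, smul_eq_mul]
    have := (P.q_mod c hc).mul_left f
    convert this using 1; ring
  have hr0 : P.D.r (ev c₀ (θ - f • P.τ)) = 0 := by
    rw [P.D.r_eq_zero_iff, map_sub, map_smul, smul_eq_mul, ← hf]
    exact dvd_sub (Dvd.dvd.mul_right (dvd_pow_self _ P.pos.ne') _) (P.τ_self.mul_left _)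
  have hev : ev (P.D.res c) (P.D.π (θ - f • P.τ)) = P.D.r (ev c θ - f * P.q c) := by
    have := P.D.r_ev c (θ - f • P.τ)
    rw [hr0, mul_zero, add_zero] at this
    rw [← this, hr]
  have hd2 : linForm b ^ mB b ∣ P.D.r (∏ c' ∈ L, linForm c' ^ m c') := by
    rw [map_prod, hm, ← Finset.prod_pow_eq_pow_sum]
    apply Finset.prod_dvd_prod_of_dvd
    intro c' hc'
    rw [map_pow]
    apply pow_dvd_pow_of_dvd
    obtain ⟨u, a, hua⟩ := mem_span_pair_iff.1 (Finset.mem_filter.1 hc').2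
    rw [P.D.r_linForm, hua, P.D.res_add, P.D.res_smul, P.D.res_smul, P.D.res_self, hres,
      smul_zero, add_zero, smul_smul, linForm_smul]
    exact dvd_mul_left _ _
  have hd3 : linForm b ^ mB b ∣ C t * ev b (P.D.π (θ - f • P.τ)) := by
    rw [← ev_smul, ← hres, hev]
    exact hd2.trans (map_dvd P.D.r hdvd)
  change linForm b ^ mB b ∣ ev b (P.D.π (θ - f • P.τ))
  have h5 : ev b (P.D.π (θ - f • P.τ)) = C t⁻¹ * (C t * ev b (P.D.π (θ - f • P.τ))) := by
    rw [← mul_assoc, ← C_mul, inv_mul_cancel₀ ht, C_1, one_mul]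
  rw [h5]
  exact hd3.mul_left _

theorem mem_Dm_of_x_smul (P : Step T m c₀ TB mB) {v : S K (n+1) × (Fin (n+1) → S K (n+1))}
    (h : linForm c₀ • v ∈ M T m c₀) : v ∈ M T m c₀ := by
  obtain ⟨h1, h2⟩ := h
  have h3 : linForm c₀ ^ m c₀ * v.1 = ev c₀ v.2 := by
    apply mul_left_cancel₀ P.x_prime.ne_zero
    simp only [Prod.smul_fst, Prod.smul_snd, smul_eq_mul, map_smul] at h2
    rw [← h2]; ring
  refine ⟨fun c hc => ?_, h3⟩
  by_cases hcc : c = c₀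
  · subst hcc; exact ⟨_, h3.symm⟩
  · have := h1 c hc
    simp only [Prod.smul_snd, map_smul, smul_eq_mul] at this
    have hrel : IsRelPrime (linForm c ^ m c) (linForm c₀) := by
      have := isRelPrime_linForm_pow (P.ne_zero _ hc) (P.nonparallel _ hc _ P.mem hcc) (m c) 1
      rwa [pow_one] at this
    exact hrel.dvd_of_dvd_mul_left this

theorem exists_eq_x_smul_of_ρ {v : S K (n+1) × (Fin (n+1) → S K (n+1))} 
    (h0 : linForm c₀ ∣ ev c₀ v.2)
    (h : P.ρ v = 0) : ∃ w, v = linForm c₀ • w := by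
  have h1 : P.D.r v.1 = 0 := congrArg Prod.fst h
  have h2 : P.D.π (v.2 - v.1 • P.τ) = 0 := congrArg Prod.snd h
  rw [P.D.π_sub, P.D.π_smul, h1, zero_smul, sub_zero] at h2
  have h3 : ∀ i, linForm c₀ ∣ v.2 i := by
    intro i
    rw [← ev_single i v.2, ← P.D.r_eq_zero_iff, P.D.r_ev, h2, (P.D.r_eq_zero_iff _).2 h0]
    simp
  obtain ⟨f, hf⟩ := (P.D.r_eq_zero_iff _).1 h1
  choose θ hθ using h3
  exact ⟨(f, θ), Prod.ext hf (funext hθ)⟩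

theorem ρ_eq_zero_iff {v : S K (n+1) × (Fin (n+1) → S K (n+1))} (hv : v ∈ M T m c₀) :
    P.ρ v = 0 ↔ ∃ w ∈ M T m c₀, v = linForm c₀ • w := by
  constructor
  · intro h
    have h0 : linForm c₀ ∣ ev c₀ v.2 := by
      rw [← hv.2]; exact Dvd.dvd.mul_right (dvd_pow_self _ P.pos.ne') _
    obtain ⟨w, rfl⟩ := P.exists_eq_x_smul_of_ρ h0 h
    exact ⟨w, P.mem_Dm_of_x_smul hv, rfl⟩
  · rintro ⟨w, _, rfl⟩
    rw [ρ_smul, P.D.r_self, zero_smul]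

/-- The image of the restriction map, in each degree. -/
noncomputable def N (d : ℕ) : Submodule K (S K n × (Fin n → S K n)) :=
  (grP (M T m c₀) (m c₀) d).map P.ρ

theorem N_le (d : ℕ) : P.N d ≤ grP (G TB mB) (m c₀) d := by
  rintro _ ⟨v, hv, rfl⟩
  exact ⟨P.ρ_mem_G hv.1, P.ρ_mem_homP hv.2⟩

theorem x_smul_mem_homP {c : Fin (n+1) → K} {a d : ℕ}
    {v : S K (n+1) × (Fin (n+1) → S K (n+1))}
    (h : v ∈ homP K (n+1) (n+1) a d) : linForm c • v ∈ homP K (n+1) (n+1) a (d+1) := by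
  refine ⟨?_, mem_homV.2 fun i => ?_⟩
  · change linForm c * v.1 ∈ _
    have h1 := h.1
    apply mul_mem_shiftHom (linForm_isHomogeneous c)
    unfold shiftHom at h1 ⊢
    by_cases had : a ≤ d
    · rw [if_pos had] at h1
      rwa [if_pos (by omega), Nat.add_sub_add_right]
    · rw [if_neg had] at h1
      rw [if_neg (by omega)]; exact h1
  · change (linForm c * v.2 i).IsHomogeneous (d+1)
    rw [add_comm d]
    exact (linForm_isHomogeneous c).mul (mem_homV.1 h.2 i)

theorem compP_x_smul (c : Fin (n+1) → K) (a d : ℕ) (v : S K (n+1) × (Fin (n+1) → S K (n+1))) :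
    compP _ _ a (d+1) (linForm c • v) = linForm c • compP _ _ a d v := by
  refine Prod.ext ?_ ?_
  · change shiftComp _ a (d+1) (linForm c * v.1) = linForm c * shiftComp _ a d v.1
    rw [shiftComp_mul_left _ (linForm_isHomogeneous c)]
    unfold shiftComp
    by_cases had : a ≤ d
    · rw [if_pos had, if_pos (by omega), Nat.add_sub_add_right]
    · rw [if_neg had, if_neg (by omega)]
  · change compV _ _ (d+1) (linForm c • v.2) = linForm c • compV _ _ d v.2
    rw [compV_hom_smul _ (linForm_isHomogeneous c), if_pos (by omega)]; rfl

theorem compP_zero_x_smul (c : Fin (n+1) → K) (a : ℕ)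
    (v : S K (n+1) × (Fin (n+1) → S K (n+1))) :
    compP _ _ a 0 (linForm c • v) = 0 := by
  refine Prod.ext ?_ ?_
  · change shiftComp _ a 0 (linForm c * v.1) = 0
    rw [shiftComp_mul_left _ (linForm_isHomogeneous c)]
    simp [shiftComp]
  · change compV _ _ 0 (linForm c • v.2) = 0
    rw [compV_hom_smul _ (linForm_isHomogeneous c), if_neg (by omega)]

theorem finrank_N_add_ker (d : ℕ) : Module.finrank K (P.N d) +
    Module.finrank K (LinearMap.ker (P.ρ.domRestrict (grP (M T m c₀) (m c₀) d)))
      = HF (Dm T m) d := by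
  rw [← P.finrank_grP_M, ← LinearMap.finrank_range_add_finrank_ker
    (P.ρ.domRestrict (grP (M T m c₀) (m c₀) d)), LinearMap.range_domRestrict]; rfl

theorem HF_zero : HF (Dm T m) 0 = Module.finrank K (P.N 0) := by
  rw [← P.finrank_N_add_ker 0]
  have : LinearMap.ker (P.ρ.domRestrict (grP (M T m c₀) (m c₀) 0)) = ⊥ := by
    rw [LinearMap.ker_eq_bot']
    rintro ⟨v, hv⟩ h
    obtain ⟨w, _, hw⟩ := (P.ρ_eq_zero_iff hv.1).1 h
    ext1
    change v = 0
    rw [← compP_of_mem hv.2, hw, compP_zero_x_smul]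
  rw [this, finrank_bot, add_zero]

theorem HF_succ (d : ℕ) :
    HF (Dm T m) (d+1) = HF (Dm T m) d + Module.finrank K (P.N (d+1)) := by
  rw [← P.finrank_N_add_ker (d+1), add_comm]
  congr 1
  rw [← P.finrank_grP_M d]
  let F : grP (M T m c₀) (m c₀) d →ₗ[K]
      LinearMap.ker (P.ρ.domRestrict (grP (M T m c₀) (m c₀) (d+1))) :=
    { toFun := fun v => ⟨⟨linForm c₀ • v.1,
          ⟨(M T m c₀).smul_mem _ v.2.1, x_smul_mem_homP v.2.2⟩⟩, by
          rw [LinearMap.mem_ker]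
          exact (P.ρ_smul _ _).trans (by rw [P.D.r_self, zero_smul])⟩
      map_add' := fun v w => by
        ext1; ext1; exact smul_add _ _ _
      map_smul' := fun a v => by
        ext1; ext1; exact smul_comm _ _ _ }
  refine (LinearEquiv.ofBijective F ⟨?_, ?_⟩).finrank_eq.symm
  · intro v w h
    have h1 : linForm c₀ • v.1 = linForm c₀ • w.1 := congrArg (fun z => z.1.1) h
    ext1
    refine Prod.ext ?_ (funext fun i => ?_)
    · exact mul_left_cancel₀ P.x_prime.ne_zero (congrArg Prod.fst h1)
    · exact mul_left_cancel₀ P.x_prime.ne_zero (congrFun (congrArg Prod.snd h1) i)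
  · rintro ⟨⟨v, hv⟩, h⟩
    obtain ⟨w, hwM, hw⟩ := (P.ρ_eq_zero_iff hv.1).1 h
    refine ⟨⟨compP _ _ _ d w, compP_mem_M hwM d, compP_mem _ _ _⟩, ?_⟩
    ext1; ext1
    change linForm c₀ • compP _ _ _ d w = v
    rw [← compP_x_smul, ← hw, compP_of_mem hv.2]

/-- `g` is a basis of a module of pairs. -/
def IsPBasis {k : ℕ} {ι : Type*} [Fintype ι] (W : Submodule (S K n) (S K n × (Fin k → S K n)))
    (g : ι → S K n × (Fin k → S K n)) : Prop :=
  (∀ i, g i ∈ W) ∧ ∀ v ∈ W, ∃! f : ι → S K n, v = ∑ i, f i • g i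

/-- The basis of `G` attached to a basis of the restriction. -/
noncomputable def gBasis (b : Fin n → Fin n → S K n) : Fin (n+1) → S K n × (Fin n → S K n) :=
  Fin.cons (1, 0) fun j => (0, b j)

theorem sum_gBasis (b : Fin n → Fin n → S K n) (f : Fin (n+1) → S K n) :
    ∑ i, f i • gBasis b i = (f 0, ∑ j, f j.succ • b j) := by
  rw [Fin.sum_univ_succ]
  simp only [gBasis, Fin.cons_zero, Fin.cons_succ]
  refine Prod.ext ?_ ?_
  · simp [Prod.fst_sum]
  · simp [Prod.snd_sum]

theorem isPBasis_gBasis {a : Fin n → ℕ} {b : Fin n → Fin n → S K n}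
    (hb : IsHBasis (Dm TB mB) a b) : IsPBasis (G TB mB) (gBasis b) := by
  constructor
  · intro i
    refine Fin.cases ?_ (fun j => ?_) i
    · exact ⟨trivial, Submodule.zero_mem _⟩
    · exact ⟨trivial, (hb.1 j).1⟩
  · rintro ⟨s, v⟩ hv
    obtain ⟨f, hf, hf'⟩ := hb.2 v hv.2
    refine ⟨Fin.cons s f, ?_, fun g hg => ?_⟩
    · simp only [sum_gBasis, Fin.cons_zero, Fin.cons_succ, ← hf]
    · simp only [sum_gBasis, Prod.mk.injEq] at hg
      have := hf' (fun j => g j.succ) hg.2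
      rw [← this, hg.1]
      exact (Fin.cons_self_tail g).symm

theorem gBasis_mem_homP {a : Fin n → ℕ} {b : Fin n → Fin n → S K n}
    (hb : IsHBasis (Dm TB mB) a b) (e₀ : ℕ) (i : Fin (n+1)) :
    gBasis b i ∈ homP K n n e₀ ((Fin.cons e₀ a : Fin (n+1) → ℕ) i) := by
  refine Fin.cases ?_ (fun j => ?_) i
  · refine ⟨?_, Submodule.zero_mem _⟩
    simp [gBasis, shiftHom]
    exact ⟨1, C_1⟩
  · exact ⟨Submodule.zero_mem _, (hb.1 j).2⟩

theorem compP_smul_mem {k a b : ℕ} (d : ℕ) {v : S K n × (Fin k → S K n)} (h : v ∈ homP K k n a b)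
    (f : S K n) : compP k n a d (f • v) = shiftComp n b d f • v := by
  refine Prod.ext ?_ (compV_smul_mem d h.2 f)
  change shiftComp n a d (f * v.1) = shiftComp n b d f * v.1
  have h1 := h.1
  unfold shiftHom at h1
  split_ifs at h1 with hab
  · rw [mul_comm, shiftComp_mul_left _ h1, mul_comm, Nat.add_sub_cancel' hab]
  · simp at h1; simp [h1]

theorem isHBasis_of_surjective {a : Fin n → ℕ} {b : Fin n → Fin n → S K n}
    (hb : IsHBasis (Dm TB mB) a b) (hs : ∀ d, grP (G TB mB) (m c₀) d ≤ P.N d) :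
    ∃ b', IsHBasis (Dm T m) (Fin.cons (m c₀) a : Fin (n+1) → ℕ) b' := by
  have hG := isPBasis_gBasis hb
  set e : Fin (n+1) → ℕ := Fin.cons (m c₀) a with he
  have hl : ∀ i, ∃ η ∈ grP (M T m c₀) (m c₀) (e i), P.ρ η = gBasis b i := fun i =>
    hs (e i) ⟨hG.1 i, gBasis_mem_homP hb _ i⟩
  choose η hη hρ using hl
  have hind : ∀ k : ℕ, ∀ f : Fin (n+1) → S K (n+1), ∑ i, f i • η i = 0 →
      ∀ i, linForm c₀ ^ k ∣ f i := by
    intro k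
    induction k with
    | zero => intro f _ i; simp
    | succ k ih =>
      intro f hf
      have h1 : ∑ i, P.D.r (f i) • gBasis b i = 0 := by
        rw [← map_zero P.ρ, ← hf, map_sum]
        exact Finset.sum_congr rfl fun i _ => by rw [P.ρ_smul, hρ]
      obtain ⟨u, _, hu⟩ := hG.2 0 (Submodule.zero_mem _)
      have h2 : ∀ i, linForm c₀ ∣ f i := by
        intro i
        rw [← P.D.r_eq_zero_iff]
        have h3 := hu _ h1.symm
        have h4 := hu (fun _ => 0) (by simp)
        exact congrFun (h3.trans h4.symm) i
      choose g hg using h2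
      have h5 : ∑ i, g i • η i = 0 := by
        have h6 : linForm c₀ • ∑ i, g i • η i = 0 := by
          rw [Finset.smul_sum, ← hf]
          exact Finset.sum_congr rfl fun i _ => by rw [smul_smul, ← hg]
        refine Prod.ext ?_ (funext fun i => ?_)
        · exact (mul_eq_zero.1 (congrArg Prod.fst h6)).resolve_left P.x_prime.ne_zero
        · exact (mul_eq_zero.1 (congrFun (congrArg Prod.snd h6) i)).resolve_left
            P.x_prime.ne_zero
      intro i
      rw [hg i, pow_succ']
      exact mul_dvd_mul_left _ (ih g h5 i)
  have hind0 : ∀ f : Fin (n+1) → S K (n+1), ∑ i, f i • η i = 0 → f = 0 := by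
    intro f hf
    funext i
    by_contra hne
    have := FiniteMultiplicity.of_not_isUnit P.x_prime.not_isUnit hne
    obtain ⟨k, hk⟩ := this
    exact hk (hind (k+1) f hf i)
  have hgen : ∀ d, ∀ v ∈ grP (M T m c₀) (m c₀) d, ∃ f : Fin (n+1) → S K (n+1),
      v = ∑ i, f i • η i := by
    intro d
    induction d with
    | zero =>
      intro v hv
      obtain ⟨s, hs, _⟩ := hG.2 _ (P.ρ_mem_G hv.1)
      have hM : v - ∑ i, P.D.sec (s i) • η i ∈ M T m c₀ :=
        Submodule.sub_mem _ hv.1 (Submodule.sum_mem _ fun i _ =>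
          Submodule.smul_mem _ _ (hη i).1)
      have h0 : P.ρ (v - ∑ i, P.D.sec (s i) • η i) = 0 := by
        rw [map_sub, map_sum, sub_eq_zero]
        simp_rw [P.ρ_smul, P.D.r_sec, hρ]
        exact hs
      obtain ⟨w, hwM, hw⟩ := (P.ρ_eq_zero_iff hM).1 h0
      refine ⟨fun i => shiftComp _ (e i) 0 (P.D.sec (s i)), ?_⟩
      have h1 := congrArg (compP (n+1) (n+1) (m c₀) 0) hw
      rw [compP_zero_x_smul, map_sub, compP_of_mem hv.2, map_sum, sub_eq_zero] at h1
      rw [h1]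
      exact Finset.sum_congr rfl fun i _ => compP_smul_mem _ (hη i).2 _
    | succ d ih =>
      intro v hv
      obtain ⟨s, hs, _⟩ := hG.2 _ (P.ρ_mem_G hv.1)
      have hM : v - ∑ i, P.D.sec (s i) • η i ∈ M T m c₀ :=
        Submodule.sub_mem _ hv.1 (Submodule.sum_mem _ fun i _ =>
          Submodule.smul_mem _ _ (hη i).1)
      have h0 : P.ρ (v - ∑ i, P.D.sec (s i) • η i) = 0 := by
        rw [map_sub, map_sum, sub_eq_zero]
        simp_rw [P.ρ_smul, P.D.r_sec, hρ]
        exact hs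
      obtain ⟨w, hwM, hw⟩ := (P.ρ_eq_zero_iff hM).1 h0
      obtain ⟨g, hg⟩ := ih (compP _ _ (m c₀) d w) ⟨compP_mem_M hwM d, compP_mem _ _ _⟩
      refine ⟨fun i => shiftComp _ (e i) (d+1) (P.D.sec (s i)) + linForm c₀ * g i, ?_⟩
      have h1 := congrArg (compP (n+1) (n+1) (m c₀) (d+1)) hw
      rw [compP_x_smul, map_sub, compP_of_mem hv.2, map_sum, sub_eq_iff_eq_add, hg,
        Finset.smul_sum, ← Finset.sum_add_distrib] at h1
      rw [h1]
      refine Finset.sum_congr rfl fun i _ => ?_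
      rw [compP_smul_mem _ (hη i).2, add_smul, smul_smul]
      exact add_comm _ _
  refine ⟨fun i => (η i).2, fun i => ⟨(hη i).1.1, (hη i).2.2⟩, fun v hv => ?_⟩
  obtain ⟨f, hf⟩ := P.exists_mem_M hv
  obtain ⟨N, hN⟩ := exists_sum_compP (m c₀) (f, v)
  choose F hF using fun d => hgen d (compP _ _ (m c₀) d (f, v)) ⟨compP_mem_M hf d, compP_mem _ _ _⟩
  have hv2 : v = ∑ i, (∑ d ∈ Finset.range N, F d i) • (η i).2 := by
    have h1 := congrArg Prod.snd (hN N le_rfl)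
    simp_rw [hF, Prod.snd_sum] at h1
    rw [Finset.sum_comm] at h1
    simp_rw [Finset.sum_smul]
    exact h1
  refine ⟨fun i => ∑ d ∈ Finset.range N, F d i, hv2, fun g hg => ?_⟩
  have h3 : ∑ i, (g i - ∑ d ∈ Finset.range N, F d i) • η i = 0 := by
    apply P.M_fst_eq (Submodule.sum_mem _ fun i _ => Submodule.smul_mem _ _ (hη i).1)
      (Submodule.zero_mem _)
    rw [Prod.snd_sum]
    have hg' : v = ∑ i, g i • (η i).2 := hg
    change ∑ i, (g i - ∑ d ∈ Finset.range N, F d i) • (η i).2 = 0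
    simp only [sub_smul, Finset.sum_sub_distrib]
    rw [← hg', ← hv2, sub_self]
  have := hind0 _ h3
  funext i
  exact sub_eq_zero.1 (congrFun this i)

end Step

end

section

variable {n : ℕ}

/-! ### Constructing restriction steps -/

theorem exists_polynomial_crt {ι : Type*} (L : Finset ι) (s : ι → K)
    (hs : ∀ i ∈ L, ∀ j ∈ L, s i = s j → i = j) (m : ι → ℕ) :
    ∃ p : Polynomial K, ∀ i ∈ L,
      (Polynomial.X + Polynomial.C (s i)) ^ m i ∣ p + Polynomial.C (s i) := by
  induction L using Finset.induction_on with
  | empty => exact ⟨0, by simp⟩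
  | insert j L hj ih =>
    obtain ⟨p, hp⟩ := ih fun i hi i' hi' => hs i (Finset.mem_insert_of_mem hi) i'
      (Finset.mem_insert_of_mem hi')
    have hco : IsCoprime ((Polynomial.X + Polynomial.C (s j)) ^ m j)
        (∏ i ∈ L, (Polynomial.X + Polynomial.C (s i)) ^ m i) := by
      refine IsCoprime.prod_right fun i hi => IsCoprime.pow ?_
      have hne : -s j ≠ -s i := fun h => hj (by
        rw [hs j (Finset.mem_insert_self _ _) i (Finset.mem_insert_of_mem hi) (neg_injective h)]
        exact hi)
      have := Polynomial.pairwise_coprime_X_sub_C (K := K) Function.injective_id hne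
      simpa [Function.onFun] using this
    obtain ⟨a, b, hab⟩ := hco
    refine ⟨p - b * (p + Polynomial.C (s j)) *
      ∏ i ∈ L, (Polynomial.X + Polynomial.C (s i)) ^ m i, fun i hi => ?_⟩
    rcases Finset.mem_insert.1 hi with rfl | hi
    · refine ⟨a * (p + Polynomial.C (s i)), ?_⟩
      linear_combination (p + Polynomial.C (s i)) * (-hab)
    · have h1 := hp i hi
      have h2 := (Finset.dvd_prod_of_mem
        (fun i => (Polynomial.X + Polynomial.C (s i)) ^ m i) hi).mul_left
        (b * (p + Polynomial.C (s j)))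
      have := dvd_sub h1 h2
      convert this using 1
      ring

theorem exists_polynomial_crt_natDegree_lt {ι : Type*} (L : Finset ι) (s : ι → K)
    (hs : ∀ i ∈ L, ∀ j ∈ L, s i = s j → i = j) (m : ι → ℕ) {N : ℕ} (hN : 0 < N)
    (hm : ∑ i ∈ L, m i ≤ N) :
    ∃ p : Polynomial K, p.natDegree < N ∧ ∀ i ∈ L,
      (Polynomial.X + Polynomial.C (s i)) ^ m i ∣ p + Polynomial.C (s i) := by
  obtain ⟨p, hp⟩ := exists_polynomial_crt L s hs m
  set Q := ∏ i ∈ L, (Polynomial.X + Polynomial.C (s i)) ^ m i with hQ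
  have hmon : Q.Monic := Polynomial.monic_prod_of_monic _ _ fun i _ =>
    (Polynomial.monic_X_add_C _).pow _
  have hdeg : Q.natDegree = ∑ i ∈ L, m i := by
    rw [hQ, Polynomial.natDegree_prod_of_monic _ _ fun i _ => (Polynomial.monic_X_add_C _).pow _]
    exact Finset.sum_congr rfl fun i _ => by
      rw [(Polynomial.monic_X_add_C _).natDegree_pow, Polynomial.natDegree_X_add_C, mul_one]
  refine ⟨p %ₘ Q, ?_, fun i hi => ?_⟩
  · by_cases h1 : Q = 1
    · rw [h1, Polynomial.modByMonic_one]; simpa using hN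
    · exact lt_of_lt_of_le (Polynomial.natDegree_modByMonic_lt p hmon h1) (hdeg.trans_le hm)
  · have h1 := Polynomial.modByMonic_add_div p Q
    have h2 : p %ₘ Q + Polynomial.C (s i) = (p + Polynomial.C (s i)) - Q * (p /ₘ Q) := by
      linear_combination h1
    rw [h2]
    exact dvd_sub (hp i hi) ((Finset.dvd_prod_of_mem
        (fun i => (Polynomial.X + Polynomial.C (s i)) ^ m i) hi).mul_right _)

theorem homogenize_X_add_C_pow (s : K) (k : ℕ) :
    ((Polynomial.X + Polynomial.C s) ^ k).homogenize k
      = (X 0 + C s * X 1 : MvPolynomial (Fin 2) K) ^ k := by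
  induction k with
  | zero => simp
  | succ k ih =>
    have h1 : ((Polynomial.X + Polynomial.C s) ^ k).natDegree ≤ k := by
      rw [(Polynomial.monic_X_add_C _).natDegree_pow, Polynomial.natDegree_X_add_C, mul_one]
    rw [pow_succ, Polynomial.homogenize_mul _ _ h1 (Polynomial.natDegree_X_add_C s).le, ih,
      Polynomial.homogenize_add, Polynomial.homogenize_X one_ne_zero, Polynomial.homogenize_C,
      pow_succ]
    simp [pow_succ]

/-- Homogeneous interpolation in two linear forms. -/
theorem exists_interpolation {ι R : Type*} [CommRing R] [Algebra K R] (L : Finset ι) (s : ι → K)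
    (hs : ∀ i ∈ L, ∀ j ∈ L, s i = s j → i = j) (m : ι → ℕ) {N : ℕ} (hN : 0 < N)
    (hm : ∑ i ∈ L, m i ≤ N) (x y : R) :
    ∃ q : R, x ∣ q ∧ ∀ i ∈ L,
      (y + algebraMap K R (s i) * x) ^ m i ∣ q + algebraMap K R (s i) * x ^ N := by
  obtain ⟨p, hp, hd⟩ := exists_polynomial_crt_natDegree_lt L s hs m hN hm
  refine ⟨aeval ![y, x] (p.homogenize N), ?_, fun i hi => ?_⟩
  · obtain ⟨N, rfl⟩ : ∃ N', N = N' + 1 := ⟨N - 1, by omega⟩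
    have := Polynomial.homogenize_mul p 1 (m := N) (n := 1) (by omega) (by simp)
    rw [mul_one, Polynomial.homogenize_one] at this
    rw [this, map_mul]
    exact Dvd.dvd.mul_left (by simp) _
  · have hmi : m i ≤ N := (Finset.single_le_sum (fun _ _ => Nat.zero_le _) hi).trans hm
    have h1 : aeval ![y, x] (p.homogenize N) + algebraMap K R (s i) * x ^ N
        = aeval ![y, x] ((p + Polynomial.C (s i)).homogenize N) := by
      rw [Polynomial.homogenize_add, Polynomial.homogenize_C, map_add, map_mul, map_pow]
      simp
    rw [h1]
    obtain ⟨g, hg⟩ := hd i hi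
    have hnd : (p + Polynomial.C (s i)).natDegree ≤ N := by
      rw [Polynomial.natDegree_add_C]; omega
    have hgd : g.natDegree ≤ N - m i := by
      by_cases h0 : g = 0
      · simp [h0]
      · rw [hg, Polynomial.Monic.natDegree_mul' ((Polynomial.monic_X_add_C _).pow _) h0,
          (Polynomial.monic_X_add_C _).natDegree_pow, Polynomial.natDegree_X_add_C] at hnd
        omega
    have h2 := Polynomial.homogenize_mul ((Polynomial.X + Polynomial.C (s i)) ^ m i) g
      (m := m i) (n := N - m i) (by
        rw [(Polynomial.monic_X_add_C _).natDegree_pow, Polynomial.natDegree_X_add_C, mul_one])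
      hgd
    rw [← hg, Nat.add_sub_cancel' hmi, homogenize_X_add_C_pow] at h2
    rw [h2, map_mul, map_pow]
    refine Dvd.intro (aeval ![y, x] (g.homogenize (N - m i))) ?_
    congr 2; simp

theorem EZmult_eq (A : Arrangement K n) (m : (Fin n → K) → ℕ) {c₀ : Fin n → K}
    (h : c₀ ∈ A.hyps) (c : Fin n → K) :
    EZmult A m c₀ c = ∑ c' ∈ (A.hyps.erase c₀).filter
      (· ∈ Submodule.span K ({c₀, c} : Set (Fin n → K))), m c' := by
  rw [EZmult, ← Finset.insert_erase h, Finset.filter_insert,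
    if_pos (show c₀ ∈ Submodule.span K ({c₀, c} : Set (Fin n → K)) from
      Submodule.subset_span (by simp)), Finset.sum_insert (by simp), Finset.erase_insert
    (by simp)]
  omega

theorem eq_of_parallel (B : Arrangement K n) {b b' c : Fin n → K} (hb : b ∈ B.hyps)
    (hb' : b' ∈ B.hyps) (h : Parallel b c) (h' : Parallel b' c) : b = b' := by
  obtain ⟨t, ht, rfl⟩ := h
  obtain ⟨t', ht', h2⟩ := h'
  by_contra hne
  refine B.nonparallel b hb b' hb' hne (t'⁻¹ * t) ?_
  rw [mul_smul, h2, smul_smul, inv_mul_cancel₀ ht', one_smul]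

theorem finrank_span_pair {c₀ c : Fin n → K} (h0 : c₀ ≠ 0) (h : ∀ t : K, c ≠ t • c₀) :
    Module.finrank K (Submodule.span K ({c₀, c} : Set (Fin n → K))) = 2 := by
  have hl : LinearIndependent K ![c₀, c] := by
    rw [LinearIndependent.pair_iff' h0]
    exact fun a => (h a).symm
  have := finrank_span_eq_card hl
  have h2 : Set.range ![c₀, c] = {c₀, c} := by
    simp only [Matrix.range_cons, Matrix.range_empty, Set.union_empty]; rfl
  rw [h2] at this
  simpa using this

theorem exists_q_of_locallyHeavy (A : Arrangement K n) (m : (Fin n → K) → ℕ) {c₀ : Fin n → K}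
    (hl : IsLocallyHeavy A m c₀) (hpos : 0 < m c₀) {c : Fin n → K} (hc : c ∈ A.hyps.erase c₀) :
    ∃ q : S K n, linForm c₀ ∣ q ∧ ∀ c' ∈ A.hyps.erase c₀, ∀ u a : K, c' = u • c + a • c₀ →
      linForm c' ^ m c' ∣ C u * q + C a * linForm c₀ ^ m c₀ := by
  obtain ⟨hcne, hcA⟩ := Finset.mem_erase.1 hc
  have h0 := A.ne_zero c₀ hl.1
  set U := Submodule.span K ({c₀, c} : Set (Fin n → K)) with hU
  set L := (A.hyps.erase c₀).filter (· ∈ U) with hL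
  have hnp : ∀ t : K, c ≠ t • c₀ := A.nonparallel c₀ hl.1 c hcA (Ne.symm hcne)
  have hind : ∀ u a u' a' : K, u • c + a • c₀ = u' • c + a' • c₀ → u = u' ∧ a = a' := by
    intro u a u' a' h
    have h1 : (u - u') • c = (a' - a) • c₀ := by
      rw [sub_smul, sub_smul, sub_eq_sub_iff_add_eq_add, h]
      abel
    have h2 : u = u' := by
      by_contra hne
      refine hnp ((u - u')⁻¹ * (a' - a)) ?_
      rw [mul_smul, ← h1, smul_smul, inv_mul_cancel₀ (sub_ne_zero.2 hne), one_smul]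
    refine ⟨h2, ?_⟩
    rw [h2, sub_self, zero_smul] at h1
    exact (sub_eq_zero.1 ((smul_eq_zero.1 h1.symm).resolve_right h0)).symm
  have hmem : ∀ (c' : Fin n → K) (u a : K), c' ∈ A.hyps.erase c₀ → c' = u • c + a • c₀ → c' ∈ L := by
    intro c' u a h1 h2
    refine Finset.mem_filter.2 ⟨h1, ?_⟩
    rw [hU, Submodule.mem_span_pair]
    exact ⟨a, u, by rw [h2]; abel⟩
  by_cases hLs : L = {c}
  · refine ⟨0, dvd_zero _, fun c' h1 u a h2 => ?_⟩
    have h3 := hmem c' u a h1 h2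
    rw [hLs, Finset.mem_singleton] at h3
    subst h3
    have := hind u a 1 0 (by rw [← h2]; simp)
    simp [this.2]
  · have hcL : c ∈ L := hmem c 1 0 hc (by simp)
    have hloc : (locHyps A U) = insert c₀ L := by
      ext c'
      simp only [locHyps, hL, Finset.mem_filter, Finset.mem_insert, Finset.mem_erase]
      constructor
      · rintro ⟨h1, h2⟩
        by_cases h : c' = c₀
        · exact Or.inl h
        · exact Or.inr ⟨⟨h, h1⟩, h2⟩
      · rintro (rfl | h)
        · exact ⟨hl.1, Submodule.subset_span (by simp)⟩
        · exact ⟨h.1.2, h.2⟩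
    have hc0L : c₀ ∉ L := by simp [hL]
    have hsum : ∑ c' ∈ L, m c' ≤ m c₀ := by
      have := hl.2 U ⟨finrank_span_pair h0 hnp, ?_⟩ (Submodule.subset_span (by simp)) ?_
      · rwa [hloc, Finset.erase_insert hc0L] at this
      · apply le_antisymm
        · refine Submodule.span_le.2 fun c' h => ?_
          exact (Finset.mem_filter.1 h).2
        · rw [hU]
          refine Submodule.span_mono ?_
          rw [← hU, hloc]
          intro c' h
          rcases h with rfl | h
          · simp
          · rw [Set.mem_singleton_iff.1 h]; simp [hcL]
      · rw [hloc, Finset.card_insert_of_notMem hc0L]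
        have : 1 < L.card := by
          rw [Finset.one_lt_card]
          by_contra hcon
          push Not at hcon
          exact hLs (Finset.eq_singleton_iff_unique_mem.2 ⟨hcL, fun x hx => hcon x hx c hcL⟩)
        omega
    have hrep : ∀ c' ∈ L, ∃ u a : K, c' = u • c + a • c₀ ∧ u ≠ 0 := by
      intro c' h
      obtain ⟨h1, h2⟩ := Finset.mem_filter.1 h
      obtain ⟨a, u, h3⟩ := Submodule.mem_span_pair.1 h2
      refine ⟨u, a, by rw [← h3]; abel, ?_⟩
      rintro rfl
      obtain ⟨h4, h5⟩ := Finset.mem_erase.1 h1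
      exact A.nonparallel c₀ hl.1 c' h5 (Ne.symm h4) a (by rw [← h3]; simp)
    choose! u a hua hu using hrep
    obtain ⟨q, hq, hq'⟩ := exists_interpolation L (fun c' => a c' / u c') (by
      intro i hi j hj hij
      by_contra hne
      refine A.nonparallel i (Finset.mem_erase.1 (Finset.mem_filter.1 hi).1).2 j
        (Finset.mem_erase.1 (Finset.mem_filter.1 hj).1).2 hne (u j / u i) ?_
      have h1 : a j = u j / u i * a i := by
        have := hu i hi; have := hu j hj
        field_simp at hij ⊢
        linear_combination -hij
      conv_lhs => rw [hua j hj]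
      have h2 : (u j / u i) • i = (u j / u i) • (u i • c + a i • c₀) := congrArg _ (hua i hi)
      rw [h2, h1, smul_add, smul_smul, smul_smul, div_mul_cancel₀ _ (hu i hi)]) m hpos hsum
      (linForm c₀) (linForm c)
    refine ⟨q, hq, fun c' h1 v b h2 => ?_⟩
    have hc'L := hmem c' v b h1 h2
    obtain ⟨rfl, rfl⟩ := hind v b (u c') (a c') (by rw [← h2, ← hua c' hc'L])
    have h3 := hq' c' hc'L
    have hune := hu c' hc'L
    have hCu : IsUnit (C (u c') : S K n) := (IsUnit.mk0 _ hune).map C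
    have h4 : linForm c' = C (u c') * (linForm c + algebraMap K (S K n) (a c' / u c') * linForm c₀) := by
      conv_lhs => rw [hua c' hc'L]
      rw [linForm_add, linForm_smul, linForm_smul, mul_add, ← mul_assoc, algebraMap_eq, ← C_mul,
        mul_div_cancel₀ _ hune]
    have h5 : C (u c') * q + C (a c') * linForm c₀ ^ m c₀ =
        C (u c') * (q + algebraMap K (S K n) (a c' / u c') * linForm c₀ ^ m c₀) := by
      rw [mul_add, ← mul_assoc (C (u c')) (algebraMap K _ _), algebraMap_eq, ← C_mul,
        mul_div_cancel₀ _ hune]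
    rw [h5, h4, mul_pow]
    exact ((hCu.pow _).mul_left_dvd.2 h3).mul_left _

theorem exists_step {A : Arrangement K (n+1)} {m : (Fin (n+1) → K) → ℕ} {c₀ : Fin (n+1) → K}
    {B : Arrangement K n} {mB : (Fin n → K) → ℕ} (hr : IsEZRes A m c₀ B mB)
    (hl : IsLocallyHeavy A m c₀ ∨ ∀ c ∈ A.hyps, m c = 1) (hpos : ∀ c ∈ A.hyps, 0 < m c) :
    Nonempty (Step A.hyps m c₀ B.hyps mB) := by
  obtain ⟨hc₀, e, h1, h2⟩ := hr
  obtain ⟨D, hD⟩ := exists_stepData (A.ne_zero _ hc₀) e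
  have hrestr : ∀ b ∈ B.hyps, ∃ c ∈ A.hyps.erase c₀, ∃ t : K, t ≠ 0 ∧ D.res c = t • b ∧
      mB b = ∑ c' ∈ (A.hyps.erase c₀).filter
        (· ∈ Submodule.span K ({c₀, c} : Set (Fin (n+1) → K))), m c' := by
    intro b hb
    obtain ⟨c, hc, hp⟩ := h2 b hb
    obtain ⟨b', hb', hp', hm⟩ := h1 c hc
    obtain rfl := eq_of_parallel B hb hb' hp hp'
    obtain ⟨t, ht, hpt⟩ := hp
    exact ⟨c, hc, t, ht, by rw [hD, hpt], by rw [hm, EZmult_eq A m hc₀]⟩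
  rcases hl with hl | hl
  · choose! q hq hq' using fun c (hc : c ∈ A.hyps.erase c₀) =>
      exists_q_of_locallyHeavy A m hl (hpos _ hc₀) hc
    exact ⟨⟨D, hc₀, hpos _ hc₀, A.ne_zero, A.nonparallel, 0, q, Submodule.zero_mem _, by simp,
      fun c hc => by simpa using hq c hc, hq', hrestr⟩⟩
  · refine ⟨⟨D, hc₀, hpos _ hc₀, A.ne_zero, A.nonparallel, X, linForm, ?_, by simp [ev_X],
      fun c hc => by simp [ev_X], ?_, hrestr⟩⟩
    · rw [hl _ hc₀]
      exact mem_homV.2 fun i => isHomogeneous_X _ _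
    · intro c hc c' hc' u a h
      rw [hl _ hc₀, hl _ (Finset.mem_erase.1 hc').2, pow_one, pow_one, h, linForm_add, linForm_smul,
        linForm_smul]

/-- A multiarrangement with a locally heavy flag whose multiplicities are `e`. -/
def Flag : (n : ℕ) → Arrangement K n → ((Fin n → K) → ℕ) → (Fin n → ℕ) → Prop
  | 0, _, _, _ => True
  | n+1, A, m, e => ∃ c₀ B mB, IsEZRes A m c₀ B mB ∧
      (IsLocallyHeavy A m c₀ ∨ ∀ c ∈ A.hyps, m c = 1) ∧ m c₀ = e 0 ∧
      (∀ c ∈ A.hyps, 0 < m c) ∧ Flag n B mB (Fin.tail e)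

theorem Flag.exists_step {A : Arrangement K (n+1)} {m : (Fin (n+1) → K) → ℕ}
    {e : Fin (n+1) → ℕ} (h : Flag (n+1) A m e) :
    ∃ c₀ B mB, Nonempty (Step A.hyps m c₀ B.hyps mB) ∧ m c₀ = e 0 ∧ Flag n B mB (Fin.tail e) := by
  obtain ⟨c₀, B, mB, h1, h2, h3, h4, h5⟩ := h
  exact ⟨c₀, B, mB, ArrPaper.exists_step h1 h2 h4, h3, h5⟩

end

section

variable {n : ℕ}

/-! ### The defect -/

theorem hs_succ_succ (n a d : ℕ) : hs (n+1) a (d+1) = hs (n+1) a d + hs n a (d+1) := by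
  unfold hs
  rcases lt_trichotomy a (d+1) with h | h | h
  · rw [if_pos h.le, if_pos (by omega), if_pos h.le, Nat.succ_sub (by omega),
      Nat.succ_eq_add_one, Nat.multichoose_succ_succ, add_comm]
  · rw [if_pos h.le, if_neg (by omega), if_pos h.le]
    simp [h]
  · rw [if_neg (by omega), if_neg (by omega), if_neg (by omega)]

theorem hs_zero_right (n a : ℕ) : hs n a 0 = if a = 0 then 1 else 0 := by
  unfold hs
  by_cases h : a = 0
  · simp [h]
  · simp [h]

/-- The defect between the expected Hilbert function for exponents `e` and the actual one. -/
noncomputable def dfct (T : Finset (Fin n → K)) (m : (Fin n → K) → ℕ) (e : Fin n → ℕ) (d : ℕ) : ℤ :=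
  ∑ i, (hs n (e i) d : ℤ) - HF (Dm T m) d

namespace Step

variable {T : Finset (Fin (n+1) → K)} {m : (Fin (n+1) → K) → ℕ} {c₀ : Fin (n+1) → K}
  {TB : Finset (Fin n → K)} {mB : (Fin n → K) → ℕ} (P : Step T m c₀ TB mB)

/-- The dimension of the cokernel of the restriction map. -/
noncomputable def cdim (d : ℕ) : ℤ :=
  Module.finrank K (grP (G TB mB) (m c₀) d) - Module.finrank K (P.N d)

theorem cdim_nonneg (d : ℕ) : 0 ≤ P.cdim d := by
  rw [cdim, sub_nonneg]
  exact_mod_cast Submodule.finrank_mono (P.N_le d)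

theorem cdim_eq_zero {d : ℕ} (h : P.cdim d = 0) : grP (G TB mB) (m c₀) d ≤ P.N d := by
  rw [cdim, sub_eq_zero] at h
  exact (Submodule.eq_of_le_of_finrank_eq (P.N_le d) (by exact_mod_cast h.symm)).ge

theorem dfct_zero {e : Fin (n+1) → ℕ} (he : m c₀ = e 0) :
    dfct T m e 0 = P.cdim 0 + dfct TB mB (Fin.tail e) 0 := by
  rw [dfct, dfct, cdim, P.HF_zero, G, finrank_grP_prod, Fin.sum_univ_succ, he]
  simp only [hs_zero_right, Fin.tail]
  push_cast
  ring

theorem dfct_succ {e : Fin (n+1) → ℕ} (he : m c₀ = e 0) (d : ℕ) :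
    dfct T m e (d+1) = dfct T m e d + P.cdim (d+1) + dfct TB mB (Fin.tail e) (d+1) := by
  rw [dfct, dfct, dfct, cdim, P.HF_succ, G, finrank_grP_prod, he]
  simp only [hs_succ_succ, Nat.cast_add, Finset.sum_add_distrib]
  rw [Fin.sum_univ_succ (fun i => (hs n (e i) (d+1) : ℤ))]
  simp only [Fin.tail]
  ring

end Step

theorem Flag.dfct_nonneg_zero {A : Arrangement K 0} {m : (Fin 0 → K) → ℕ} {e : Fin 0 → ℕ}
    (d : ℕ) : dfct A.hyps m e d = 0 := by
  rw [dfct]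
  have : HF (Dm A.hyps m) d = 0 := Module.finrank_zero_of_subsingleton
  simp [this]

theorem Flag.dfct_nonneg : {n : ℕ} → {A : Arrangement K n} → {m : (Fin n → K) → ℕ} →
    {e : Fin n → ℕ} → Flag n A m e → ∀ d, 0 ≤ dfct A.hyps m e d
  | 0, _, _, _, _, d => (Flag.dfct_nonneg_zero d).ge
  | n+1, A, m, e, h, d => by
    obtain ⟨c₀, B, mB, ⟨P⟩, he, hB⟩ := h.exists_step
    have ih := Flag.dfct_nonneg hB
    induction d with
    | zero =>
      rw [P.dfct_zero he]
      exact add_nonneg (P.cdim_nonneg 0) (ih 0)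
    | succ d hd =>
      rw [P.dfct_succ he]
      exact add_nonneg (add_nonneg hd (P.cdim_nonneg _)) (ih _)

theorem Flag.dfct_mono {A : Arrangement K n} {m : (Fin n → K) → ℕ}
    {e : Fin n → ℕ} (h : Flag n A m e) : Monotone (dfct A.hyps m e) := by
  cases n with
  | zero => intro d d' _; rw [Flag.dfct_nonneg_zero, Flag.dfct_nonneg_zero]
  | succ n =>
    obtain ⟨c₀, B, mB, ⟨P⟩, he, hB⟩ := h.exists_step
    refine monotone_nat_of_le_succ fun d => ?_
    rw [P.dfct_succ he]
    have := P.cdim_nonneg (d+1)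
    have := hB.dfct_nonneg (d+1)
    omega

/-- `f` is bounded above by a multiple of `(d + 1) ^ (p - 1)`. -/
def Bd (f : ℕ → ℤ) (p : ℕ) : Prop := ∃ c : ℤ, ∀ d : ℕ, (d + 1 : ℤ) * f d ≤ c * (d + 1) ^ p

theorem Bd.eq_zero {f : ℕ → ℤ} (h : Bd f 0) (hm : Monotone f) (h0 : ∀ d, 0 ≤ f d) (d : ℕ) :
    f d = 0 := by
  obtain ⟨c, hc⟩ := h
  by_contra hne
  have h1 : 1 ≤ f d := by have := h0 d; omega
  have h2 := hc (d + c.toNat)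
  have h3 : 1 ≤ f (d + c.toNat) := h1.trans (hm (by omega))
  push_cast at h2
  nlinarith [Int.self_le_toNat c]

namespace Step

variable {A : Arrangement K (n+1)} {m : (Fin (n+1) → K) → ℕ} {c₀ : Fin (n+1) → K}
  {B : Arrangement K n} {mB : (Fin n → K) → ℕ}

theorem cdim_add_dfct_le {e : Fin (n+1) → ℕ} (P : Step A.hyps m c₀ B.hyps mB)
    (hA : Flag (n+1) A m e) (he : m c₀ = e 0) (d : ℕ) :
    P.cdim d + dfct B.hyps mB (Fin.tail e) d ≤ dfct A.hyps m e d := by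
  cases d with
  | zero => rw [P.dfct_zero he]
  | succ d => rw [P.dfct_succ he]; have := hA.dfct_nonneg d; omega

theorem bd_restriction {e : Fin (n+1) → ℕ} (P : Step A.hyps m c₀ B.hyps mB)
    (hA : Flag (n+1) A m e) (hB : Flag n B mB (Fin.tail e)) (he : m c₀ = e 0) {p : ℕ}
    (h : Bd (dfct A.hyps m e) p) : Bd (dfct B.hyps mB (Fin.tail e)) (p - 1) := by
  cases p with
  | zero =>
    refine ⟨0, fun d => ?_⟩
    have h1 := h.eq_zero hA.dfct_mono hA.dfct_nonneg d
    have h2 := P.cdim_add_dfct_le hA he d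
    have h3 := P.cdim_nonneg d
    have h4 := hB.dfct_nonneg d
    have : dfct B.hyps mB (Fin.tail e) d = 0 := by omega
    simp [this]
  | succ p =>
    obtain ⟨c, hc⟩ := h
    have key : ∀ d k : ℕ, (k : ℤ) * dfct B.hyps mB (Fin.tail e) d ≤ dfct A.hyps m e (d + k) := by
      intro d k
      induction k with
      | zero => simpa using hA.dfct_nonneg _
      | succ k ih =>
        rw [← add_assoc, P.dfct_succ he]
        have h1 := P.cdim_nonneg (d + k + 1)
        have h2 := hB.dfct_mono (show d ≤ d + k + 1 by omega)
        push_cast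
        nlinarith
    refine ⟨c * 2 ^ p, fun d => ?_⟩
    have h1 := key d (d+1)
    have h2 := hc (d + (d + 1))
    push_cast at h1 h2
    refine h1.trans ?_
    have h3 : (d : ℤ) + (d + 1) + 1 = 2 * (d + 1) := by ring
    rw [h3, pow_succ, mul_pow] at h2
    have h4 : (0:ℤ) < 2 * (d + 1) := by positivity
    simp only [Nat.add_sub_cancel]
    have h5 : (2 * ((d:ℤ) + 1)) * dfct A.hyps m e (d + (d+1)) ≤ (2 * ((d:ℤ) + 1)) * (c * 2 ^ p * (d+1)^p) := by
      linarith
    exact le_of_mul_le_mul_left h5 h4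

end Step

end

section

variable {n : ℕ}

/-! ### Annihilating the cokernel of the restriction map -/

/-- A multivariate polynomial with prescribed coefficients on a box. -/
noncomputable def boxPoly (K : Type*) [Field K] (q s : ℕ) :
    ((Fin q → Fin (s+1)) → K) →ₗ[K] MvPolynomial (Fin q) K where
  toFun f := ∑ v, monomial (Finsupp.equivFunOnFinite.symm fun i => (v i : ℕ)) (f v)
  map_add' f g := by simp [Finset.sum_add_distrib]
  map_smul' a f := by simp [Finset.smul_sum, smul_monomial]

theorem boxPoly_injective (q s : ℕ) : Function.Injective (boxPoly K q s) := by
  rw [← LinearMap.ker_eq_bot, LinearMap.ker_eq_bot']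
  intro f hf
  funext w
  have h1 := congrArg (coeff (Finsupp.equivFunOnFinite.symm fun i => (w i : ℕ))) hf
  simp only [boxPoly, LinearMap.coe_mk, AddHom.coe_mk, coeff_sum, coeff_monomial, coeff_zero] at h1
  rw [Finset.sum_eq_single w] at h1
  · simpa using h1
  · intro v _ hv
    rw [if_neg]
    intro h
    refine hv (funext fun i => Fin.ext ?_)
    exact congrFun (Finsupp.equivFunOnFinite.symm.injective h) i
  · simp

theorem totalDegree_aeval_boxPoly {q s N : ℕ} (f : (Fin q → Fin (s+1)) → K) (z : Fin q → S K n)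
    (hz : ∀ i, (z i).totalDegree ≤ N) : (aeval z (boxPoly K q s f)).totalDegree ≤ q * (s * N) := by
  simp only [boxPoly, LinearMap.coe_mk, AddHom.coe_mk, map_sum]
  refine totalDegree_finsetSum_le fun v _ => ?_
  rw [aeval_monomial, algebraMap_eq]
  refine (totalDegree_mul _ _).trans ?_
  rw [totalDegree_C, zero_add, Finsupp.prod_fintype _ _ (by simp)]
  refine (totalDegree_finsetProd _ _).trans ?_
  calc _ ≤ ∑ _i : Fin q, s * N := Finset.sum_le_sum fun i _ => ?_
    _ = q * (s * N) := by simp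
  refine (totalDegree_pow _ _).trans ?_
  exact Nat.mul_le_mul (by simpa using Nat.lt_succ_iff.1 (v i).2) (hz i)

namespace Step

variable {T : Finset (Fin (n+1) → K)} {m : (Fin (n+1) → K) → ℕ} {c₀ : Fin (n+1) → K}
  {TB : Finset (Fin n → K)} {mB : (Fin n → K) → ℕ} (P : Step T m c₀ TB mB)

/-- The image of the restriction map. -/
noncomputable def NM : Submodule (S K n) (S K n × (Fin n → S K n)) where
  carrier := {v | ∃ η ∈ M T m c₀, P.ρ η = v}
  add_mem' := by
    rintro _ _ ⟨η, hη, rfl⟩ ⟨η', hη', rfl⟩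
    exact ⟨η + η', Submodule.add_mem _ hη hη', map_add _ _ _⟩
  zero_mem' := ⟨0, Submodule.zero_mem _, map_zero _⟩
  smul_mem' := by
    rintro s _ ⟨η, hη, rfl⟩
    exact ⟨P.D.sec s • η, Submodule.smul_mem _ _ hη, by rw [P.ρ_smul, P.D.r_sec]⟩

theorem NM_le : P.NM ≤ G TB mB := by
  rintro _ ⟨η, hη, rfl⟩
  exact P.ρ_mem_G hη

theorem mem_NM_of_mem_N {d : ℕ} {v : S K n × (Fin n → S K n)} (h : v ∈ P.N d) : v ∈ P.NM := by
  obtain ⟨η, hη, rfl⟩ := h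
  exact ⟨η, hη.1, rfl⟩

theorem mem_N_of_mem_NM {d : ℕ} {v : S K n × (Fin n → S K n)} (h : v ∈ P.NM)
    (hd : v ∈ homP K n n (m c₀) d) : v ∈ P.N d := by
  obtain ⟨η, hη, rfl⟩ := h
  refine ⟨compP _ _ (m c₀) d η, ⟨compP_mem_M hη d, compP_mem _ _ _⟩, ?_⟩
  rw [P.ρ_compP, compP_of_mem hd]

theorem compP_mem_G {v : S K n × (Fin n → S K n)} (h : v ∈ G TB mB) (a d : ℕ) :
    compP n n a d v ∈ grP (G TB mB) a d :=
  ⟨⟨trivial, compV_mem_Dm h.2 d⟩, compP_mem _ _ _⟩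

/-- The graded pieces of the cokernel of the restriction map. -/
def Coker (d : ℕ) : Type _ :=
  grP (G TB mB) (m c₀) d ⧸ (P.N d).submoduleOf (grP (G TB mB) (m c₀) d)

noncomputable instance (d : ℕ) : AddCommGroup (P.Coker d) :=
  inferInstanceAs (AddCommGroup (grP (G TB mB) (m c₀) d ⧸
    (P.N d).submoduleOf (grP (G TB mB) (m c₀) d)))

noncomputable instance (d : ℕ) : Module K (P.Coker d) :=
  inferInstanceAs (Module K (grP (G TB mB) (m c₀) d ⧸
    (P.N d).submoduleOf (grP (G TB mB) (m c₀) d)))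

instance (d : ℕ) : Module.Finite K (P.Coker d) :=
  inferInstanceAs (Module.Finite K (grP (G TB mB) (m c₀) d ⧸
    (P.N d).submoduleOf (grP (G TB mB) (m c₀) d)))

/-- The projection to the cokernel. -/
noncomputable def toCoker (d : ℕ) : grP (G TB mB) (m c₀) d →ₗ[K] P.Coker d :=
  Submodule.mkQ ((P.N d).submoduleOf (grP (G TB mB) (m c₀) d))

theorem finrank_coker (d : ℕ) : (Module.finrank K (P.Coker d) : ℤ) = P.cdim d := by
  have h1 := Submodule.finrank_quotient_add_finrank
    ((P.N d).submoduleOf (grP (G TB mB) (m c₀) d))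
  have h2 := (Submodule.submoduleOfEquivOfLe (P.N_le d)).finrank_eq
  have h3 : Module.finrank K (P.Coker d) + Module.finrank K (P.N d)
      = Module.finrank K (grP (G TB mB) (m c₀) d) := by rw [← h2]; exact h1
  rw [cdim]
  omega

/-- A linear system over the cokernel of the restriction map with more unknowns than equations
has a nontrivial solution. -/
theorem exists_ne_zero_mem_NM {V : Type*} [AddCommGroup V] [Module K V] [Module.Finite K V]
    (F : V →ₗ[K] S K n × (Fin n → S K n)) (hF : ∀ v, F v ∈ G TB mB) (D : ℕ)
    (hD : ∀ v j, D < j → compP n n (m c₀) j (F v) = 0)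
    (hlt : ∑ j ∈ Finset.range (D+1), P.cdim j < Module.finrank K V) :
    ∃ v ≠ 0, F v ∈ P.NM := by
  let Φ : V →ₗ[K] ((j : Fin (D+1)) → P.Coker j) := LinearMap.pi fun j =>
    (P.toCoker j).comp
      (LinearMap.codRestrict _ ((compP n n (m c₀) j).comp F) fun v => compP_mem_G (hF v) _ _)
  have hfr : Module.finrank K ((j : Fin (D+1)) → P.Coker j) < Module.finrank K V := by
    have h1 : (Module.finrank K ((j : Fin (D+1)) → P.Coker j) : ℤ) =
        ∑ j ∈ Finset.range (D+1), P.cdim j := by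
      rw [Module.finrank_pi_fintype, Finset.sum_range]
      push_cast
      exact Finset.sum_congr rfl fun j _ => P.finrank_coker j
    rw [← h1] at hlt
    exact_mod_cast hlt
  obtain ⟨v, hv, hne⟩ := Submodule.exists_mem_ne_zero_of_ne_bot
    (LinearMap.ker_ne_bot_of_finrank_lt (f := Φ) hfr)
  refine ⟨v, hne, ?_⟩
  have hcomp : ∀ j, compP n n (m c₀) j (F v) ∈ P.NM := by
    intro j
    by_cases hj : D < j
    · rw [hD v j hj]; exact Submodule.zero_mem _
    · have h2 := congrFun (LinearMap.mem_ker.1 hv) ⟨j, by omega⟩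
      have h3 := (Submodule.Quotient.mk_eq_zero _).1 h2
      exact P.mem_NM_of_mem_N h3
  obtain ⟨N, hN⟩ := exists_sum_compP (m c₀) (F v)
  rw [hN N le_rfl]
  exact Submodule.sum_mem _ fun j _ => hcomp j

theorem exists_aeval_smul_mem {A : Arrangement K (n+1)} {B : Arrangement K n}
    {e : Fin (n+1) → ℕ} (P : Step A.hyps m c₀ B.hyps mB) (hA : Flag (n+1) A m e)
    (hB : Flag n B mB (Fin.tail e)) (he : m c₀ = e 0) {p : ℕ} (h : Bd (dfct A.hyps m e) p)
    {a : ℕ} {g : S K n × (Fin n → S K n)} (hg : g ∈ grP (G B.hyps mB) (m c₀) a)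
    (z : Fin p → S K n) : ∃ f : MvPolynomial (Fin p) K, f ≠ 0 ∧ aeval z f • g ∈ P.NM := by
  obtain ⟨c, hc⟩ := h
  obtain ⟨N, hN⟩ : ∃ N, ∀ i, (z i).totalDegree ≤ N :=
    ⟨Finset.univ.sup fun i => (z i).totalDegree, fun i =>
      Finset.le_sup (f := fun i => (z i).totalDegree) (Finset.mem_univ i)⟩
  obtain ⟨W, hW⟩ : ∃ W, W = p * N + a + 1 := ⟨_, rfl⟩
  obtain ⟨s, hs⟩ : ∃ s : ℕ, c * W ^ p ≤ s := ⟨(c * W ^ p).toNat, Int.self_le_toNat _⟩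
  obtain ⟨D, hD⟩ : ∃ D, D + 1 = W * (s + 1) := ⟨W * (s+1) - 1, Nat.sub_add_cancel (by
    rw [hW]; exact Nat.succ_le_of_lt (by positivity))⟩
  have hDs : p * (s * N) + a ≤ D := by
    have : D + 1 = p * (s * N) + p * N + (a + 1) * s + a + 1 := by rw [hD, hW]; ring
    have h0 : 0 ≤ (a+1) * s := Nat.zero_le _
    omega
  have hlt : dfct A.hyps m e D < ((s + 1) ^ p : ℕ) := by
    have h1 := hc D
    have h2 : ((D : ℤ) + 1) = W * (s + 1) := by exact_mod_cast hD
    rw [h2, mul_pow] at h1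
    have hWpos : (1 : ℤ) ≤ W := by rw [hW]; push_cast; nlinarith [Nat.zero_le p]
    by_contra hcon
    push Not at hcon
    have h3 : ((s : ℤ) + 1) ^ p ≤ dfct A.hyps m e D := by exact_mod_cast hcon
    have hp : (0:ℤ) < ((s : ℤ) + 1) ^ p := by positivity
    have h4 : ((s : ℤ) + 1) * ((s : ℤ) + 1) ^ p ≤ (W * (s + 1)) * dfct A.hyps m e D := by
      have : ((s : ℤ) + 1) ≤ W * (s + 1) := by nlinarith
      nlinarith
    have h5 : ((s : ℤ) + 1) * ((s : ℤ) + 1) ^ p ≤ s * ((s : ℤ) + 1) ^ p := by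
      refine (h4.trans h1).trans ?_
      rw [← mul_assoc]
      exact mul_le_mul_of_nonneg_right hs hp.le
    nlinarith
  have hsum : ∀ D, ∑ j ∈ Finset.range (D+1), P.cdim j ≤ dfct A.hyps m e D := by
    intro D
    induction D with
    | zero =>
      have := P.cdim_add_dfct_le hA he 0
      have := hB.dfct_nonneg 0
      simp; omega
    | succ D ih =>
      rw [Finset.sum_range_succ, P.dfct_succ he]
      have := hB.dfct_nonneg (D+1)
      omega
  let F : ((Fin p → Fin (s+1)) → K) →ₗ[K] S K n × (Fin n → S K n) :=
    ((LinearMap.toSpanSingleton (S K n) _ g).restrictScalars K).comp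
      ((aeval z).toLinearMap.comp (boxPoly K p s))
  have hF : ∀ v, F v = aeval z (boxPoly K p s v) • g := fun v => rfl
  obtain ⟨v, hv, hmem⟩ := P.exists_ne_zero_mem_NM F (fun v => by
      rw [hF]; exact Submodule.smul_mem _ _ hg.1) D (fun v j hj => by
      rw [hF, compP_smul_mem _ hg.2]
      have hdeg := totalDegree_aeval_boxPoly v z hN
      have : shiftComp n a j (aeval z (boxPoly K p s v)) = 0 := by
        unfold shiftComp
        split_ifs
        · exact homogeneousComponent_eq_zero _ _ (by omega)
        · rfl
      rw [this, zero_smul]) (by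
      refine (hsum D).trans_lt (hlt.trans_le ?_)
      rw [Module.finrank_fintype_fun_eq_card]
      simp)
  refine ⟨boxPoly K p s v, fun h0 => hv (boxPoly_injective p s (by rw [h0, map_zero])), ?_⟩
  rw [← hF]; exact hmem

end Step

/-! ### Coprime pairs in ideals -/

theorem exists_isRelPrime_mem {q : ℕ} (I : Ideal (MvPolynomial (Fin q) K))
    (h0 : ∃ t ∈ I, t ≠ 0) (h : ∀ j, ∃ f ∈ I, f ≠ 0 ∧ f.degreeOf j = 0) :
    ∃ t ∈ I, ∃ u ∈ I, t ≠ 0 ∧ u ≠ 0 ∧ IsRelPrime t u := by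
  obtain ⟨t, ht, ht0⟩ := h0
  obtain ⟨s, hs, hst⟩ : ∃ s : Finset (MvPolynomial (Fin q) K), (∀ p ∈ s, Prime p) ∧
      ∀ p, Prime p → p ∣ t → ∃ p' ∈ s, Associated p p' := by
    refine ⟨(UniqueFactorizationMonoid.factors t).toFinset, fun p hp =>
      UniqueFactorizationMonoid.prime_of_factor p (Multiset.mem_toFinset.1 hp), fun p hp hpt => ?_⟩
    obtain ⟨p', h1, h2⟩ := UniqueFactorizationMonoid.exists_mem_factors_of_dvd ht0
      hp.irreducible hpt
    exact ⟨p', Multiset.mem_toFinset.2 h1, h2⟩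
  have hnot : ¬ ((I : Set (MvPolynomial (Fin q) K)) ⊆ ⋃ p ∈ (s : Set (MvPolynomial (Fin q) K)),
      ((Ideal.span {p} : Ideal (MvPolynomial (Fin q) K)) : Set (MvPolynomial (Fin q) K))) := by
    rw [Ideal.subset_union_prime 0 0 (fun p hp _ _ => (Ideal.span_singleton_prime (hs p hp).ne_zero).2
      (hs p hp))]
    rintro ⟨p, hp, hle⟩
    have hpp := hs p hp
    have hvar : ∃ j, p.degreeOf j ≠ 0 := by
      by_contra hcon
      push Not at hcon
      have h1 : p.vars = ∅ := by
        ext j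
        simp [mem_vars_iff_degreeOf_ne_zero, hcon j]
      obtain ⟨a, ha⟩ : ∃ a, p = C a := ⟨_, vars_eq_empty_iff_eq_C.1 h1⟩
      apply hpp.not_isUnit
      rw [ha]
      refine (IsUnit.mk0 a ?_).map C
      rintro rfl
      exact hpp.ne_zero (by rw [ha, C_0])
    obtain ⟨j, hj⟩ := hvar
    obtain ⟨f, hf, hf0, hfj⟩ := h j
    obtain ⟨g, hg⟩ := Ideal.mem_span_singleton.1 (hle hf)
    have hg0 : g ≠ 0 := by rintro rfl; exact hf0 (by rw [hg, mul_zero])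
    rw [hg, degreeOf_mul_eq hpp.ne_zero hg0] at hfj
    omega
  obtain ⟨u, hu, hu'⟩ := Set.not_subset.1 hnot
  have hdiv : ∀ p, Prime p → p ∣ t → ¬ p ∣ u := by
    intro p hp hpt hpu
    obtain ⟨p', hp', hass⟩ := hst p hp hpt
    apply hu'
    simp only [Set.mem_iUnion]
    exact ⟨p', hp', Ideal.mem_span_singleton.2 (hass.symm.dvd.trans hpu)⟩
  by_cases hu0 : u = 0
  · have htu : IsUnit t := by
      by_contra hcon
      obtain ⟨p, hp, hpt⟩ := WfDvdMonoid.exists_irreducible_factor hcon ht0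
      exact hdiv p hp.prime hpt (hu0 ▸ dvd_zero _)
    exact ⟨t, ht, t, ht, ht0, ht0, isRelPrime_self.2 htu⟩
  · exact ⟨t, ht, u, hu, ht0, hu0, UniqueFactorizationMonoid.isRelPrime_iff_no_prime_factors ht0 |>.2
      fun p hpt hpu hp => hdiv p hp hpt hpu⟩

end

section

variable {n : ℕ}

/-! ### Exponents of free arrangements with a flag -/

theorem IsHBasis.eq_zero {k : ℕ} {ι : Type*} [Fintype ι] {W : Submodule (S K n) (Fin k → S K n)}
    {a : ι → ℕ} {b : ι → Fin k → S K n} (h : IsHBasis W a b) {f : ι → S K n}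
    (hf : ∑ i, f i • b i = 0) (i : ι) : f i = 0 := by
  obtain ⟨u, _, hu⟩ := h.2 0 W.zero_mem
  have h1 := hu f hf.symm
  have h2 := hu 0 (by simp)
  exact congrFun (h1.trans h2.symm) i

theorem map_univ_succAbove (d : Fin (n+1) → ℕ) (i : Fin (n+1)) :
    (Finset.univ : Finset (Fin (n+1))).val.map d =
      d i ::ₘ (Finset.univ : Finset (Fin n)).val.map (fun j => d (i.succAbove j)) := by
  rw [Fin.univ_succAbove n i, Finset.cons_val, Multiset.map_cons, Finset.map_val,
    Multiset.map_map]
  rfl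

theorem aeval_X_succAbove (j : Fin (n+1)) {f : MvPolynomial (Fin n) K} (hf : f ≠ 0) :
    aeval (fun i => (X (j.succAbove i) : S K (n+1))) f ≠ 0 ∧
      (aeval (fun i => (X (j.succAbove i) : S K (n+1))) f).degreeOf j = 0 := by
  have h : aeval (fun i => (X (j.succAbove i) : S K (n+1))) f = rename j.succAbove f := by
    rw [rename_eq_aeval]; rfl
  rw [h]
  refine ⟨fun h0 => hf (rename_injective _ Fin.succAbove_right_injective (by rw [h0, map_zero])), ?_⟩
  by_contra hne
  have := vars_rename j.succAbove f (mem_vars_iff_degreeOf_ne_zero.2 hne)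
  obtain ⟨i, _, hi⟩ := Finset.mem_image.1 this
  exact Fin.succAbove_ne j i hi

namespace Step

variable {T : Finset (Fin (n+1) → K)} {m : (Fin (n+1) → K) → ℕ} {c₀ : Fin (n+1) → K}
  {TB : Finset (Fin n → K)} {mB : (Fin n → K) → ℕ}

theorem smul_right_cancel {s : S K n} (hs : s ≠ 0) {v w : S K n × (Fin n → S K n)}
    (h : s • v = s • w) : v = w := by
  have h1 : s * v.1 = s * w.1 := congrArg Prod.fst h
  have h2 : ∀ i, s * v.2 i = s * w.2 i := fun i => by
    simpa only [Prod.smul_snd, Pi.smul_apply, smul_eq_mul] using congrFun (congrArg Prod.snd h) i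
  refine Prod.ext (mul_left_cancel₀ hs h1) ?_
  funext i
  exact mul_left_cancel₀ hs (h2 i)

theorem G_le_of_forall (P : Step T m c₀ TB mB)
    (h : ∀ d, ∀ g ∈ grP (G TB mB) (m c₀) d, g ∈ P.NM) : G TB mB ≤ P.NM := by
  intro g hg
  obtain ⟨N, hN⟩ := exists_sum_compP (m c₀) g
  rw [hN N le_rfl]
  exact Submodule.sum_mem _ fun d _ => h d _ (compP_mem_G hg _ _)

/-- A basis of the logarithmic vector fields restricts to a basis of the image. -/
theorem isPBasis_NM (P : Step T m c₀ TB mB) {d : Fin (n+1) → ℕ}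
    {b : Fin (n+1) → Fin (n+1) → S K (n+1)} (hb : IsHBasis (Dm T m) d b) :
    ∃ g : Fin (n+1) → S K n × (Fin n → S K n), IsPBasis P.NM g ∧
      ∀ i, g i ∈ homP K n n (m c₀) (d i) := by
  have hβ : ∀ i, ∃ β ∈ grP (M T m c₀) (m c₀) (d i), β.2 = b i := by
    intro i
    obtain ⟨f, hf⟩ := P.exists_mem_M (hb.1 i).1
    refine ⟨compP _ _ (m c₀) (d i) (f, b i), ⟨compP_mem_M hf _, compP_mem _ _ _⟩, ?_⟩
    change compV (n+1) (n+1) (d i) (b i) = b i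
    exact compV_of_mem (hb.1 i).2
  choose β hβ hβ2 using hβ
  have hrep : ∀ v ∈ M T m c₀, ∃ f : Fin (n+1) → S K (n+1), v = ∑ i, f i • β i := by
    intro v hv
    obtain ⟨f, hf, _⟩ := hb.2 v.2 hv.1
    refine ⟨f, P.M_fst_eq hv (Submodule.sum_mem _ fun i _ => Submodule.smul_mem _ _ (hβ i).1) ?_⟩
    rw [Prod.snd_sum, hf]
    exact Finset.sum_congr rfl fun i _ => by rw [Prod.smul_snd, hβ2]
  have hind : ∀ s : Fin (n+1) → S K n, ∑ i, s i • P.ρ (β i) = 0 → ∀ i, s i = 0 := by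
    intro s hs i
    have h0 : P.ρ (∑ i, P.D.sec (s i) • β i) = 0 := by
      rw [map_sum, ← hs]
      exact Finset.sum_congr rfl fun i _ => by rw [P.ρ_smul, P.D.r_sec]
    obtain ⟨w, hwM, hw⟩ := (P.ρ_eq_zero_iff (Submodule.sum_mem _ fun i _ =>
      Submodule.smul_mem _ _ (hβ i).1)).1 h0
    obtain ⟨f, rfl⟩ := hrep w hwM
    have h1 : ∑ i, (P.D.sec (s i) - linForm c₀ * f i) • b i = 0 := by
      have h2 := congrArg Prod.snd hw
      simp only [Finset.smul_sum, Prod.snd_sum, Prod.smul_snd, hβ2, smul_smul] at h2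
      simp only [sub_smul, Finset.sum_sub_distrib, h2, sub_self]
    have h3 := congrArg P.D.r (sub_eq_zero.1 (hb.eq_zero h1 i))
    rwa [P.D.r_sec, map_mul, P.D.r_self, zero_mul] at h3
  refine ⟨fun i => P.ρ (β i), ⟨fun i => ⟨β i, (hβ i).1, rfl⟩, ?_⟩, fun i => P.ρ_mem_homP (hβ i).2⟩
  rintro _ ⟨η, hη, rfl⟩
  obtain ⟨f, rfl⟩ := hrep η hη
  have h1 : P.ρ (∑ i, f i • β i) = ∑ i, P.D.r (f i) • P.ρ (β i) := by
    rw [map_sum]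
    exact Finset.sum_congr rfl fun i _ => P.ρ_smul _ _
  refine ⟨fun i => P.D.r (f i), h1, fun g hg => ?_⟩
  have h2 : ∑ i, (g i - P.D.r (f i)) • P.ρ (β i) = 0 := by
    simp only [sub_smul, Finset.sum_sub_distrib]
    rw [← h1, hg, sub_self]
  funext i
  exact sub_eq_zero.1 (hind _ h2 i)

theorem mem_of_isRelPrime {W : Submodule (S K n) (S K n × (Fin n → S K n))} {ι : Type*}
    [Fintype ι] {g : ι → S K n × (Fin n → S K n)} (hg : IsPBasis W g) {t u : S K n}
    (ht : t ≠ 0) (htu : IsRelPrime t u) {v : S K n × (Fin n → S K n)} (h1 : t • v ∈ W)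
    (h2 : u • v ∈ W) : v ∈ W := by
  obtain ⟨f, hf, _⟩ := hg.2 _ h1
  obtain ⟨f', hf', _⟩ := hg.2 _ h2
  have h3 : u • t • v ∈ W := W.smul_mem _ h1
  obtain ⟨w, _, hw⟩ := hg.2 _ h3
  have h4 := hw (fun i => u * f i) (by
    change u • t • v = ∑ i, (u * f i) • g i
    rw [hf, Finset.smul_sum]
    exact Finset.sum_congr rfl fun i _ => smul_smul _ _ _)
  have h5 := hw (fun i => t * f' i) (by
    change u • t • v = ∑ i, (t * f' i) • g i
    rw [smul_comm, hf', Finset.smul_sum]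
    exact Finset.sum_congr rfl fun i _ => smul_smul _ _ _)
  have h6 : ∀ i, t ∣ f i := fun i => htu.dvd_of_dvd_mul_left
    ⟨f' i, congrFun (h4.trans h5.symm) i⟩
  choose k hk using h6
  have h7 : v = ∑ i, k i • g i := by
    apply smul_right_cancel ht
    rw [hf, Finset.smul_sum]
    exact Finset.sum_congr rfl fun i _ => by rw [smul_smul, ← hk]
  rw [h7]
  exact W.sum_mem fun i _ => W.smul_mem _ (hg.1 i)

/-- Splitting off a generator from a homogeneous basis of `G`. -/
theorem exists_basis_restriction {d : Fin (n+1) → ℕ} {e₀ : ℕ}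
    {g : Fin (n+1) → S K n × (Fin n → S K n)} (hg : IsPBasis (G TB mB) g)
    (hd : ∀ i, g i ∈ homP K n n e₀ (d i)) :
    ∃ i₀ : Fin (n+1), d i₀ = e₀ ∧
      IsHBasis (Dm TB mB) (fun j => d (i₀.succAbove j)) (fun j => (g (i₀.succAbove j)).2) := by
  have h10 : ((1, 0) : S K n × (Fin n → S K n)) ∈ G TB mB := ⟨trivial, Submodule.zero_mem _⟩
  have h10h : ((1, 0) : S K n × (Fin n → S K n)) ∈ homP K n n e₀ e₀ := by
    refine ⟨?_, Submodule.zero_mem _⟩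
    simp [shiftHom]
    exact ⟨1, C_1⟩
  have hind : ∀ f : Fin (n+1) → S K n, ∑ i, f i • g i = 0 → ∀ i, f i = 0 := by
    intro f hf i
    obtain ⟨u, _, hu⟩ := hg.2 0 (Submodule.zero_mem _)
    exact congrFun ((hu f hf.symm).trans (hu 0 (by simp)).symm) i
  obtain ⟨s₀, hs₀, _⟩ := hg.2 _ h10
  have hs₁ : ((1, 0) : S K n × (Fin n → S K n)) = ∑ i, shiftComp n (d i) e₀ (s₀ i) • g i := by
    have := congrArg (compP n n e₀ e₀) hs₀
    rw [compP_of_mem h10h, map_sum] at this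
    rw [this]
    exact Finset.sum_congr rfl fun i _ => compP_smul_mem _ (hd i) _
  set s : Fin (n+1) → S K n := fun i => shiftComp n (d i) e₀ (s₀ i) with hs
  have hs₂ : ((1, 0) : S K n × (Fin n → S K n)) = ∑ i, s i • g i := hs₁
  have hex : ∃ i₀, s i₀ * (g i₀).1 ≠ 0 := by
    by_contra hcon
    push Not at hcon
    have := congrArg Prod.fst hs₂
    rw [Prod.fst_sum] at this
    have h2 : (1 : S K n) = ∑ i, s i * (g i).1 := this
    rw [Finset.sum_eq_zero fun i _ => hcon i] at h2
    exact one_ne_zero h2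
  obtain ⟨i₀, hi₀⟩ := hex
  have hle1 : d i₀ ≤ e₀ := by
    by_contra hcon
    exact left_ne_zero_of_mul hi₀ (by simp [hs, shiftComp, hcon])
  have hle2 : e₀ ≤ d i₀ := by
    by_contra hcon
    have := (hd i₀).1
    rw [shiftHom, if_neg hcon] at this
    exact right_ne_zero_of_mul hi₀ (by simpa using this)
  have heq : d i₀ = e₀ := le_antisymm hle1 hle2
  have hconst : ∃ a : K, s i₀ = C a := by
    refine ⟨coeff 0 (s₀ i₀), ?_⟩
    simp [hs, shiftComp, heq, homogeneousComponent_zero]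
  obtain ⟨a, ha⟩ := hconst
  have ha0 : a ≠ 0 := by
    rintro rfl
    exact left_ne_zero_of_mul hi₀ (by rw [ha, C_0])
  refine ⟨i₀, heq, fun j => ⟨(hg.1 _).2, (hd _).2⟩, fun v hv => ?_⟩
  obtain ⟨f, hf, _⟩ := hg.2 ((0, v) : S K n × (Fin n → S K n)) ⟨trivial, hv⟩
  have hv2 : v = ∑ i, f i • (g i).2 := by
    have := congrArg Prod.snd hf
    rwa [Prod.snd_sum] at this
  have hs2 : (0 : Fin n → S K n) = ∑ i, s i • (g i).2 := by
    have := congrArg Prod.snd hs₂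
    rwa [Prod.snd_sum] at this
  rw [Fin.sum_univ_succAbove _ i₀] at hv2 hs2
  have hgi : (g i₀).2 = ∑ j, (-(C a⁻¹) * s (i₀.succAbove j)) • (g (i₀.succAbove j)).2 := by
    have h1 : (C a : S K n) • (g i₀).2 = -∑ j, s (i₀.succAbove j) • (g (i₀.succAbove j)).2 := by
      rw [← ha]; exact eq_neg_of_add_eq_zero_left hs2.symm
    have h2 : (g i₀).2 = (C a⁻¹ : S K n) • (C a : S K n) • (g i₀).2 := by
      rw [smul_smul, ← C_mul, inv_mul_cancel₀ ha0, C_1, one_smul]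
    rw [h2, h1, smul_neg, Finset.smul_sum, ← Finset.sum_neg_distrib]
    exact Finset.sum_congr rfl fun j _ => by rw [smul_smul, neg_mul, neg_smul]
  refine ⟨fun j => f i₀ * (-(C a⁻¹) * s (i₀.succAbove j)) + f (i₀.succAbove j), ?_, fun k hk => ?_⟩
  · change v = ∑ j, (f i₀ * (-(C a⁻¹) * s (i₀.succAbove j)) + f (i₀.succAbove j)) •
      (g (i₀.succAbove j)).2
    rw [hv2, hgi, Finset.smul_sum, ← Finset.sum_add_distrib]
    exact Finset.sum_congr rfl fun j _ => by rw [smul_smul, add_smul]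
  · have hk' : v = ∑ j, k j • (g (i₀.succAbove j)).2 := hk
    set l : Fin n → S K n :=
      fun j => f i₀ * (-(C a⁻¹) * s (i₀.succAbove j)) + f (i₀.succAbove j) with hl
    have hl' : v = ∑ j, l j • (g (i₀.succAbove j)).2 := by
      rw [hv2, hgi, Finset.smul_sum, ← Finset.sum_add_distrib]
      exact Finset.sum_congr rfl fun j _ => by rw [smul_smul, hl, add_smul]
    set c : S K n := ∑ j, (k j - l j) * (g (i₀.succAbove j)).1 with hc
    have h1 : ∑ i, ((i₀.insertNth (α := fun _ => S K n) 0 (fun j => k j - l j) : Fin (n+1) → S K n) i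
        - c * s i) • g i = 0 := by
      have e1 : ∑ i, (c * s i) • g i = (c, 0) := by
        have : (c, (0 : Fin n → S K n)) = c • ((1, 0) : S K n × (Fin n → S K n)) :=
          Prod.ext (by simp) (by simp)
        rw [this, hs₂, Finset.smul_sum]
        exact Finset.sum_congr rfl fun i _ => (smul_smul _ _ _).symm
      have e2 : ∑ i, (i₀.insertNth (α := fun _ => S K n) 0 (fun j => k j - l j) :
          Fin (n+1) → S K n) i • g i = (c, 0) := by
        rw [Fin.sum_univ_succAbove _ i₀]
        simp only [Fin.insertNth_apply_same, Fin.insertNth_apply_succAbove, zero_smul, zero_add]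
        refine Prod.ext ?_ ?_
        · rw [Prod.fst_sum]; rfl
        · rw [Prod.snd_sum]
          change ∑ j, (k j - l j) • (g (i₀.succAbove j)).2 = 0
          simp only [sub_smul, Finset.sum_sub_distrib]
          rw [← hk', ← hl', sub_self]
      simp only [sub_smul, Finset.sum_sub_distrib]
      rw [e1, e2, sub_self]
    have h2 := hind _ h1
    have h3 : c = 0 := by
      have := h2 i₀
      rw [Fin.insertNth_apply_same, zero_sub, neg_eq_zero, ha] at this
      exact (mul_eq_zero.1 this).resolve_right fun h => ha0 (C_injective _ _ (by rw [h, C_0]))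
    funext j
    have := h2 (i₀.succAbove j)
    rw [Fin.insertNth_apply_succAbove, h3, zero_mul, sub_zero] at this
    exact sub_eq_zero.1 this

end Step

theorem Flag.exponents_eq : {n : ℕ} → {A : Arrangement K n} → {m : (Fin n → K) → ℕ} →
    {e : Fin n → ℕ} → Flag n A m e → Bd (dfct A.hyps m e) (n - 2) → {d : Fin n → ℕ} →
    {b : Fin n → Fin n → S K n} → IsHBasis (Dm A.hyps m) d b →
    Finset.univ.val.map d = Finset.univ.val.map e
  | 0, _, _, _, _, _, _, _, _ => rfl
  | n+1, A, m, e, h, hbd, d, b, hb => by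
    obtain ⟨c₀, B, mB, ⟨P⟩, he, hB⟩ := h.exists_step
    obtain ⟨g, hg, hgd⟩ := P.isPBasis_NM hb
    have hGN : Step.G B.hyps mB ≤ P.NM := by
      refine P.G_le_of_forall fun a v hv => ?_
      cases n with
      | zero =>
        refine P.mem_NM_of_mem_N (P.cdim_eq_zero ?_ hv)
        have h1 := hbd.eq_zero h.dfct_mono h.dfct_nonneg a
        have h2 := P.cdim_add_dfct_le h he a
        have h3 := P.cdim_nonneg a
        have h4 := hB.dfct_nonneg a
        omega
      | succ k =>
        have hj : ∀ j : Fin (k+1), ∃ f ∈ P.NM.comap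
            (LinearMap.toSpanSingleton (S K (k+1)) _ v), f ≠ 0 ∧ f.degreeOf j = 0 := by
          intro j
          obtain ⟨f, hf0, hf⟩ := P.exists_aeval_smul_mem h hB he hbd hv
            (fun i => (X (j.succAbove i) : S K (k+1)))
          exact ⟨_, hf, aeval_X_succAbove j hf0⟩
        obtain ⟨t, ht, u, hu, ht0, _, htu⟩ := exists_isRelPrime_mem _
          (by obtain ⟨f, hf, hf0, _⟩ := hj 0; exact ⟨f, hf, hf0⟩) hj
        exact Step.mem_of_isRelPrime hg ht0 htu ht hu
    have hg' : Step.IsPBasis (Step.G B.hyps mB) g := by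
      rw [← le_antisymm P.NM_le hGN]; exact hg
    obtain ⟨i₀, hi₀, hb'⟩ := Step.exists_basis_restriction hg' hgd
    have ih := Flag.exponents_eq hB (P.bd_restriction h hB he hbd) hb'
    rw [map_univ_succAbove d i₀, ih, hi₀, he, map_univ_succAbove e 0]
    rfl

end

section

variable {n : ℕ}

/-! ### Regular sequences in ideals of large codimension -/

/-- The substitution `X i ↦ X i + c • X 0 ^ (N ^ i)` for `i ≠ 0`. -/
noncomputable def twist (N : ℕ) (c : K) : S K (n+1) →ₐ[K] S K (n+1) :=
  aeval fun i => if i = 0 then X 0 else X i + c • X 0 ^ N ^ i.1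

theorem twist_comp_twist_neg (N : ℕ) (c : K) :
    (twist N c : S K (n+1) →ₐ[K] S K (n+1)).comp (twist N (-c)) = AlgHom.id _ _ := by
  apply algHom_ext
  intro i
  cases i using Fin.cases <;> simp [twist]

/-- The triangular automorphism attached to `twist`. -/
noncomputable def twistEquiv (K : Type*) [Field K] (n N : ℕ) : S K (n+1) ≃ₐ[K] S K (n+1) :=
  AlgEquiv.ofAlgHom (twist N 1) (twist N (-1)) (twist_comp_twist_neg N 1)
    (by simpa using twist_comp_twist_neg N (-1 : K))

theorem twistEquiv_X_succ (N : ℕ) (i : Fin n) :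
    twistEquiv K n N (X i.succ) = X i.succ + X 0 ^ N ^ (i.1 + 1) := by
  simp [twistEquiv, twist, Fin.succ_ne_zero]

theorem twistEquiv_X_zero (N : ℕ) : twistEquiv K n N (X 0) = X 0 := by
  simp [twistEquiv, twist]

theorem twistEquiv_C (N : ℕ) (a : K) : twistEquiv K n N (C a) = C a :=
  (twistEquiv K n N).commutes a

theorem sum_pow_mul_ne {N : ℕ} (hN : 1 < N) {v w : Fin n →₀ ℕ} (hv : ∀ i, v i < N)
    (hw : ∀ i, w i < N) (ne : v ≠ w) :
    ∑ x : Fin n, N ^ x.1 * v x ≠ ∑ x : Fin n, N ^ x.1 * w x := by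
  intro h
  refine ne <| Finsupp.ext <| congrFun <| List.ofFn_inj.mp ?_
  apply Nat.ofDigits_inj_of_len_eq hN (by simp) (by simpa using hv) (by simpa using hw)
  simpa only [Nat.ofDigits_eq_sum_mapIdx, List.mapIdx_eq_ofFn, List.get_ofFn, List.length_ofFn,
    Fin.val_cast, mul_comm, List.sum_ofFn] using! h

theorem leadingCoeff_twistEquiv_X (N : ℕ) (hN : 0 < N) (i : Fin (n+1)) :
    (finSuccEquiv K n (twistEquiv K n N (X i))).leadingCoeff = 1 ∧
    (finSuccEquiv K n (twistEquiv K n N (X i))).natDegree = N ^ i.1 := by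
  cases i using Fin.cases with
  | zero => simp [twistEquiv_X_zero, finSuccEquiv_X_zero]
  | succ i =>
    rw [twistEquiv_X_succ, map_add, map_pow, finSuccEquiv_X_succ, finSuccEquiv_X_zero, add_comm]
    have : 0 < N ^ (i.1 + 1) := by positivity
    exact ⟨Polynomial.leadingCoeff_X_pow_add_C this, Polynomial.natDegree_X_pow_add_C⟩

theorem twistEquiv_monomial (N : ℕ) (hN : 0 < N) (v : Fin (n+1) →₀ ℕ) {a : K} (ha : a ≠ 0) :
    (finSuccEquiv K n (twistEquiv K n N (monomial v a))).leadingCoeff = C a ∧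
    (finSuccEquiv K n (twistEquiv K n N (monomial v a))).natDegree = ∑ i, N ^ i.1 * v i := by
  have h1 : finSuccEquiv K n (twistEquiv K n N (monomial v a)) =
      Polynomial.C (C a) * ∏ i, finSuccEquiv K n (twistEquiv K n N (X i)) ^ v i := by
    rw [monomial_eq, Finsupp.prod_fintype _ _ (fun i => pow_zero _), map_mul, map_mul,
      twistEquiv_C, map_prod, map_prod]
    simp only [map_pow]
    congr 1
    simp [finSuccEquiv_apply]
  have hm : (∏ i, finSuccEquiv K n (twistEquiv K n N (X i)) ^ v i).Monic :=
    Polynomial.monic_prod_of_monic _ _ fun i _ =>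
      Polynomial.Monic.pow (leadingCoeff_twistEquiv_X N hN i).1 _
  refine ⟨by rw [h1, Polynomial.leadingCoeff_mul, hm.leadingCoeff, mul_one,
    Polynomial.leadingCoeff_C], ?_⟩
  rw [h1, Polynomial.natDegree_C_mul (by simpa using ha), Polynomial.natDegree_prod_of_monic _ _
    fun i _ => Polynomial.Monic.pow (leadingCoeff_twistEquiv_X N hN i).1 _]
  refine Finset.sum_congr rfl fun i _ => ?_
  rw [Polynomial.Monic.natDegree_pow (leadingCoeff_twistEquiv_X N hN i).1,
    (leadingCoeff_twistEquiv_X N hN i).2, mul_comm]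

/-- After a triangular change of variables, a nonzero polynomial becomes monic up to a scalar. -/
theorem exists_leadingCoeff_eq_C {f : S K (n+1)} (hf : f ≠ 0) :
    ∃ (Φ : S K (n+1) ≃ₐ[K] S K (n+1)) (a : K), a ≠ 0 ∧
      (finSuccEquiv K n (Φ f)).leadingCoeff = C a := by
  set N := 2 + f.totalDegree with hN
  have hN0 : 0 < N := by omega
  set F : (Fin (n+1) →₀ ℕ) → Polynomial (MvPolynomial (Fin n) K) :=
    fun v => finSuccEquiv K n (twistEquiv K n N (monomial v (coeff v f))) with hF
  have hFd : ∀ v ∈ f.support, (F v).natDegree = ∑ i, N ^ i.1 * v i := fun v hv =>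
    (twistEquiv_monomial N hN0 v (mem_support_iff.1 hv)).2
  have hF0 : ∀ v ∈ f.support, F v ≠ 0 := fun v hv h0 => by
    have := (twistEquiv_monomial N hN0 v (mem_support_iff.1 hv)).1
    rw [show finSuccEquiv K n (twistEquiv K n N (monomial v (coeff v f))) = 0 from h0,
      Polynomial.leadingCoeff_zero] at this
    exact mem_support_iff.1 hv (C_injective _ _ (by rw [← this, C_0]))
  obtain ⟨v, vin, vs⟩ := Finset.exists_max_image f.support (fun v => (F v).natDegree)
    (support_nonempty.mpr hf)
  have hlt : ∀ w ∈ f.support.erase v, (F w).degree < (F v).degree := by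
    intro w hw
    obtain ⟨hne, hw⟩ := Finset.mem_erase.1 hw
    apply Polynomial.degree_lt_degree
    refine lt_of_le_of_ne (vs w hw) ?_
    rw [hFd w hw, hFd v vin]
    refine sum_pow_mul_ne (by omega) (fun i => ?_) (fun i => ?_) hne <;>
    exact lt_of_le_of_lt ((monomial_le_degreeOf i ‹_›).trans (degreeOf_le_totalDegree f i))
      (by omega)
  refine ⟨twistEquiv K n N, coeff v f, mem_support_iff.1 vin, ?_⟩
  have h1 : finSuccEquiv K n (twistEquiv K n N f) = ∑ w ∈ f.support.erase v, F w + F v := by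
    rw [Finset.sum_erase_add _ _ vin]
    conv_lhs => rw [← f.support_sum_monomial_coeff]
    simp only [map_sum, hF]
  rw [h1, Polynomial.leadingCoeff_add_of_degree_lt]
  · exact (twistEquiv_monomial N hN0 v (mem_support_iff.1 vin)).1
  · refine lt_of_le_of_lt (Polynomial.degree_sum_le _ _) ?_
    refine (Finset.sup_lt_iff ?_).mpr hlt
    exact Ne.bot_lt fun h => hF0 v vin (Polynomial.degree_eq_bot.1 h)

theorem isRelPrime_C {R : Type*} [CommRing R] [IsDomain R] {t u : R} (ht : t ≠ 0)
    (h : IsRelPrime t u) : IsRelPrime (Polynomial.C t) (Polynomial.C u) := by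
  intro d h1 h2
  have hd : d.natDegree = 0 := by
    have := Polynomial.natDegree_le_of_dvd h1 (by simpa using ht)
    simpa using this
  obtain ⟨c, rfl⟩ : ∃ c, d = Polynomial.C c := ⟨_, Polynomial.eq_C_of_natDegree_eq_zero hd⟩
  rw [Polynomial.C_dvd_iff_dvd_coeff] at h1 h2
  have h1' := h1 0
  have h2' := h2 0
  rw [Polynomial.coeff_C_zero] at h1' h2'
  exact (h h1' h2').map Polynomial.C

theorem mem_span_of_monic_mul {R : Type*} [CommRing R] {t u : R} {s a b c : Polynomial R}
    (hs : s.Monic) (h : s * a = Polynomial.C t * b + Polynomial.C u * c) :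
    ∃ b' c', a = Polynomial.C t * b' + Polynomial.C u * c' := by
  set I : Ideal R := Ideal.span {t, u} with hI
  have h1 : Polynomial.map (Ideal.Quotient.mk I) s * Polynomial.map (Ideal.Quotient.mk I) a = 0 := by
    rw [← Polynomial.map_mul, h, Polynomial.map_add, Polynomial.map_mul, Polynomial.map_mul,
      Polynomial.map_C, Polynomial.map_C,
      Ideal.Quotient.eq_zero_iff_mem.2 (Ideal.subset_span (by simp : t ∈ ({t, u} : Set R))),
      Ideal.Quotient.eq_zero_iff_mem.2 (Ideal.subset_span (by simp : u ∈ ({t, u} : Set R)))]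
    simp
  have h2 : Polynomial.map (Ideal.Quotient.mk I) a = 0 :=
    (hs.map (Ideal.Quotient.mk I)).mul_right_eq_zero_iff.1 h1
  have h3 : a ∈ I.map Polynomial.C := by
    rw [Ideal.mem_map_C_iff]
    intro k
    rw [← Ideal.Quotient.eq_zero_iff_mem, ← Polynomial.coeff_map, h2, Polynomial.coeff_zero]
  rw [hI, Ideal.map_span, Set.image_pair, Ideal.mem_span_pair] at h3
  obtain ⟨b', c', h⟩ := h3
  exact ⟨b', c', by rw [← h]; ring⟩

/-- An ideal meeting every subalgebra generated by two elements fewer than the dimension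
contains a regular sequence of length three, stable under powers. -/
theorem exists_regular_triple {q : ℕ} (I : Ideal (S K (q+2)))
    (h : ∀ z : Fin q → S K (q+2), ∃ f : MvPolynomial (Fin q) K, f ≠ 0 ∧ aeval z f ∈ I) :
    ∃ t ∈ I, ∃ u ∈ I, ∃ s ∈ I, t ≠ 0 ∧ u ≠ 0 ∧ IsRelPrime t u ∧
      ∀ p a b c, s ^ p * a = t ^ p * b + u ^ p * c → ∃ b' c', a = t ^ p * b' + u ^ p * c' := by
  obtain ⟨s₀, hs₀, hs₀0⟩ : ∃ s ∈ I, s ≠ 0 := by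
    obtain ⟨f, hf0, hf⟩ := h fun i => X i.succ.succ
    refine ⟨_, hf, ?_⟩
    have : aeval (fun i : Fin q => (X i.succ.succ : S K (q+2))) f =
        rename (fun i : Fin q => i.succ.succ) f := by rw [rename_eq_aeval]; rfl
    rw [this]
    intro h0
    refine hf0 (rename_injective _ ?_ (by rw [h0, map_zero]))
    exact (Fin.succ_injective _).comp (Fin.succ_injective _)
  obtain ⟨Φ, a₀, ha₀, hΦ⟩ := exists_leadingCoeff_eq_C hs₀0
  set Ψ : S K (q+2) ≃ₐ[K] Polynomial (S K (q+1)) := Φ.trans (finSuccEquiv K (q+1)) with hΨ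
  have hΨX : ∀ i : Fin (q+1), Ψ (Φ.symm (X i.succ)) = Polynomial.C (X i) := by
    intro i; simp [hΨ, finSuccEquiv_X_succ]
  set J : Ideal (S K (q+1)) := (I.comap (Ψ.symm : Polynomial (S K (q+1)) →ₐ[K] S K (q+2))).comap
    (Polynomial.C : S K (q+1) →+* Polynomial (S K (q+1))) with hJ
  have hJmem : ∀ f, f ∈ J ↔ Ψ.symm (Polynomial.C f) ∈ I := fun f => Iff.rfl
  have hj : ∀ j : Fin (q+1), ∃ f ∈ J, f ≠ 0 ∧ f.degreeOf j = 0 := by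
    intro j
    obtain ⟨f, hf0, hf⟩ := h fun i => Ψ.symm (Polynomial.C (X (j.succAbove i)))
    refine ⟨_, ?_, aeval_X_succAbove j hf0⟩
    rw [hJmem]
    convert hf using 1
    have e1 : (aeval fun i => Ψ.symm (Polynomial.C (X (j.succAbove i) : S K (q+1)))) =
        ((Ψ.symm : Polynomial (S K (q+1)) →ₐ[K] S K (q+2)).comp
          (Polynomial.CAlgHom (R := K))).comp (aeval fun i => (X (j.succAbove i) : S K (q+1))) := by
      apply algHom_ext
      intro i
      simp
    rw [e1]; rfl
  obtain ⟨t, ht, u, hu, ht0, hu0, htu⟩ := exists_isRelPrime_mem J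
    (by obtain ⟨f, hf, hf0, _⟩ := hj 0; exact ⟨f, hf, hf0⟩) hj
  have hC0 : ∀ {f : S K (q+1)}, f ≠ 0 → Ψ.symm (Polynomial.C f) ≠ 0 := fun hf h0 => hf (by
    rw [map_eq_zero_iff _ Ψ.symm.injective] at h0
    simpa using h0)
  set σ : Polynomial (S K (q+1)) := Polynomial.C (C a₀⁻¹) * Ψ s₀ with hσ
  have hσm : σ.Monic := by
    rw [Polynomial.Monic, hσ, Polynomial.leadingCoeff_mul, Polynomial.leadingCoeff_C]
    change _ * (finSuccEquiv K (q+1) (Φ s₀)).leadingCoeff = 1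
    rw [hΦ, ← C_mul, inv_mul_cancel₀ ha₀, C_1]
  refine ⟨Ψ.symm (Polynomial.C t), ht, Ψ.symm (Polynomial.C u), hu, Ψ.symm σ, ?_, hC0 ht0, hC0 hu0, ?_, ?_⟩
  · rw [hσ, map_mul, AlgEquiv.symm_apply_apply]
    exact I.mul_mem_left _ hs₀
  · intro d h1 h2
    have h1' := map_dvd Ψ h1
    have h2' := map_dvd Ψ h2
    rw [AlgEquiv.apply_symm_apply] at h1' h2'
    have := (isRelPrime_C ht0 htu h1' h2').map Ψ.symm
    rwa [AlgEquiv.symm_apply_apply] at this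
  · intro p a b c habc
    have h1 := congrArg Ψ habc
    simp only [map_mul, map_add, map_pow, AlgEquiv.apply_symm_apply] at h1
    rw [← Polynomial.C_pow, ← Polynomial.C_pow] at h1
    obtain ⟨b', c', h2⟩ := mem_span_of_monic_mul (hσm.pow p) h1
    refine ⟨Ψ.symm b', Ψ.symm c', Ψ.injective ?_⟩
    rw [h2]
    simp only [map_mul, map_add, map_pow, AlgEquiv.apply_symm_apply]

end

section

variable {n : ℕ}

/-! ### Lifting along the restriction map -/

theorem StepData.exists_eq_add_pow_mul {c₀ : Fin (n+1) → K} (D : StepData c₀)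
    (hx : linForm c₀ ≠ 0) {t u : S K (n+1)} (ht : D.r t ≠ 0)
    (htu : IsRelPrime (D.r t) (D.r u)) (k : ℕ) : ∀ {a b c : S K (n+1)},
    u * a = t * b + linForm c₀ ^ k * c → ∃ a' c', a = t * a' + linForm c₀ ^ k * c' := by
  induction k with
  | zero => intro a b c _; exact ⟨0, a, by simp⟩
  | succ k ih =>
    intro a b c h
    have h1 : D.r u * D.r a = D.r t * D.r b := by
      have := congrArg D.r h
      simpa only [map_mul, map_add, map_pow, D.r_self, zero_pow (Nat.succ_ne_zero k), zero_mul,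
        add_zero] using this
    obtain ⟨f, hf⟩ := htu.dvd_of_dvd_mul_left ⟨_, h1⟩
    obtain ⟨a₂, ha₂⟩ : linForm c₀ ∣ a - t * D.sec f := by
      rw [← D.r_eq_zero_iff, map_sub, map_mul, D.r_sec, hf, sub_self]
    obtain ⟨b', hb'⟩ : linForm c₀ ∣ u * D.sec f - b := by
      rw [← D.r_eq_zero_iff]
      refine (mul_eq_zero.1 ?_).resolve_left ht
      rw [map_sub, map_mul, D.r_sec, mul_sub, ← h1, hf]
      ring
    have h2 : u * a₂ = t * (-b') + linForm c₀ ^ k * c := by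
      apply mul_left_cancel₀ hx
      linear_combination h - u * ha₂ - t * hb'
    obtain ⟨a', c', h3⟩ := ih h2
    exact ⟨D.sec f + linForm c₀ * a', c', by linear_combination ha₂ + linForm c₀ * h3⟩

theorem exists_koszul {R : Type*} [CommRing R] [IsDomain R] [DecompositionMonoid R]
    {t u s : R} (ht : t ≠ 0) (htu : IsRelPrime t u)
    (hs : ∀ a b c, s * a = t * b + u * c → ∃ b' c', a = t * b' + u * c')
    {a b c : R} (h : s * a + t * b + u * c = 0) :
    ∃ x y z, a = u * x - t * y ∧ b = s * y - u * z ∧ c = t * z - s * x := by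
  obtain ⟨b', c', h1⟩ := hs a (-b) (-c) (by linear_combination h)
  have h2 : t * (b + s * b') = u * (-(c + s * c')) := by
    rw [h1] at h
    linear_combination h
  obtain ⟨z, hz⟩ : t ∣ c + s * c' := by
    have := htu.dvd_of_dvd_mul_left ⟨_, h2.symm⟩
    rwa [dvd_neg] at this
  refine ⟨c', -b', z, by linear_combination h1, ?_, by linear_combination hz⟩
  apply mul_left_cancel₀ ht
  linear_combination h2 - u * hz

theorem smul_pair_step {R V : Type*} [CommRing R] [AddCommGroup V] [Module R V] {z w x : R}
    {ηz ηw lz lw ω ω' : V} {p k : ℕ}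
    (h : w ^ p • ηz - z ^ p • ηw = x ^ k • ω)
    (h' : (z * w) • ω - w ^ (p+1) • lz + z ^ (p+1) • lw = x • ω') :
    w ^ (p+1) • (z • ηz - x ^ k • lz) - z ^ (p+1) • (w • ηw - x ^ k • lw) =
      x ^ (k+1) • ω' := by
  have e1 : x ^ (k+1) • ω' = x ^ k • ((z * w) • ω - w ^ (p+1) • lz + z ^ (p+1) • lw) := by
    rw [h', smul_smul, pow_succ]
  have e2 : x ^ k • ((z * w) • ω - w ^ (p+1) • lz + z ^ (p+1) • lw) =
      (z * w) • (x ^ k • ω) - x ^ k • (w ^ (p+1) • lz) + x ^ k • (z ^ (p+1) • lw) := by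
    module
  rw [e1, e2, ← h]
  module

theorem smul_cocycle {R V : Type*} [CommRing R] [AddCommGroup V] [Module R V]
    {t u s x : R} {a b c α β γ : V}
    (h1 : u • a - t • b = x • α) (h2 : s • b - u • c = x • β) (h3 : t • c - s • a = x • γ) :
    x • (s • α + t • β + u • γ) = 0 := by
  have : x • (s • α + t • β + u • γ) = s • (x • α) + t • (x • β) + u • (x • γ) := by module
  rw [this, ← h1, ← h2, ← h3]
  module

namespace Step

variable {T : Finset (Fin (n+1) → K)} {m : (Fin (n+1) → K) → ℕ} {c₀ : Fin (n+1) → K}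
  {TB : Finset (Fin n → K)} {mB : (Fin n → K) → ℕ}

theorem exists_koszul_of_isPBasis {W : Submodule (S K n) (S K n × (Fin n → S K n))} {ι : Type*}
    [Fintype ι] {g : ι → S K n × (Fin n → S K n)} (hg : IsPBasis W g) {t u s : S K n}
    (ht : t ≠ 0) (htu : IsRelPrime t u)
    (hs : ∀ a b c, s * a = t * b + u * c → ∃ b' c', a = t * b' + u * c')
    {a b c : S K n × (Fin n → S K n)} (ha : a ∈ W) (hb : b ∈ W) (hc : c ∈ W)
    (h : s • a + t • b + u • c = 0) :
    ∃ x ∈ W, ∃ y ∈ W, ∃ z ∈ W, a = u • x - t • y ∧ b = s • y - u • z ∧ c = t • z - s • x := by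
  obtain ⟨fa, hfa, _⟩ := hg.2 _ ha
  obtain ⟨fb, hfb, _⟩ := hg.2 _ hb
  obtain ⟨fc, hfc, _⟩ := hg.2 _ hc
  have h0 : ∀ i, s * fa i + t * fb i + u * fc i = 0 := by
    intro i
    obtain ⟨w, _, hw⟩ := hg.2 0 W.zero_mem
    have e1 := hw 0 (by simp)
    have e2 := hw (fun i => s * fa i + t * fb i + u * fc i) (by
      change 0 = ∑ i, (s * fa i + t * fb i + u * fc i) • g i
      simp only [add_smul, Finset.sum_add_distrib, mul_smul, ← Finset.smul_sum]
      rw [← hfa, ← hfb, ← hfc, h])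
    exact congrFun (e2.trans e1.symm) i
  choose x y z hx hy hz using fun i => exists_koszul ht htu hs (h0 i)
  have hW : ∀ f : ι → S K n, ∑ i, f i • g i ∈ W := fun f =>
    W.sum_mem fun i _ => W.smul_mem _ (hg.1 i)
  refine ⟨_, hW x, _, hW y, _, hW z, ?_, ?_, ?_⟩
  · rw [hfa]
    simp only [hx, sub_smul, Finset.sum_sub_distrib, mul_smul, ← Finset.smul_sum]
  · rw [hfb]
    simp only [hy, sub_smul, Finset.sum_sub_distrib, mul_smul, ← Finset.smul_sum]
  · rw [hfc]
    simp only [hz, sub_smul, Finset.sum_sub_distrib, mul_smul, ← Finset.smul_sum]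

theorem exists_pair_step (P : Step T m c₀ TB mB) {z w : S K n} {p k : ℕ}
    {ηz ηw lz lw ω : S K (n+1) × (Fin (n+1) → S K (n+1))} {μz μw : S K n × (Fin n → S K n)}
    (hω : ω ∈ M T m c₀) (hlz : lz ∈ M T m c₀) (hlw : lw ∈ M T m c₀)
    (h : P.D.sec w ^ p • ηz - P.D.sec z ^ p • ηw = linForm c₀ ^ k • ω)
    (hρ : P.ρ ω = w ^ p • μz - z ^ p • μw) (hz : P.ρ lz = z • μz) (hw : P.ρ lw = w • μw) :
    ∃ ω' ∈ M T m c₀, P.D.sec w ^ (p+1) • (P.D.sec z • ηz - linForm c₀ ^ k • lz) -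
      P.D.sec z ^ (p+1) • (P.D.sec w • ηw - linForm c₀ ^ k • lw) = linForm c₀ ^ (k+1) • ω' := by
  have hmem : (P.D.sec z * P.D.sec w) • ω - P.D.sec w ^ (p+1) • lz + P.D.sec z ^ (p+1) • lw ∈
      M T m c₀ :=
    Submodule.add_mem _ (Submodule.sub_mem _ (Submodule.smul_mem _ _ hω)
      (Submodule.smul_mem _ _ hlz)) (Submodule.smul_mem _ _ hlw)
  obtain ⟨ω', hω', h'⟩ := (P.ρ_eq_zero_iff hmem).1 (by
    rw [map_add, map_sub, P.ρ_smul, P.ρ_smul, P.ρ_smul, hρ, hz, hw]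
    simp only [map_mul, map_pow, P.D.r_sec]
    module)
  exact ⟨ω', hω', smul_pair_step h h'⟩

theorem exists_compatible_lifts (P : Step T m c₀ TB mB) {ι : Type*} [Fintype ι]
    {g : ι → S K n × (Fin n → S K n)} (hg : IsPBasis (G TB mB) g) {t u s : S K n}
    (ht0 : t ≠ 0) (htu : IsRelPrime t u)
    (hs : ∀ p a b c, s ^ p * a = t ^ p * b + u ^ p * c → ∃ b' c', a = t ^ p * b' + u ^ p * c')
    (htN : ∀ v ∈ G TB mB, t • v ∈ P.NM) (huN : ∀ v ∈ G TB mB, u • v ∈ P.NM)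
    (hsN : ∀ v ∈ G TB mB, s • v ∈ P.NM) {ψ : S K n × (Fin n → S K n)} (hψ : ψ ∈ G TB mB)
    (k : ℕ) : ∃ p : ℕ, ∃ ηt ∈ M T m c₀, ∃ ηu ∈ M T m c₀, ∃ ηs ∈ M T m c₀,
      (P.ρ ηt = t ^ p • ψ ∧ P.ρ ηu = u ^ p • ψ ∧ P.ρ ηs = s ^ p • ψ) ∧
      (∃ ω ∈ M T m c₀, P.D.sec u ^ p • ηt - P.D.sec t ^ p • ηu = linForm c₀ ^ (k+1) • ω) ∧
      (∃ ω ∈ M T m c₀, P.D.sec s ^ p • ηu - P.D.sec u ^ p • ηs = linForm c₀ ^ (k+1) • ω) ∧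
      (∃ ω ∈ M T m c₀, P.D.sec t ^ p • ηs - P.D.sec s ^ p • ηt = linForm c₀ ^ (k+1) • ω) := by
  induction k with
  | zero =>
    obtain ⟨ηt, ht, ht'⟩ := htN ψ hψ
    obtain ⟨ηu, hu, hu'⟩ := huN ψ hψ
    obtain ⟨ηs, hs, hs'⟩ := hsN ψ hψ
    have key : ∀ {z w : S K n} {ηz ηw : S K (n+1) × (Fin (n+1) → S K (n+1))},
        ηz ∈ M T m c₀ → ηw ∈ M T m c₀ → P.ρ ηz = z • ψ → P.ρ ηw = w • ψ →
        ∃ ω ∈ M T m c₀, P.D.sec w ^ 1 • ηz - P.D.sec z ^ 1 • ηw = linForm c₀ ^ (0+1) • ω := by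
      intro z w ηz ηw hz hw hz' hw'
      rw [zero_add, pow_one, pow_one, pow_one]
      refine (P.ρ_eq_zero_iff (Submodule.sub_mem _ (Submodule.smul_mem _ _ hz)
        (Submodule.smul_mem _ _ hw))).1 ?_
      rw [map_sub, P.ρ_smul, P.ρ_smul, hz', hw', P.D.r_sec, P.D.r_sec, smul_smul, smul_smul,
        mul_comm, sub_self]
    exact ⟨1, ηt, ht, ηu, hu, ηs, hs, ⟨by rw [pow_one, ht'], by rw [pow_one, hu'],
      by rw [pow_one, hs']⟩, key ht hu ht' hu', key hu hs hu' hs', key hs ht hs' ht'⟩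
  | succ k ih =>
    obtain ⟨p, ηt, ht, ηu, hu, ηs, hs', ⟨ht', hu', hs''⟩, ⟨ω₁, hω₁, e₁⟩, ⟨ω₂, hω₂, e₂⟩,
      ⟨ω₃, hω₃, e₃⟩⟩ := ih
    have hx0 : linForm c₀ ^ (k+1) ≠ 0 := pow_ne_zero _ P.x_prime.ne_zero
    have hcoc : P.D.sec s ^ p • ω₁ + P.D.sec t ^ p • ω₂ + P.D.sec u ^ p • ω₃ = 0 := by
      apply smul_right_cancel hx0
      rw [smul_cocycle e₁ e₂ e₃, smul_zero]
    have hcoc' : s ^ p • P.ρ ω₁ + t ^ p • P.ρ ω₂ + u ^ p • P.ρ ω₃ = 0 := by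
      have := congrArg P.ρ hcoc
      simpa only [map_add, P.ρ_smul, map_pow, P.D.r_sec, map_zero] using this
    obtain ⟨μt, hμt, μu, hμu, μs, hμs, f₁, f₂, f₃⟩ := exists_koszul_of_isPBasis hg
      (pow_ne_zero p ht0) htu.pow (hs p) (P.ρ_mem_G hω₁) (P.ρ_mem_G hω₂) (P.ρ_mem_G hω₃) hcoc'
    obtain ⟨lt, hlt, hlt'⟩ := htN _ hμt
    obtain ⟨lu, hlu, hlu'⟩ := huN _ hμu
    obtain ⟨ls, hls, hls'⟩ := hsN _ hμs
    have hmem : ∀ {z : S K n} {η l : S K (n+1) × (Fin (n+1) → S K (n+1))}, η ∈ M T m c₀ →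
        l ∈ M T m c₀ → P.ρ η = z ^ p • ψ →
        P.D.sec z • η - linForm c₀ ^ (k+1) • l ∈ M T m c₀ ∧
        P.ρ (P.D.sec z • η - linForm c₀ ^ (k+1) • l) = z ^ (p+1) • ψ := by
      intro z η l hη hl hρ
      refine ⟨Submodule.sub_mem _ (Submodule.smul_mem _ _ hη) (Submodule.smul_mem _ _ hl), ?_⟩
      rw [map_sub, P.ρ_smul, P.ρ_smul, map_pow, P.D.r_self, zero_pow (Nat.succ_ne_zero k),
        zero_smul, sub_zero, P.D.r_sec, hρ, smul_smul, pow_succ']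
    exact ⟨p+1, _, (hmem ht hlt ht').1, _, (hmem hu hlu hu').1, _, (hmem hs' hls hs'').1,
      ⟨(hmem ht hlt ht').2, (hmem hu hlu hu').2, (hmem hs' hls hs'').2⟩,
      P.exists_pair_step hω₁ hlt hlu e₁ f₁ hlt' hlu',
      P.exists_pair_step hω₂ hlu hls e₂ f₂ hlu' hls',
      P.exists_pair_step hω₃ hls hlt e₃ f₃ hls' hlt'⟩

end Step

end

section

variable {n : ℕ}

/-! ### Rigidity -/

theorem homogeneousComponent_pow_mul_eq_zero (c : Fin n → K) {k d : ℕ} (h : d < k) (b : S K n) :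
    homogeneousComponent d (linForm c ^ k * b) = 0 := by
  rw [homogeneousComponent_mul_left d (linForm_pow_isHomogeneous c k), shiftComp,
    if_neg (by omega)]
  simp

namespace Step

variable {T : Finset (Fin (n+1) → K)} {m : (Fin (n+1) → K) → ℕ} {c₀ : Fin (n+1) → K}
  {TB : Finset (Fin n → K)} {mB : (Fin n → K) → ℕ}

theorem mem_NM_of_regular (P : Step T m c₀ TB mB) {ι : Type*} [Fintype ι]
    {g : ι → S K n × (Fin n → S K n)} (hg : IsPBasis (G TB mB) g) {t u s : S K n}
    (ht0 : t ≠ 0) (htu : IsRelPrime t u)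
    (hs : ∀ p a b c, s ^ p * a = t ^ p * b + u ^ p * c → ∃ b' c', a = t ^ p * b' + u ^ p * c')
    (htN : ∀ v ∈ G TB mB, t • v ∈ P.NM) (huN : ∀ v ∈ G TB mB, u • v ∈ P.NM)
    (hsN : ∀ v ∈ G TB mB, s • v ∈ P.NM) {d : ℕ} {ψ : S K n × (Fin n → S K n)}
    (hψ : ψ ∈ grP (G TB mB) (m c₀) d) : ψ ∈ P.NM := by
  obtain ⟨p, ηt, ht, ηu, hu, _, _, ⟨ht', hu', _⟩, ⟨ω, _, e⟩, _⟩ :=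
    P.exists_compatible_lifts hg ht0 htu hs htN huN hsN hψ.1 d
  have hx := P.x_prime.ne_zero
  set x := linForm c₀ with hxdef
  set t' := P.D.sec t ^ p with ht'def
  set u' := P.D.sec u ^ p with hu'def
  have hrt : P.D.r t' = t ^ p := by rw [ht'def, map_pow, P.D.r_sec]
  have hru : P.D.r u' = u ^ p := by rw [hu'def, map_pow, P.D.r_sec]
  have hrt0 : P.D.r t' ≠ 0 := by rw [hrt]; exact pow_ne_zero _ ht0
  have hrel : IsRelPrime (P.D.r t') (P.D.r u') := by rw [hrt, hru]; exact htu.pow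
  have e1 : u' * ηt.1 = t' * ηu.1 + x ^ (d+1) * ω.1 := by
    have := congrArg Prod.fst e
    simp only [Prod.fst_sub, Prod.smul_fst, smul_eq_mul] at this
    linear_combination this
  have e2 : ∀ i, u' * ηt.2 i = t' * ηu.2 i + x ^ (d+1) * ω.2 i := by
    intro i
    have := congrFun (congrArg Prod.snd e) i
    simp only [Prod.snd_sub, Prod.smul_snd, Pi.sub_apply, Pi.smul_apply, smul_eq_mul] at this
    linear_combination this
  obtain ⟨η1, ζ1, h1⟩ := P.D.exists_eq_add_pow_mul hx hrt0 hrel _ e1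
  choose η2 ζ2 h2 using fun i => P.D.exists_eq_add_pow_mul hx hrt0 hrel _ (e2 i)
  have hηt : ηt = t' • (η1, η2) + x ^ (d+1) • (ζ1, ζ2) := by
    refine Prod.ext h1 ?_
    funext i
    exact h2 i
  have hxt : IsRelPrime (x ^ (d+1)) t' := by
    refine IsRelPrime.pow_left ((P.x_prime.irreducible.isRelPrime_iff_not_dvd).2 fun hdvd => ?_)
    exact hrt0 ((P.D.r_eq_zero_iff _).2 hdvd)
  have hu2 : ∃ ζ' : Fin (n+1) → S K (n+1), ηu.2 = u' • η2 + x ^ (d+1) • ζ' := by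
    have : ∀ i, x ^ (d+1) ∣ ηu.2 i - u' * η2 i := by
      intro i
      refine hxt.dvd_of_dvd_mul_left ⟨u' * ζ2 i - ω.2 i, ?_⟩
      have := e2 i
      rw [h2 i] at this
      linear_combination -this
    choose ζ' hζ' using this
    refine ⟨ζ', ?_⟩
    funext i
    have := hζ' i
    simp only [Pi.add_apply, Pi.smul_apply, smul_eq_mul]
    linear_combination this
  obtain ⟨ζu, hζu⟩ := hu2
  have ht2 : ηt.2 = t' • η2 + x ^ (d+1) • ζ2 := congrArg Prod.snd hηt
  have key : ∀ {w : S K n} {η ζ : Fin (n+1) → S K (n+1)}, η ∈ Dm T m →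
      η = (P.D.sec w ^ p) • η2 + x ^ (d+1) • ζ → ∀ c ∈ T, c ≠ c₀ →
      ¬ linForm (P.D.res c) ∣ w → linForm c ^ m c ∣ ev c (compV (n+1) (n+1) d η2) := by
    intro w η ζ hη hηζ c hc hcc hw
    obtain ⟨f, hf⟩ := hη c hc
    have hres : P.D.res c ≠ 0 := by
      intro h0
      obtain ⟨a, ha⟩ := (P.D.res_eq_zero_iff c).1 h0
      exact P.nonparallel c₀ P.mem c hc hcc.symm a ha
    have hpr := linForm_prime hres
    rw [hηζ, map_add, map_smul, map_smul, smul_eq_mul, smul_eq_mul] at hf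
    have hr1 : P.D.r (linForm c ^ m c) ≠ 0 := by
      rw [map_pow, P.D.r_linForm]; exact pow_ne_zero _ hpr.ne_zero
    have hr2 : IsRelPrime (P.D.r (linForm c ^ m c)) (P.D.r (P.D.sec w ^ p)) := by
      rw [map_pow, P.D.r_linForm, map_pow, P.D.r_sec]
      exact ((hpr.irreducible.isRelPrime_iff_not_dvd).2 hw).pow
    obtain ⟨a', c', h⟩ := P.D.exists_eq_add_pow_mul hx hr1 hr2 (d+1) (a := ev c η2) (b := f)
      (c := - ev c ζ) (by linear_combination hf)
    rw [ev_homogeneousComponent, h, map_add, homogeneousComponent_pow_mul_eq_zero c₀ (by omega),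
      add_zero, homogeneousComponent_mul_left d (linForm_pow_isHomogeneous c (m c))]
    exact dvd_mul_right _ _
  have hc0 : x ^ m c₀ * shiftComp (n+1) (m c₀) d η1 = ev c₀ (compV (n+1) (n+1) d η2) := by
    have h3 := ht.2
    rw [hηt] at h3
    simp only [Prod.fst_add, Prod.snd_add, Prod.smul_fst, Prod.smul_snd, smul_eq_mul, map_add,
      map_smul] at h3
    obtain ⟨b, hb⟩ : x ^ (d+1) ∣ ev c₀ η2 - x ^ m c₀ * η1 := by
      refine hxt.dvd_of_dvd_mul_left ⟨x ^ m c₀ * ζ1 - ev c₀ ζ2, ?_⟩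
      linear_combination -h3
    rw [ev_homogeneousComponent, sub_eq_iff_eq_add.1 hb, map_add,
      homogeneousComponent_pow_mul_eq_zero c₀ (by omega), zero_add,
      homogeneousComponent_mul_left d (linForm_pow_isHomogeneous c₀ (m c₀))]
  have hmem : compP (n+1) (n+1) (m c₀) d (η1, η2) ∈ M T m c₀ := by
    refine ⟨fun c hc => ?_, hc0⟩
    change linForm c ^ m c ∣ ev c (compV (n+1) (n+1) d η2)
    by_cases hcc : c = c₀
    · rw [hcc, ← hc0]; exact dvd_mul_right _ _
    · by_cases hdt : linForm (P.D.res c) ∣ t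
      · refine key hu.1 hζu c hc hcc fun hdu => ?_
        have hres : P.D.res c ≠ 0 := by
          intro h0
          obtain ⟨a, ha⟩ := (P.D.res_eq_zero_iff c).1 h0
          exact P.nonparallel c₀ P.mem c hc (Ne.symm hcc) a ha
        exact (linForm_prime hres).not_isUnit (htu hdt hdu)
      · exact key ht.1 ht2 c hc hcc hdt
  have hρ : P.ρ (η1, η2) = ψ := by
    apply smul_right_cancel (pow_ne_zero p ht0)
    rw [← ht', hηt, map_add, P.ρ_smul, P.ρ_smul, map_pow P.D.r x, hxdef, P.D.r_self,
      zero_pow (Nat.succ_ne_zero d), zero_smul, add_zero, hrt]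
  refine ⟨_, hmem, ?_⟩
  rw [P.ρ_compP, hρ, compP_of_mem hψ.2]

end Step

/-- An arrangement with a flag whose defect grows slowly is free. -/
theorem Flag.free_of_bd : {n : ℕ} → {A : Arrangement K n} → {m : (Fin n → K) → ℕ} →
    {e : Fin n → ℕ} → Flag n A m e → Bd (dfct A.hyps m e) (n - 3) →
    ∃ b, IsHBasis (Dm A.hyps m) e b
  | 0, _, _, _, _, _ => ⟨fun i => i.elim0, fun i => i.elim0, fun v _ =>
      ⟨fun i => i.elim0, Subsingleton.elim _ _, fun _ _ => Subsingleton.elim _ _⟩⟩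
  | n+1, A, m, e, h, hbd => by
    obtain ⟨c₀, B, mB, ⟨P⟩, he, hB⟩ := h.exists_step
    have hbdB : Bd (dfct B.hyps mB (Fin.tail e)) (n - 3) := by
      have := P.bd_restriction h hB he hbd
      rwa [show n + 1 - 3 - 1 = n - 3 by omega] at this
    obtain ⟨b, hb⟩ := Flag.free_of_bd hB hbdB
    have hG := Step.isPBasis_gBasis hb
    suffices hsurj : ∀ d, grP (Step.G B.hyps mB) (m c₀) d ≤ P.N d by
      have := P.isHBasis_of_surjective hb hsurj
      rwa [he, Fin.cons_self_tail] at this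
    intro d v hv
    obtain hn | ⟨q, rfl⟩ : n < 2 ∨ ∃ q, n = q + 2 := by
      rcases lt_or_ge n 2 with h | h
      · exact Or.inl h
      · exact Or.inr ⟨n - 2, by omega⟩
    · refine P.cdim_eq_zero ?_ hv
      rw [show n + 1 - 3 = 0 by omega] at hbd
      have h1 := hbd.eq_zero h.dfct_mono h.dfct_nonneg d
      have h2 := P.cdim_add_dfct_le h he d
      have h3 := P.cdim_nonneg d
      have h4 := hB.dfct_nonneg d
      omega
    · refine P.mem_N_of_mem_NM ?_ hv.2
      have hbd' : Bd (dfct A.hyps m e) q := hbd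
      let I : Ideal (S K (q+2)) := ⨅ i, P.NM.comap
        (LinearMap.toSpanSingleton (S K (q+2)) _ (Step.gBasis b i))
      have hI : ∀ {f}, f ∈ I ↔ ∀ i, f • Step.gBasis b i ∈ P.NM := by
        intro f
        simp only [I, Submodule.mem_iInf, Submodule.mem_comap, LinearMap.toSpanSingleton_apply]
      have hIG : ∀ {f}, f ∈ I → ∀ v ∈ Step.G B.hyps mB, f • v ∈ P.NM := by
        intro f hf v hv
        obtain ⟨k, rfl, _⟩ := hG.2 v hv
        rw [Finset.smul_sum]
        refine P.NM.sum_mem fun i _ => ?_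
        rw [smul_comm]
        exact P.NM.smul_mem _ (hI.1 hf i)
      obtain ⟨t, ht, u, hu, s, hs, ht0, _, htu, hreg⟩ := exists_regular_triple I fun z => by
        choose f hf0 hf using fun i => P.exists_aeval_smul_mem h hB he hbd'
          ⟨hG.1 i, Step.gBasis_mem_homP hb (m c₀) i⟩ z
        refine ⟨∏ i, f i, Finset.prod_ne_zero_iff.2 fun i _ => hf0 i, hI.2 fun i => ?_⟩
        rw [← Finset.prod_erase_mul _ _ (Finset.mem_univ i), map_mul, mul_smul]
        exact P.NM.smul_mem _ (hf i)
      exact P.mem_NM_of_regular hG ht0 htu hreg (hIG ht) (hIG hu) (hIG hs) hv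

end

section

variable {n : ℕ}

/-! ### Growth of Hilbert functions -/

/-- `|f|` is bounded by a multiple of `(d + 1) ^ (p - 1)`. -/
def Err (f : ℕ → ℤ) (p : ℕ) : Prop := ∃ c : ℤ, ∀ d : ℕ, (d + 1 : ℤ) * |f d| ≤ c * (d + 1) ^ p

theorem Err.bd {f : ℕ → ℤ} {p : ℕ} (h : Err f p) : Bd f p := by
  obtain ⟨c, hc⟩ := h
  refine ⟨c, fun d => le_trans ?_ (hc d)⟩
  have := le_abs_self (f d)
  gcongr

theorem Err.zero (p : ℕ) : Err (fun _ => 0) p := ⟨0, fun d => by simp⟩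

theorem Err.add {f g : ℕ → ℤ} {p : ℕ} (hf : Err f p) (hg : Err g p) :
    Err (fun d => f d + g d) p := by
  obtain ⟨c, hc⟩ := hf
  obtain ⟨c', hc'⟩ := hg
  refine ⟨c + c', fun d => ?_⟩
  have h1 : (d + 1 : ℤ) * |f d + g d| ≤ (d + 1) * (|f d| + |g d|) := by
    have := abs_add_le (f d) (g d)
    gcongr
  nlinarith [hc d, hc' d]

theorem Err.const_mul {f : ℕ → ℤ} {p : ℕ} (hf : Err f p) (a : ℤ) :
    Err (fun d => a * f d) p := by
  obtain ⟨c, hc⟩ := hf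
  refine ⟨|a| * c, fun d => ?_⟩
  rw [abs_mul]
  nlinarith [mul_le_mul_of_nonneg_left (hc d) (abs_nonneg a)]

theorem Err.sub {f g : ℕ → ℤ} {p : ℕ} (hf : Err f p) (hg : Err g p) :
    Err (fun d => f d - g d) p := by
  have := hf.add (hg.const_mul (-1))
  simpa [sub_eq_add_neg] using this

theorem Err.sum {ι : Type*} (s : Finset ι) {f : ι → ℕ → ℤ} {p : ℕ} (hf : ∀ i ∈ s, Err (f i) p) :
    Err (fun d => ∑ i ∈ s, f i d) p := by
  induction s using Finset.induction_on with
  | empty => simpa using Err.zero p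
  | insert a s ha ih =>
    simp_rw [Finset.sum_insert ha]
    exact (hf a (by simp)).add (ih fun i hi => hf i (by simp [hi]))

theorem Bd.mono {f : ℕ → ℤ} {p q : ℕ} (h : Bd f p) (hpq : p ≤ q) : Bd f q := by
  obtain ⟨c, hc⟩ := h
  refine ⟨|c|, fun d => (hc d).trans ?_⟩
  have h1 := le_abs_self c
  have h2 : ((d : ℤ) + 1) ^ p ≤ (d + 1) ^ q := pow_le_pow_right₀ (by omega) hpq
  have h3 : (0 : ℤ) ≤ (d + 1) ^ p := by positivity
  have h4 := abs_nonneg c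
  nlinarith

theorem Err.mono {f : ℕ → ℤ} {p q : ℕ} (h : Err f p) (hpq : p ≤ q) : Err f q :=
  Bd.mono (f := fun d => |f d|) h hpq

theorem succ_mul_multichoose_le (n k : ℕ) : (k + 1) * n.multichoose k ≤ (k + 1) ^ n := by
  induction n generalizing k with
  | zero => cases k <;> simp
  | succ n ihn =>
    rcases Nat.eq_zero_or_pos n with rfl | hn
    · simp
    induction k with
    | zero => simp
    | succ k ih =>
      rw [Nat.multichoose_succ_succ]
      have h1 := ihn (k + 1)
      have h2 : (n + 1).multichoose k ≤ (k + 1) ^ n := by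
        rw [pow_succ'] at ih
        exact Nat.le_of_mul_le_mul_left ih (by omega)
      obtain ⟨j, rfl⟩ : ∃ j, n = j + 1 := ⟨n - 1, by omega⟩
      have h3 : (k + 1) ^ j ≤ (k + 1 + 1) ^ j := Nat.pow_le_pow_left (by omega) j
      have h4 : (k + 1 + 1) * (k + 1) ^ (j + 1) ≤ (k + 1) * (k + 1 + 1) ^ (j + 1) := by
        rw [pow_succ, pow_succ]
        nlinarith [Nat.mul_le_mul_left ((k + 1 + 1) * (k + 1)) h3]
      rw [pow_succ _ (j + 1)]
      nlinarith [Nat.mul_le_mul_left (k + 1 + 1) h2]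

theorem err_hs (n a : ℕ) : Err (fun d => (hs n a d : ℤ)) n := by
  refine ⟨(a + 1 : ℤ), fun d => ?_⟩
  dsimp only [hs]
  split_ifs with h
  · have h1 := succ_mul_multichoose_le n (d - a)
    have h2 : (d - a + 1) ^ n ≤ (d + 1) ^ n := Nat.pow_le_pow_left (by omega) n
    have h3 : d + 1 ≤ (a + 1) * (d - a + 1) := by
      obtain ⟨k, rfl⟩ := Nat.exists_eq_add_of_le h
      rw [Nat.add_sub_cancel_left]; nlinarith
    have h4 : (d + 1) * n.multichoose (d - a) ≤ (a + 1) * (d + 1) ^ n :=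
      calc _ ≤ (a + 1) * (d - a + 1) * n.multichoose (d - a) := Nat.mul_le_mul_right _ h3
        _ = (a + 1) * ((d - a + 1) * n.multichoose (d - a)) := by ring
        _ ≤ _ := Nat.mul_le_mul_left _ (h1.trans h2)
    rw [abs_of_nonneg (by positivity)]
    exact_mod_cast h4
  · simp; positivity

theorem hs_succ_left (n a d : ℕ) :
    (hs (n+1) (a+1) d : ℤ) = hs (n+1) a d - hs n a d := by
  unfold hs
  rcases lt_trichotomy a d with h | h | h
  · obtain ⟨k, rfl⟩ := Nat.exists_eq_add_of_lt h
    rw [if_pos (by omega), if_pos (by omega), if_pos (by omega),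
      show a + k + 1 - a = k + 1 by omega, show a + k + 1 - (a + 1) = k by omega,
      Nat.multichoose_succ_succ]
    push_cast; ring
  · subst h; simp
  · rw [if_neg (by omega), if_neg (by omega), if_neg (by omega)]; simp

theorem hs_zero (n d : ℕ) : hs n 0 d = n.multichoose d := by simp [hs]

theorem err_hs_sub (n a : ℕ) : Err (fun d => (hs n a d : ℤ) - n.multichoose d) (n - 1) := by
  cases n with
  | zero =>
    have h1 := (err_hs 0 a).sub (err_hs 0 0)
    simpa only [hs_zero] using h1
  | succ n =>
    induction a with
    | zero => simpa [hs_zero] using Err.zero n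
    | succ a ih =>
      have := ih.sub (err_hs n a)
      simp only [hs_succ_left]
      simpa [sub_right_comm] using this

theorem err_hs_sub_linear (n a : ℕ) :
    Err (fun d => (hs (n+1) a d : ℤ) - ((n+1).multichoose d - a * n.multichoose d)) (n - 1) := by
  induction a with
  | zero => simpa [hs_zero] using Err.zero (n-1)
  | succ a ih =>
    have := ih.sub (err_hs_sub n a)
    simp only [hs_succ_left]
    convert this using 2
    push_cast; ring

theorem err_hs_sub_quadratic (n a : ℕ) :
    Err (fun d => (hs (n+2) a d : ℤ) - ((n+2).multichoose d - a * (n+1).multichoose d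
      + a.choose 2 * n.multichoose d)) (n - 1) := by
  induction a with
  | zero => simpa [hs_zero] using Err.zero (n-1)
  | succ a ih =>
    have := ih.sub (err_hs_sub_linear n a)
    simp only [hs_succ_left]
    convert this using 2
    rw [Nat.choose_succ_succ' a 1]
    push_cast [Nat.choose_one_right]; ring

theorem Err.eq_zero_of_const_mul {n : ℕ} {a : ℤ}
    (h : Err (fun d => a * ((n+1).multichoose d : ℤ)) n) : a = 0 := by
  obtain ⟨c, hc⟩ := h
  have key : ∀ d : ℕ, (d + 1) ^ n ≤ n.factorial * (n+1).multichoose d := by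
    intro d
    have h1 := Nat.pow_succ_le_ascFactorial (d + 1) n
    rw [Nat.ascFactorial_eq_factorial_mul_choose] at h1
    rw [Nat.multichoose_eq, show n + 1 + d - 1 = d + n by omega, Nat.choose_symm_add]
    exact h1
  by_contra ha
  have h1 : 1 ≤ |a| := Int.one_le_abs ha
  set d := (c * n.factorial).toNat with hd
  have h2 := hc d
  rw [abs_mul, abs_of_nonneg (by positivity : (0 : ℤ) ≤ (n+1).multichoose d)] at h2
  have h3 : ((d : ℤ) + 1) ^ n ≤ n.factorial * (n+1).multichoose d := by exact_mod_cast key d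
  have h4 : (0 : ℤ) < (d + 1) ^ n := by positivity
  have h5 : (0 : ℤ) < n.factorial := by exact_mod_cast n.factorial_pos
  have h6 : c * n.factorial ≤ d := Int.self_le_toNat _
  have h7 : ((d : ℤ) + 1) * (d + 1) ^ n ≤ (c * n.factorial) * (d + 1) ^ n := by
    calc ((d : ℤ) + 1) * (d + 1) ^ n ≤ (d + 1) * (n.factorial * (n+1).multichoose d) := by gcongr
      _ = n.factorial * ((d + 1) * (1 * (n+1).multichoose d)) := by ring
      _ ≤ n.factorial * ((d + 1) * (|a| * (n+1).multichoose d)) := by gcongr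
      _ ≤ n.factorial * (c * (d + 1) ^ n) := by gcongr
      _ = _ := by ring
  have h8 := le_of_mul_le_mul_right h7 h4
  omega

end

section

variable {n : ℕ}

/-! ### Products of linear forms and ideals of codimension two -/

/-- Nonzero, pairwise nonproportional covectors. -/
def NonPar (T : Finset (Fin n → K)) : Prop :=
  (∀ c ∈ T, c ≠ 0) ∧ ∀ c ∈ T, ∀ c' ∈ T, c ≠ c' → ∀ t : K, c' ≠ t • c

theorem NonPar.mono {T T' : Finset (Fin n → K)} (h : NonPar T) (hT : T' ⊆ T) : NonPar T' :=
  ⟨fun c hc => h.1 c (hT hc), fun c hc c' hc' => h.2 c (hT hc) c' (hT hc')⟩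

theorem prod_isHomogeneous {ι : Type*} (T : Finset ι) (f : ι → Fin n → K) :
    (∏ c ∈ T, linForm (f c)).IsHomogeneous T.card := by
  have := IsHomogeneous.prod T (fun c => linForm (f c)) (fun _ => 1)
    fun c _ => linForm_isHomogeneous (f c)
  simpa using this

/-- The homogeneous part of an ideal. -/
noncomputable def grI (I : Ideal (S K n)) (d : ℕ) : Submodule K (S K n) :=
  I.restrictScalars K ⊓ homogeneousSubmodule (Fin n) K d

theorem mem_grI {I : Ideal (S K n)} {d : ℕ} {f : S K n} :
    f ∈ grI I d ↔ f ∈ I ∧ f.IsHomogeneous d := Iff.rfl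

instance finite_grI (I : Ideal (S K n)) (d : ℕ) : Module.Finite K (grI I d) :=
  Module.Finite.of_injective (Submodule.inclusion (inf_le_right :
    grI I d ≤ homogeneousSubmodule (Fin n) K d)) (Submodule.inclusion_injective _)

/-- The Hilbert function of an ideal. -/
noncomputable def HI (I : Ideal (S K n)) (d : ℕ) : ℕ := Module.finrank K (grI I d)

theorem HI_le (I : Ideal (S K n)) (d : ℕ) : HI I d ≤ n.multichoose d := by
  rw [← finrank_homogeneousSubmodule (K := K)]
  exact Submodule.finrank_mono inf_le_right

/-- The ideal generated by the product of a family of linear forms and the products of all but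
one of them. -/
noncomputable def prodIdeal (T : Finset (Fin n → K)) : Ideal (S K n) :=
  Ideal.span (insert (∏ c ∈ T, linForm c) ((fun c => ∏ c' ∈ T.erase c, linForm c') '' T))

theorem prod_mem_prodIdeal (T : Finset (Fin n → K)) : ∏ c ∈ T, linForm c ∈ prodIdeal T :=
  Ideal.subset_span (Set.mem_insert _ _)

theorem prod_erase_mem_prodIdeal {T : Finset (Fin n → K)} {c : Fin n → K} (hc : c ∈ T) :
    ∏ c' ∈ T.erase c, linForm c' ∈ prodIdeal T :=
  Ideal.subset_span (Set.mem_insert_of_mem _ ⟨c, hc, rfl⟩)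

theorem mul_mem_prodIdeal_insert {T : Finset (Fin n → K)} {β : Fin n → K} (hβ : β ∉ T)
    {f : S K n} (hf : f ∈ prodIdeal T) : linForm β * f ∈ prodIdeal (insert β T) := by
  have : prodIdeal T ≤ Submodule.comap (LinearMap.mulLeft (S K n) (linForm β)) (prodIdeal (insert β T)) := by
    refine Ideal.span_le.2 ?_
    rintro _ (rfl | ⟨c, hc, rfl⟩)
    · change linForm β * (∏ c ∈ T, linForm c) ∈ prodIdeal (insert β T)
      rw [← Finset.prod_insert hβ]
      exact prod_mem_prodIdeal _
    · change linForm β * (∏ c' ∈ T.erase c, linForm c') ∈ prodIdeal (insert β T)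
      have hne : β ≠ c := fun h => hβ (h ▸ hc)
      rw [← Finset.prod_insert (f := linForm) (fun h => hβ (Finset.mem_of_mem_erase h)),
        ← Finset.erase_insert_of_ne hne]
      exact prod_erase_mem_prodIdeal (Finset.mem_insert_of_mem hc)
  exact this hf

theorem HI_prodIdeal_insert {T : Finset (Fin (n+1) → K)} {β : Fin (n+1) → K} (hβ : β ∉ T)
    (hT : NonPar (insert β T)) (d : ℕ) :
    HI (prodIdeal T) d + hs n T.card (d+1) ≤ HI (prodIdeal (insert β T)) (d+1) := by
  have hβ0 : β ≠ 0 := hT.1 β (by simp)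
  obtain ⟨e⟩ := ker_toFunc_equiv hβ0
  obtain ⟨D, -⟩ := exists_stepData hβ0 e
  set Q := ∏ c ∈ T, linForm c with hQ
  have hQmem : Q ∈ prodIdeal (insert β T) := by
    have := prod_erase_mem_prodIdeal (T := insert β T) (c := β) (by simp)
    rwa [Finset.erase_insert hβ] at this
  have hrQ : D.r Q ≠ 0 := by
    rw [hQ, map_prod, Finset.prod_ne_zero_iff]
    intro c hc h0
    rw [D.r_linForm] at h0
    have h1 : D.res c = 0 := linForm_injective (by rw [h0, linForm_zero])
    obtain ⟨a, ha⟩ := (D.res_eq_zero_iff c).1 h1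
    exact hT.2 β (by simp) c (by simp [hc]) (fun h => hβ (h ▸ hc)) a ha
  have hQh : Q.IsHomogeneous T.card := prod_isHomogeneous T id
  let F : grI (prodIdeal T) d × shiftHom K n T.card (d+1) →ₗ[K]
      grI (prodIdeal (insert β T)) (d+1) :=
    LinearMap.codRestrict _
      (LinearMap.coprod (LinearMap.mulLeft K (linForm β) ∘ₗ Submodule.subtype _)
        (LinearMap.mulLeft K Q ∘ₗ D.sec.toLinearMap ∘ₗ Submodule.subtype _)) (by
      rintro ⟨u, v⟩
      change linForm β * (u : S K (n+1)) + Q * D.sec v ∈ _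
      refine Submodule.add_mem _ (mem_grI.2 ⟨mul_mem_prodIdeal_insert hβ u.2.1, ?_⟩)
        (mem_grI.2 ⟨Ideal.mul_mem_right _ _ hQmem, ?_⟩)
      · have := (linForm_isHomogeneous β).mul (mem_grI.1 u.2).2
        rwa [add_comm 1 d] at this
      · have hv := v.2
        unfold shiftHom at hv
        split_ifs at hv with h
        · have := hQh.mul (D.sec_isHomogeneous hv)
          rwa [Nat.add_sub_cancel' h] at this
        · rw [Submodule.mem_bot] at hv
          rw [hv, map_zero, mul_zero]
          exact isHomogeneous_zero _ _ _)
  have hF : ∀ x, (F x : S K (n+1)) = linForm β * x.1 + Q * D.sec x.2 := fun x => rfl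
  have hinj : Function.Injective F := by
    rw [← LinearMap.ker_eq_bot, LinearMap.ker_eq_bot']
    rintro ⟨u, v⟩ h
    have h1 := congrArg Subtype.val h
    rw [hF] at h1
    change linForm β * (u : S K (n+1)) + Q * D.sec v = 0 at h1
    have h2 := congrArg D.r h1
    rw [map_add, map_mul, map_mul, D.r_self, zero_mul, zero_add, D.r_sec, map_zero] at h2
    have h3 : (v : S K n) = 0 := (mul_eq_zero.1 h2).resolve_left hrQ
    rw [h3, map_zero, mul_zero, add_zero] at h1
    have h4 : (u : S K (n+1)) = 0 := (mul_eq_zero.1 h1).resolve_left (linForm_ne_zero hβ0)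
    exact Prod.ext (Subtype.ext h4) (Subtype.ext h3)
  have := LinearMap.finrank_le_finrank_of_injective hinj
  rwa [Module.finrank_prod, finrank_shiftHom] at this

theorem bd_prodIdeal {T : Finset (Fin (n+1) → K)} (hT : NonPar T) :
    Bd (fun d => ((n+1).multichoose d : ℤ) - HI (prodIdeal T) d) (n - 1) := by
  induction T using Finset.induction_on with
  | empty =>
    refine ⟨0, fun d => ?_⟩
    have h1 : prodIdeal (∅ : Finset (Fin (n+1) → K)) = ⊤ := by
      rw [Ideal.eq_top_iff_one]
      simpa using prod_mem_prodIdeal (∅ : Finset (Fin (n+1) → K))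
    have h2 : HI (⊤ : Ideal (S K (n+1))) d = (n+1).multichoose d := by
      have h3 : grI (⊤ : Ideal (S K (n+1))) d = homogeneousSubmodule (Fin (n+1)) K d := by
        rw [grI, Submodule.restrictScalars_top, top_inf_eq]
      rw [← finrank_homogeneousSubmodule (K := K), HI, h3]
    simp [h1, h2]
  | insert β T hβ ih =>
    obtain ⟨c, hc⟩ := ih (hT.mono (Finset.subset_insert _ _))
    obtain ⟨c', hc'⟩ := err_hs_sub n T.card
    have hc0 : 0 ≤ c' := by
      have := hc' 0
      simp only [Nat.cast_zero, zero_add, one_mul, one_pow, mul_one] at this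
      exact (abs_nonneg _).trans this
    refine ⟨2 * |c| + c' + 1, fun d => ?_⟩
    have hp : ∀ d : ℕ, (1 : ℤ) ≤ (d + 1) ^ (n - 1) := fun d => one_le_pow₀ (by omega)
    cases d with
    | zero =>
      have h1 : (0 : ℤ) ≤ HI (prodIdeal (insert β T)) 0 := by positivity
      have h2 := abs_nonneg c
      simp
      omega
    | succ d =>
      have h1 := HI_prodIdeal_insert hβ hT d
      have h2 := hc d
      have h3 := hc' (d+1)
      have h4 : ((HI (prodIdeal T) d : ℤ) + hs n T.card (d+1)) ≤
        HI (prodIdeal (insert β T)) (d+1) := by exact_mod_cast h1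
      dsimp only at h2 h3 ⊢
      rw [Nat.multichoose_succ_succ]
      push_cast at h3 ⊢
      have h5 := neg_abs_le ((hs n T.card (d+1) : ℤ) - n.multichoose (d+1))
      have h6 : (0 : ℤ) ≤ (n+1).multichoose d - HI (prodIdeal T) d := by
        have := HI_le (prodIdeal T) d
        rw [sub_nonneg]; exact_mod_cast this
      set x : ℤ := (n+1).multichoose d - HI (prodIdeal T) d with hx
      set y : ℤ := |(hs n T.card (d+1) : ℤ) - n.multichoose (d+1)| with hy
      have h7 : (n.multichoose (d+1) : ℤ) + (n+1).multichoose d - HI (prodIdeal (insert β T)) (d+1)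
          ≤ x + y := by rw [hx]; linarith
      have h8 : ((d : ℤ) + 1) ^ (n-1) ≤ (d + 1 + 1) ^ (n-1) :=
        pow_le_pow_left₀ (by positivity) (by omega) _
      have h9 : ((d : ℤ) + 1) * x ≤ |c| * (d + 1 + 1) ^ (n-1) := by
        refine h2.trans ?_
        have := le_abs_self c
        have := abs_nonneg c
        have : (0:ℤ) ≤ (d+1)^(n-1) := by positivity
        nlinarith
      calc ((d : ℤ) + 1 + 1) * _ ≤ (d + 1 + 1) * (x + y) := by gcongr
        _ ≤ 2 * ((d + 1) * x) + (d + 1 + 1) * y := by nlinarith [Int.natCast_nonneg d]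
        _ ≤ 2 * (|c| * (d + 1 + 1) ^ (n-1)) + c' * (d + 1 + 1) ^ (n-1) := by linarith
        _ ≤ _ := by
          have : (0:ℤ) ≤ (d+1+1)^(n-1) := by positivity
          nlinarith

end

section

variable {n : ℕ}

/-! ### Adding a hyperplane -/

/-- The plane spanned by two covectors. -/
def plane (H c : Fin n → K) : Submodule K (Fin n → K) := Submodule.span K {H, c}

theorem left_mem_plane (H c : Fin n → K) : H ∈ plane H c := Submodule.subset_span (by simp)

theorem right_mem_plane (H c : Fin n → K) : c ∈ plane H c := Submodule.subset_span (by simp)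

theorem mem_plane {H c c' : Fin n → K} : c' ∈ plane H c ↔ ∃ a u : K, a • H + u • c = c' :=
  Submodule.mem_span_pair

theorem finrank_plane {T : Finset (Fin n → K)} (hT : NonPar T) {H c : Fin n → K} (hH : H ∈ T)
    (hc : c ∈ T) (hne : H ≠ c) : Module.finrank K (plane H c) = 2 :=
  finrank_span_pair (hT.1 H hH) (hT.2 H hH c hc hne)

theorem plane_eq {T : Finset (Fin n → K)} (hT : NonPar T) {H c : Fin n → K} (hH : H ∈ T)
    (hc : c ∈ T) (hne : H ≠ c) {U : Submodule K (Fin n → K)} (hU : Module.finrank K U = 2)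
    (h1 : H ∈ U) (h2 : c ∈ U) : plane H c = U := by
  apply Submodule.eq_of_le_of_finrank_eq
  · refine Submodule.span_le.2 ?_
    rintro x (rfl | rfl)
    · exact h1
    · exact h2
  · rw [hU, finrank_plane hT hH hc hne]

namespace StepData

variable {H : Fin (n+1) → K} (D : StepData H) {T : Finset (Fin (n+1) → K)}

theorem res_ne_zero (hT : NonPar (insert H T)) (hH : H ∉ T) {c : Fin (n+1) → K} (hc : c ∈ T) :
    D.res c ≠ 0 := by
  intro h
  obtain ⟨a, ha⟩ := (D.res_eq_zero_iff c).1 h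
  exact hT.2 H (by simp) c (by simp [hc]) (fun h => hH (h ▸ hc)) a ha

theorem plane_eq_of_res {c c' : Fin (n+1) → K} (hT : NonPar (insert H T)) (hH : H ∉ T)
    (hc : c ∈ T) (hc' : c' ∈ T) {t : K} (h : D.res c' = t • D.res c) : plane H c = plane H c' := by
  have h1 : D.res (c' + (-t) • c) = 0 := by rw [D.res_add, D.res_smul, h, neg_smul, add_neg_cancel]
  obtain ⟨a, ha⟩ := (D.res_eq_zero_iff _).1 h1
  symm
  refine plane_eq hT (by simp) (by simp [hc']) (fun (h : H = c') => hH (h ▸ hc'))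
    (finrank_plane hT (by simp) (by simp [hc]) fun (h : H = c) => hH (h ▸ hc)) (left_mem_plane _ _) ?_
  rw [mem_plane]
  refine ⟨a, t, ?_⟩
  rw [← ha, neg_smul, neg_add_cancel_right]

/-- The products of linear forms in one class divide the restricted value. -/
theorem prod_dvd_r_ev_of_plane (hT : NonPar (insert H T)) {c₀ : Fin (n+1) → K}
    (hc₀ : c₀ ∈ T) {T' : Finset (Fin (n+1) → K)} (hT' : T' ⊆ T)
    (h0 : c₀ ∉ T') (h : ∀ c ∈ T', plane H c = plane H c₀)
    {θ : Fin (n+1) → S K (n+1)} (hθ : θ ∈ Dm T (fun _ => 1)) :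
    ∏ c ∈ T', linForm (D.res c) ∣ D.r (ev H θ) := by
  obtain ⟨g, hg⟩ := hθ c₀ hc₀
  rw [pow_one] at hg
  have hd : ∏ c ∈ T', linForm c ∣ ev H θ - g * linForm H := by
    refine Finset.prod_dvd_of_isRelPrime ?_ fun c hc => ?_
    · intro c hc c' hc' hne
      exact isRelPrime_linForm (hT.1 c (by simp [hT' hc]))
        (hT.2 c (by simp [hT' hc]) c' (by simp [hT' hc']) hne)
    · have hmem : c ∈ plane H c₀ := h c hc ▸ right_mem_plane H c
      obtain ⟨a, u, hau⟩ := mem_plane.1 hmem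
      have ha : a ≠ 0 := by
        rintro rfl
        rw [zero_smul, zero_add] at hau
        exact hT.2 c₀ (by simp [hc₀]) c (by simp [hT' hc]) (fun hh => h0 (hh ▸ hc)) u hau.symm
      have h1 : linForm c ∣ ev c θ := by simpa using hθ c (hT' hc)
      have h2 : ev c θ - g * linForm c = C a * (ev H θ - g * linForm H) := by
        rw [← hau, ev_add, ev_smul, ev_smul, linForm_add, linForm_smul, linForm_smul, hg]
        ring
      have h3 : linForm c ∣ C a * (ev H θ - g * linForm H) := by
        rw [← h2]; exact dvd_sub h1 (dvd_mul_left _ _)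
      have hu : IsUnit (C a : S K (n+1)) := (isUnit_iff_ne_zero.2 ha).map C
      exact hu.dvd_mul_left.1 h3
  have := map_dvd D.r hd
  rw [map_prod, map_sub, map_mul, D.r_self, mul_zero, sub_zero] at this
  simpa only [D.r_linForm] using this

theorem prod_dvd_r_ev (hT : NonPar (insert H T)) (hH : H ∉ T) {T₀ : Finset (Fin (n+1) → K)}
    (hT₀ : T₀ ⊆ T) (himg : T₀.image (plane H) = T.image (plane H))
    {θ : Fin (n+1) → S K (n+1)} (hθ : θ ∈ Dm T (fun _ => 1)) :
    ∏ c ∈ T \ T₀, linForm (D.res c) ∣ D.r (ev H θ) := by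
  rw [← Finset.prod_fiberwise_of_maps_to (g := plane H) (t := T.image (plane H))
    (fun c hc => Finset.mem_image_of_mem _ (Finset.mem_sdiff.1 hc).1)]
  refine Finset.prod_dvd_of_isRelPrime ?_ fun U hU => ?_
  · intro U hU U' hU' hne
    refine IsRelPrime.prod_left fun c hc => IsRelPrime.prod_right fun c' hc' => ?_
    simp only [Finset.mem_filter, Finset.mem_sdiff] at hc hc'
    refine isRelPrime_linForm (D.res_ne_zero hT hH hc.1.1) fun t ht => hne ?_
    rw [← hc.2, ← hc'.2]
    exact D.plane_eq_of_res hT hH hc.1.1 hc'.1.1 ht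
  · rw [← himg, Finset.mem_image] at hU
    obtain ⟨c₀, hc₀, rfl⟩ := hU
    refine D.prod_dvd_r_ev_of_plane hT (hT₀ hc₀) (fun c hc => ?_) ?_ (fun c hc => ?_) hθ
    · exact (Finset.mem_sdiff.1 (Finset.mem_filter.1 hc).1).1
    · simp [hc₀]
    · exact (Finset.mem_filter.1 hc).2

theorem ev_C (c w : Fin n → K) : ev c (fun i => (C (w i) : S K n)) = C (∑ i, c i * w i) := by
  simp [ev_apply]

theorem exists_dual (D : StepData H) {c : Fin (n+1) → K} (hc : D.res c ≠ 0) :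
    ∃ w : Fin (n+1) → K, ∑ i, H i * w i = 1 ∧ ∑ i, c i * w i = 0 := by
  obtain ⟨j, hj⟩ := Function.ne_iff.1 hc
  have hj' : ∑ i, c i * D.emb j i ≠ 0 := hj
  set a : K := (∑ i, c i * D.vec i) / ∑ i, c i * D.emb j i with ha
  have key : ∀ x : Fin (n+1) → K, ∑ i, x i * (D.vec i - a * D.emb j i) =
      ∑ i, x i * D.vec i - a * ∑ i, x i * D.emb j i := by
    intro x
    rw [Finset.mul_sum, ← Finset.sum_sub_distrib]
    exact Finset.sum_congr rfl fun i _ => by ring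
  refine ⟨fun i => D.vec i - a * D.emb j i, ?_, ?_⟩
  · rw [key, D.emb_ker, D.vec_one]; simp
  · rw [key, ha, div_mul_cancel₀ _ hj', sub_self]

theorem exists_r_ev_eq (D : StepData H) (hT : NonPar (insert H T)) (hH : H ∉ T)
    {T₀ : Finset (Fin (n+1) → K)}
    (hT₀ : T₀ ⊆ T) (hinj : Set.InjOn (plane H) (T₀ : Set (Fin (n+1) → K))) {f : S K n}
    (hf : f ∈ prodIdeal (T₀.image D.res)) :
    ∃ θ ∈ Dm T (fun _ => 1), D.r (ev H θ) = (∏ c ∈ T \ T₀, linForm (D.res c)) * f := by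
  have hri : Set.InjOn D.res (T₀ : Set (Fin (n+1) → K)) := by
    intro c hc c' hc' h
    exact hinj hc hc' (D.plane_eq_of_res hT hH (hT₀ hc) (hT₀ hc') (t := 1) (by simp [h]))
  have hw : ∀ (T' : Finset (Fin (n+1) → K)) (w : Fin (n+1) → K), ∑ i, H i * w i = 1 →
      T' ⊆ T → (∀ c ∈ T, c ∉ T' → ∑ i, c i * w i = 0) →
      ∃ θ ∈ Dm T (fun _ => 1), D.r (ev H θ) = ∏ c ∈ T', linForm (D.res c) := by
    intro T' w h1 h2 h3
    refine ⟨(∏ c ∈ T', linForm c) • fun i => C (w i), fun c hc => ?_, ?_⟩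
    · rw [map_smul, ev_C, smul_eq_mul, pow_one]
      by_cases hcT : c ∈ T'
      · exact (Finset.dvd_prod_of_mem _ hcT).mul_right _
      · rw [h3 c hc hcT]; simp
    · rw [map_smul, ev_C, h1, smul_eq_mul, map_one, mul_one, map_prod]
      simp only [D.r_linForm]
  refine Submodule.span_induction (p := fun f _ => ∃ θ ∈ Dm T (fun _ => 1),
    D.r (ev H θ) = (∏ c ∈ T \ T₀, linForm (D.res c)) * f) ?_ ?_ ?_ ?_ hf
  · rintro _ (rfl | ⟨b, hb, rfl⟩)
    · obtain ⟨θ, h1, h2⟩ := hw T D.vec D.vec_one subset_rfl fun c h h' => absurd h h'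
      refine ⟨θ, h1, ?_⟩
      rw [h2, Finset.prod_image hri, Finset.prod_sdiff hT₀]
    · rw [Finset.mem_coe, Finset.mem_image] at hb
      obtain ⟨c₁, hc₁, rfl⟩ := hb
      obtain ⟨w, hw1, hw2⟩ := D.exists_dual (D.res_ne_zero hT hH (hT₀ hc₁))
      obtain ⟨θ, h1, h2⟩ := hw (T.erase c₁) w hw1 (Finset.erase_subset _ _) (by
        intro c hc hc'
        have : c = c₁ := by
          by_contra hne
          exact hc' (Finset.mem_erase.2 ⟨hne, hc⟩)
        rw [this, hw2])
      refine ⟨θ, h1, ?_⟩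
      have h3 : (T₀.image D.res).erase (D.res c₁) = (T₀.erase c₁).image D.res := by
        ext b
        simp only [Finset.mem_erase, Finset.mem_image]
        constructor
        · rintro ⟨h, c, hc, rfl⟩
          exact ⟨c, ⟨fun hh => h (by rw [hh]), hc⟩, rfl⟩
        · rintro ⟨c, ⟨h, hc⟩, rfl⟩
          exact ⟨fun hh => h (hri hc hc₁ hh), c, hc, rfl⟩
      have h4 : T \ T₀ = T.erase c₁ \ T₀.erase c₁ := by
        ext c
        simp only [Finset.mem_sdiff, Finset.mem_erase]
        have : c = c₁ → c ∈ T₀ := fun h => h ▸ hc₁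
        tauto
      dsimp only
      rw [h2, h3, Finset.prod_image (hri.mono (by simp)), h4,
        Finset.prod_sdiff (Finset.erase_subset_erase _ hT₀)]
  · exact ⟨0, Submodule.zero_mem _, by simp⟩
  · rintro f g - - ⟨θ, h1, h2⟩ ⟨η, h3, h4⟩
    exact ⟨θ + η, Submodule.add_mem _ h1 h3, by rw [map_add, map_add, h2, h4, mul_add]⟩
  · rintro s f - ⟨θ, h1, h2⟩
    refine ⟨D.sec s • θ, Submodule.smul_mem _ _ h1, ?_⟩
    rw [map_smul, smul_eq_mul, map_mul, D.r_sec, h2, smul_eq_mul]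
    ring

end StepData

end

section

variable {n : ℕ}

namespace StepData

variable {H : Fin (n+1) → K} (D : StepData H) {T : Finset (Fin (n+1) → K)}

/-- The restricted values on `H` of logarithmic vector fields of degree `d`. -/
noncomputable def evImage (T : Finset (Fin (n+1) → K)) (d : ℕ) : Submodule K (S K n) :=
  (grV (Dm T (fun _ => 1)) d).map (D.r.toLinearMap ∘ₗ (ev H).restrictScalars K)

theorem mem_evImage {d : ℕ} {f : S K n} : f ∈ D.evImage T d ↔
    ∃ θ ∈ grV (Dm T (fun _ => 1)) d, D.r (ev H θ) = f := Iff.rfl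

instance finite_evImage (d : ℕ) : Module.Finite K (D.evImage T d) := by
  unfold evImage; infer_instance

theorem HF_insert_add (T : Finset (Fin (n+1) → K)) (d : ℕ) :
    HF (Dm (insert H T) (fun _ => 1)) d + Module.finrank K (D.evImage T d) =
      HF (Dm T (fun _ => 1)) d := by
  let F := (D.r.toLinearMap ∘ₗ (ev H).restrictScalars K).domRestrict (grV (Dm T (fun _ => 1)) d)
  have h1 := LinearMap.finrank_range_add_finrank_ker F
  have h2 : LinearMap.range F = D.evImage T d := LinearMap.range_domRestrict _ _
  have h3 : (LinearMap.ker F).map (Submodule.subtype _) = grV (Dm (insert H T) (fun _ => 1)) d := by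
    ext θ
    simp only [Submodule.mem_map, LinearMap.mem_ker, Submodule.subtype_apply]
    constructor
    · rintro ⟨⟨θ, hθ⟩, h, rfl⟩
      refine ⟨fun c hc => ?_, hθ.2⟩
      rcases Finset.mem_insert.1 hc with rfl | hc
      · rw [pow_one]; exact (D.r_eq_zero_iff _).1 h
      · exact hθ.1 c hc
    · rintro ⟨h4, h5⟩
      refine ⟨⟨θ, fun c hc => h4 c (Finset.mem_insert_of_mem hc), h5⟩, ?_, rfl⟩
      refine (D.r_eq_zero_iff _).2 ?_
      simpa using h4 H (by simp)
  have h4 : Module.finrank K (LinearMap.ker F) = HF (Dm (insert H T) (fun _ => 1)) d := by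
    rw [HF, ← h3]
    exact (LinearEquiv.finrank_eq (Submodule.equivMapOfInjective _
      (Submodule.subtype_injective _) _))
  rw [h2, h4] at h1
  rw [add_comm]; exact h1

theorem finrank_evImage_le {B : S K n} {b : ℕ} (hB : B.IsHomogeneous b)
    (hd : ∀ θ ∈ Dm T (fun _ => 1), B ∣ D.r (ev H θ)) (d : ℕ) :
    Module.finrank K (D.evImage T d) ≤ hs n b d := by
  have : D.evImage T d ≤ (shiftHom K n b d).map (LinearMap.mulLeft K B) := by
    intro f hf
    obtain ⟨θ, hθ, rfl⟩ := D.mem_evImage.1 hf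
    obtain ⟨g, hg⟩ := hd θ hθ.1
    refine ⟨shiftComp n b d g, shiftComp_mem n b d g, ?_⟩
    rw [LinearMap.mulLeft_apply, ← homogeneousComponent_mul_left d hB, ← hg]
    exact homogeneousComponent_eq_self (D.r_isHomogeneous (ev_isHomogeneous _ hθ.2))
  refine (Submodule.finrank_mono this).trans ?_
  rw [← finrank_shiftHom (K := K)]
  exact Submodule.finrank_map_le _ _

theorem HI_le_finrank_evImage {B : S K n} {b : ℕ} (hB : B.IsHomogeneous b) (hB0 : B ≠ 0)
    {J : Ideal (S K n)} (hJ : ∀ f ∈ J, ∃ θ ∈ Dm T (fun _ => 1), D.r (ev H θ) = B * f) (d : ℕ) :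
    HI J d ≤ Module.finrank K (D.evImage T (b + d)) := by
  have : (grI J d).map (LinearMap.mulLeft K B) ≤ D.evImage T (b + d) := by
    rintro _ ⟨f, hf, rfl⟩
    obtain ⟨θ, hθ, h⟩ := hJ f hf.1
    refine D.mem_evImage.2 ⟨compV _ _ (b + d) θ, ⟨compV_mem_Dm hθ _, compV_mem _ _⟩, ?_⟩
    rw [ev_homogeneousComponent, D.r_homogeneousComponent, h]
    exact homogeneousComponent_eq_self (hB.mul hf.2)
  refine le_trans (le_of_eq ?_) (Submodule.finrank_mono this)
  exact LinearEquiv.finrank_eq (Submodule.equivMapOfInjective _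
    (mul_right_injective₀ hB0) _)

end StepData

/-- The number of planes through `H` and a member of `T`. -/
noncomputable def planeCount (H : Fin n → K) (T : Finset (Fin n → K)) : ℕ :=
  (T.image (plane H)).card

theorem err_HF_insert {H : Fin (n+2) → K} {T : Finset (Fin (n+2) → K)}
    (hT : NonPar (insert H T)) (hH : H ∉ T) :
    Err (fun d => (HF (Dm T (fun _ => 1)) d : ℤ) - HF (Dm (insert H T) (fun _ => 1)) d
      - hs (n+1) (T.card - planeCount H T) d) (n - 1) := by
  have h0 : H ≠ 0 := hT.1 H (by simp)
  obtain ⟨e⟩ := ker_toFunc_equiv h0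
  obtain ⟨D, -⟩ := exists_stepData h0 e
  obtain ⟨T₀, hT₀, hinj, himg⟩ := Finset.exists_subset_injOn_image_eq_of_surjOn
    (T : Set (Fin (n+2) → K)) (T.image (plane H)) (by
      intro U hU; simpa using hU)
  have hT₀' : T₀ ⊆ T := by exact_mod_cast hT₀
  have hcard : T₀.card = planeCount H T := by
    rw [planeCount, ← himg, Finset.card_image_of_injOn hinj]
  set B := ∏ c ∈ T \ T₀, linForm (D.res c) with hBdef
  set b := T.card - planeCount H T with hb
  have hBh : B.IsHomogeneous b := by
    have := prod_isHomogeneous (T \ T₀) D.res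
    rwa [Finset.card_sdiff_of_subset hT₀', hcard] at this
  have hB0 : B ≠ 0 := Finset.prod_ne_zero_iff.2 fun c hc =>
    linForm_ne_zero (D.res_ne_zero hT hH (Finset.mem_sdiff.1 hc).1)
  have hnp : NonPar (T₀.image D.res) := by
    constructor
    · intro x hx
      obtain ⟨c, hc, rfl⟩ := Finset.mem_image.1 hx
      exact D.res_ne_zero hT hH (hT₀' hc)
    · intro x hx x' hx' hne t ht
      obtain ⟨c, hc, rfl⟩ := Finset.mem_image.1 hx
      obtain ⟨c', hc', rfl⟩ := Finset.mem_image.1 hx'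
      exact hne (congrArg _ (hinj hc hc' (D.plane_eq_of_res hT hH (hT₀' hc) (hT₀' hc') ht)))
  have hup := D.finrank_evImage_le hBh (fun θ hθ => D.prod_dvd_r_ev hT hH hT₀' himg hθ)
  have hlo := D.HI_le_finrank_evImage hBh hB0 (J := prodIdeal (T₀.image D.res))
    fun f hf => D.exists_r_ev_eq hT hH hT₀' hinj hf
  obtain ⟨c, hc⟩ := bd_prodIdeal hnp
  have hkey : ∀ d, (HF (Dm T (fun _ => 1)) d : ℤ) - HF (Dm (insert H T) (fun _ => 1)) d
      = Module.finrank K (D.evImage T d) := by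
    intro d; rw [← D.HF_insert_add T d]; push_cast; ring
  refine ⟨(b + 1) * |c|, fun d => ?_⟩
  dsimp only
  rw [hkey, abs_sub_comm, abs_of_nonneg (by rw [sub_nonneg]; exact_mod_cast hup d)]
  by_cases hbd : b ≤ d
  · obtain ⟨k, rfl⟩ := Nat.exists_eq_add_of_le hbd
    have h1 : (HI (prodIdeal (T₀.image D.res)) k : ℤ) ≤ Module.finrank K (D.evImage T (b + k)) := by
      exact_mod_cast hlo k
    have h2 : hs (n+1) b (b + k) = (n+1).multichoose k := by simp [hs]
    have h3 := hc k
    rw [h2]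
    dsimp only at h3
    set x : ℤ := (n+1).multichoose k - HI (prodIdeal (T₀.image D.res)) k
    have hx : 0 ≤ x := by
      rw [sub_nonneg]; exact_mod_cast HI_le _ _
    push_cast
    have h4 : ((b : ℤ) + k + 1) ≤ (b + 1) * (k + 1) := by nlinarith [mul_nonneg (Int.natCast_nonneg b) (Int.natCast_nonneg k)]
    have h5 : ((k : ℤ) + 1) ^ (n - 1) ≤ (b + k + 1) ^ (n - 1) :=
      pow_le_pow_left₀ (by positivity) (by omega) _
    calc ((b : ℤ) + k + 1) * ((n+1).multichoose k - Module.finrank K (D.evImage T (b + k)))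
        ≤ (b + k + 1) * x := mul_le_mul_of_nonneg_left (sub_le_sub_left h1 _) (by positivity)
      _ ≤ (b + 1) * (k + 1) * x := by gcongr
      _ = (b + 1) * ((k + 1) * x) := by ring
      _ ≤ (b + 1) * (c * (k + 1) ^ (n-1)) := by gcongr
      _ ≤ (b + 1) * (|c| * (b + k + 1) ^ (n-1)) := by
        have := le_abs_self c
        gcongr
      _ = _ := by ring
  · have h1 : hs (n+1) b d = 0 := by simp [hs, hbd]
    have h2 : Module.finrank K (D.evImage T d) = 0 := by have := hup d; omega
    rw [h1, h2]
    simp only [Nat.cast_zero, sub_self, mul_zero]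
    positivity

/-! ### The second Betti number -/

/-- The second Betti number of a finite set of covectors. -/
noncomputable def b2F (T : Finset (Fin n → K)) : ℕ :=
  ∑ᶠ U ∈ {U : Submodule K (Fin n → K) | Module.finrank K U = 2}, ((T.filter (· ∈ U)).card - 1)

theorem exists_pair_of_card_sub_one_ne_zero {T : Finset (Fin n → K)}
    {U : Submodule K (Fin n → K)} (h : (T.filter (· ∈ U)).card - 1 ≠ 0) :
    ∃ c ∈ T, ∃ c' ∈ T, c ≠ c' ∧ c ∈ U ∧ c' ∈ U := by
  obtain ⟨c, hc, c', hc', hne⟩ := Finset.one_lt_card.1 (show 1 < (T.filter (· ∈ U)).card by omega)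
  rw [Finset.mem_filter] at hc hc'
  exact ⟨c, hc.1, c', hc'.1, hne, hc.2, hc'.2⟩

theorem b2F_eq_sum {T T' : Finset (Fin n → K)} (hT' : NonPar T') (hT : T ⊆ T') :
    b2F T = ∑ U ∈ ((T' ×ˢ T').image (fun x => plane x.1 x.2)).filter
      (fun U : Submodule K (Fin n → K) => Module.finrank K U = 2),
        ((T.filter (· ∈ U)).card - 1) := by
  rw [b2F]
  apply finsum_mem_eq_sum_of_inter_support_eq
  ext U
  simp only [Set.mem_inter_iff, Set.mem_ofPred_eq, Function.mem_support, Finset.coe_filter,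
    Finset.mem_image, Finset.mem_product, Prod.exists]
  constructor
  · rintro ⟨h1, h2⟩
    obtain ⟨c, hc, c', hc', hne, hU, hU'⟩ := exists_pair_of_card_sub_one_ne_zero h2
    exact ⟨⟨⟨c, c', ⟨hT hc, hT hc'⟩, plane_eq hT' (hT hc) (hT hc') hne h1 hU hU'⟩, h1⟩, h2⟩
  · rintro ⟨⟨-, h1⟩, h2⟩
    exact ⟨h1, h2⟩

theorem b2F_insert {H : Fin n → K} {T : Finset (Fin n → K)} (hT : NonPar (insert H T))
    (hH : H ∉ T) : b2F (insert H T) = b2F T + planeCount H T := by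
  rw [b2F_eq_sum hT subset_rfl, b2F_eq_sum hT (Finset.subset_insert _ _)]
  set F := ((insert H T ×ˢ insert H T).image (fun x => plane x.1 x.2)).filter
      (fun U : Submodule K (Fin n → K) => Module.finrank K U = 2) with hF
  have h1 : T.image (plane H) ⊆ F := by
    intro U hU
    obtain ⟨c, hc, rfl⟩ := Finset.mem_image.1 hU
    refine Finset.mem_filter.2 ⟨Finset.mem_image.2 ⟨(H, c), by simp [hc], rfl⟩, ?_⟩
    exact finrank_plane hT (by simp) (by simp [hc]) (fun h => hH (h ▸ hc))
  have h2 : planeCount H T = ∑ U ∈ F, if U ∈ T.image (plane H) then 1 else 0 := by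
    rw [Finset.sum_ite_mem, Finset.inter_eq_right.2 h1, planeCount, Finset.card_eq_sum_ones]
  rw [h2, ← Finset.sum_add_distrib]
  refine Finset.sum_congr rfl fun U hU => ?_
  have hU2 := (Finset.mem_filter.1 hU).2
  have h3 : U ∈ T.image (plane H) ↔ H ∈ U ∧ (T.filter (· ∈ U)).Nonempty := by
    rw [Finset.mem_image]
    constructor
    · rintro ⟨c, hc, rfl⟩
      exact ⟨left_mem_plane _ _, c, Finset.mem_filter.2 ⟨hc, right_mem_plane _ _⟩⟩
    · rintro ⟨hHU, c, hc⟩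
      rw [Finset.mem_filter] at hc
      exact ⟨c, hc.1, plane_eq hT (by simp) (by simp [hc.1])
        (fun (h : H = c) => hH (h ▸ hc.1)) hU2 hHU hc.2⟩
  rw [Finset.filter_insert]
  simp only [h3, ← Finset.card_pos]
  by_cases hHU : H ∈ U
  · rw [if_pos hHU, Finset.card_insert_of_notMem (by simp [hH])]
    simp only [hHU, true_and]
    split_ifs <;> omega
  · simp [hHU]

theorem b2Simple_eq (A : Arrangement K n) : b2Simple A = b2F A.hyps := by
  rw [b2Simple, b2F]
  apply finsum_mem_inter_support_eq'
  intro U hU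
  refine ⟨fun h => h.1, fun h => ⟨h, le_antisymm (Submodule.span_le.2 fun c hc =>
    (Finset.mem_filter.1 hc).2) ?_⟩⟩
  obtain ⟨c, hc, c', hc', hne, hcU, hcU'⟩ := exists_pair_of_card_sub_one_ne_zero hU
  rw [← plane_eq ⟨A.ne_zero, A.nonparallel⟩ hc hc' hne h hcU hcU', plane]
  refine Submodule.span_mono ?_
  rintro x (rfl | rfl)
  · exact Finset.mem_filter.2 ⟨hc, left_mem_plane _ _⟩
  · exact Finset.mem_filter.2 ⟨hc', right_mem_plane _ _⟩

/-! ### The expansion of the Hilbert function -/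

theorem HF_Dm_empty (d : ℕ) :
    HF (Dm (∅ : Finset (Fin n → K)) (fun _ => 1)) d = n * n.multichoose d := by
  have hb : IsHBasis (Dm (∅ : Finset (Fin n → K)) (fun _ => 1)) (fun _ : Fin n => 0)
      (fun i => Pi.single i 1) := by
    refine ⟨fun i => ⟨fun c hc => by simp at hc, mem_homV.2 fun j => ?_⟩, fun v _ => ⟨v, ?_, ?_⟩⟩
    · by_cases h : j = i
      · subst h; simpa using isHomogeneous_one _ _
      · simpa [h] using isHomogeneous_zero _ _ _
    · exact pi_eq_sum_univ' v
    · intro f hf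
      rw [hf]
      exact pi_eq_sum_univ' f
  rw [hb.HF_eq]
  simp [hs_zero]

theorem err_HF {T : Finset (Fin (n+2) → K)} (hT : NonPar T) :
    Err (fun d => (HF (Dm T (fun _ => 1)) d : ℤ) - ((n+2) * (n+2).multichoose d
      - T.card * (n+1).multichoose d + (T.card.choose 2 - b2F T) * n.multichoose d)) (n - 1) := by
  induction T using Finset.induction_on with
  | empty =>
    have : b2F (∅ : Finset (Fin (n+2) → K)) = 0 := by simp [b2F]
    simpa [HF_Dm_empty, this] using Err.zero (n-1)
  | insert H T hH ih =>
    have h1 := err_HF_insert hT hH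
    have h2 := err_hs_sub_linear n (T.card - planeCount H T)
    have h3 := ((ih (hT.mono (Finset.subset_insert _ _))).sub h1).sub h2
    convert h3 using 2
    have h4 : planeCount H T ≤ T.card := Finset.card_image_le
    rw [Finset.card_insert_of_notMem hH, b2F_insert hT hH, Nat.choose_succ_succ' T.card 1,
      Nat.cast_sub h4]
    push_cast [Nat.choose_one_right]
    ring

end

section

variable {n : ℕ}

/-! ### Euler–Ziegler restrictions as quotients of the set of hyperplanes -/

theorem Arrangement.nonPar (A : Arrangement K n) : NonPar A.hyps := ⟨A.ne_zero, A.nonparallel⟩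

theorem plane_eq_iff {T : Finset (Fin n → K)} (hT : NonPar T) {H c c' : Fin n → K} (hH : H ∈ T)
    (hc : c ∈ T) (hc' : c' ∈ T) (hne : H ≠ c) (hne' : H ≠ c') :
    plane H c = plane H c' ↔ c' ∈ plane H c := by
  refine ⟨fun h => h ▸ right_mem_plane _ _, fun h => ?_⟩
  exact (plane_eq hT hH hc' hne' (finrank_plane hT hH hc hne) (left_mem_plane _ _) h).symm

theorem mem_plane_iff_finrank {T : Finset (Fin n → K)} (hT : NonPar T) {H c c' : Fin n → K}
    (hH : H ∈ T) (hc : c ∈ T) (hne : H ≠ c) :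
    c' ∈ plane H c ↔ Module.finrank K (Submodule.span K
      (({H, c, c'} : Finset (Fin n → K)) : Set (Fin n → K))) = 2 := by
  have hle : plane H c ≤ Submodule.span K (({H, c, c'} : Finset (Fin n → K)) : Set (Fin n → K)) :=
    Submodule.span_mono (by intro x hx; simp at hx ⊢; tauto)
  have h2 := finrank_plane hT hH hc hne
  constructor
  · intro h
    rw [← h2]
    refine congrArg (fun W : Submodule K (Fin n → K) => Module.finrank K W)
      (le_antisymm (Submodule.span_le.2 ?_) hle)
    intro x hx
    simp only [Finset.coe_insert, Finset.coe_singleton, Set.mem_insert_iff,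
      Set.mem_singleton_iff] at hx
    rcases hx with rfl | rfl | rfl
    · exact left_mem_plane _ _
    · exact right_mem_plane _ _
    · exact h
  · intro h
    rw [Submodule.eq_of_le_of_finrank_eq hle (h2.trans h.symm)]
    exact Submodule.subset_span (by simp)

/-- The covectors other than `H` that lie in the plane spanned by `H` and `c`. -/
noncomputable def planeClass (T : Finset (Fin n → K)) (H c : Fin n → K) : Finset (Fin n → K) :=
  (T.erase H).filter (· ∈ plane H c)

/-- The restriction map of an Euler–Ziegler restriction to `c₀`. -/
structure ResMap (A : Arrangement K (n+1)) (m : (Fin (n+1) → K) → ℕ) (c₀ : Fin (n+1) → K)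
    (B : Arrangement K n) (mB : (Fin n → K) → ℕ) where
  D : StepData c₀
  g : (Fin (n+1) → K) → (Fin n → K)
  mem : c₀ ∈ A.hyps
  maps : ∀ c ∈ A.hyps.erase c₀, g c ∈ B.hyps
  res : ∀ c ∈ A.hyps.erase c₀, ∃ t : K, t ≠ 0 ∧ D.res c = t • g c
  mult : ∀ c ∈ A.hyps.erase c₀, mB (g c) = ∑ c' ∈ planeClass A.hyps c₀ c, m c'
  surj : ∀ b ∈ B.hyps, ∃ c ∈ A.hyps.erase c₀, g c = b

namespace ResMap

variable {A : Arrangement K (n+1)} {m : (Fin (n+1) → K) → ℕ} {c₀ : Fin (n+1) → K}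
  {B : Arrangement K n} {mB : (Fin n → K) → ℕ}

theorem eq_iff (R : ResMap A m c₀ B mB) {c c' : Fin (n+1) → K} (hc : c ∈ A.hyps.erase c₀)
    (hc' : c' ∈ A.hyps.erase c₀) : R.g c' = R.g c ↔ c' ∈ plane c₀ c := by
  have hT : NonPar (insert c₀ (A.hyps.erase c₀)) := by
    rw [Finset.insert_erase R.mem]; exact A.nonPar
  obtain ⟨t, ht, h⟩ := R.res c hc
  obtain ⟨t', ht', h'⟩ := R.res c' hc'
  constructor
  · intro hg
    have : R.D.res c' = (t' * t⁻¹) • R.D.res c := by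
      rw [h, h', hg, smul_smul, inv_mul_cancel_right₀ ht]
    rw [R.D.plane_eq_of_res hT (by simp) hc hc' this]
    exact right_mem_plane _ _
  · intro hp
    obtain ⟨a, u, rfl⟩ := mem_plane.1 hp
    have hr : R.D.res (a • c₀ + u • c) = u • R.D.res c := by
      rw [R.D.res_add, R.D.res_smul, R.D.res_smul, R.D.res_self, smul_zero, zero_add]
    have hu : u ≠ 0 := by
      rintro rfl
      exact R.D.res_ne_zero hT (by simp) hc' (by rw [hr, zero_smul])
    refine eq_of_parallel B (R.maps _ hc') (R.maps _ hc) ⟨t', ht', h'⟩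
      ⟨u * t, mul_ne_zero hu ht, ?_⟩
    rw [hr, h, smul_smul]

theorem sum_mult (R : ResMap A m c₀ B mB) :
    m c₀ + ∑ b ∈ B.hyps, mB b = ∑ c ∈ A.hyps, m c := by
  rw [← Finset.add_sum_erase _ _ R.mem,
    ← Finset.sum_fiberwise_of_maps_to (s := A.hyps.erase c₀) (t := B.hyps) (g := R.g) R.maps]
  congr 1
  refine Finset.sum_congr rfl fun b hb => ?_
  obtain ⟨c, hc, rfl⟩ := R.surj b hb
  rw [R.mult c hc, planeClass]
  refine Finset.sum_congr (Finset.filter_congr fun c' hc' => ?_) fun _ _ => rfl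
  exact (R.eq_iff hc hc').symm

theorem mult_pos (R : ResMap A m c₀ B mB) (hm : ∀ c ∈ A.hyps, 0 < m c) {b : Fin n → K}
    (hb : b ∈ B.hyps) : 0 < mB b := by
  obtain ⟨c, hc, rfl⟩ := R.surj b hb
  rw [R.mult c hc]
  refine (hm c (Finset.mem_of_mem_erase hc)).trans_le
    (Finset.single_le_sum (f := m) (fun _ _ => Nat.zero_le _) ?_)
  exact Finset.mem_filter.2 ⟨hc, right_mem_plane _ _⟩

/-- Restriction drops the rank of a set of hyperplanes containing `c₀` by one. -/
theorem finrank_image (R : ResMap A m c₀ B mB) {T : Finset (Fin (n+1) → K)}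
    (hT : T ⊆ A.hyps.erase c₀) :
    Module.finrank K (Submodule.span K ((T.image R.g : Finset (Fin n → K)) : Set (Fin n → K))) + 1 =
      Module.finrank K (Submodule.span K
        ((insert c₀ T : Finset (Fin (n+1) → K)) : Set (Fin (n+1) → K))) := by
  let f : (Fin (n+1) → K) →ₗ[K] (Fin n → K) :=
    { toFun := R.D.res, map_add' := R.D.res_add, map_smul' := R.D.res_smul }
  set W := Submodule.span K ((insert c₀ T : Finset (Fin (n+1) → K)) : Set (Fin (n+1) → K)) with hW
  have h0 : c₀ ∈ W := Submodule.subset_span (by simp)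
  have hrange : LinearMap.range (f.domRestrict W) =
      Submodule.span K ((T.image R.g : Finset (Fin n → K)) : Set (Fin n → K)) := by
    rw [LinearMap.range_domRestrict, hW, Submodule.map_span]
    apply le_antisymm <;> rw [Submodule.span_le]
    · rintro _ ⟨c, hc, rfl⟩
      rcases Finset.mem_insert.1 (Finset.mem_coe.1 hc) with rfl | hc
      · change R.D.res c ∈ Submodule.span K _
        rw [R.D.res_self]
        exact Submodule.zero_mem _
      · obtain ⟨t, -, ht⟩ := R.res c (hT hc)
        change R.D.res c ∈ Submodule.span K _
        rw [ht]
        exact Submodule.smul_mem _ _ (Submodule.subset_span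
          (Finset.mem_coe.2 (Finset.mem_image_of_mem _ hc)))
    · intro b hb
      obtain ⟨c, hc, rfl⟩ := Finset.mem_image.1 (Finset.mem_coe.1 hb)
      obtain ⟨t, ht0, ht⟩ := R.res c (hT hc)
      have : R.g c = t⁻¹ • f c := by
        change R.g c = t⁻¹ • R.D.res c
        rw [ht, smul_smul, inv_mul_cancel₀ ht0, one_smul]
      rw [this]
      exact Submodule.smul_mem _ _ (Submodule.subset_span ⟨c, by simp [hc], rfl⟩)
  have hker : LinearMap.ker (f.domRestrict W) = Submodule.span K {(⟨c₀, h0⟩ : W)} := by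
    ext x
    rw [LinearMap.mem_ker, Submodule.mem_span_singleton]
    change R.D.res x.1 = 0 ↔ _
    rw [R.D.res_eq_zero_iff]
    exact exists_congr fun a => ⟨fun h => Subtype.ext h.symm, fun h => (congrArg Subtype.val h).symm⟩
  have h1 := LinearMap.finrank_range_add_finrank_ker (f.domRestrict W)
  rwa [hrange, hker, finrank_span_singleton] at h1
  intro h
  exact A.ne_zero c₀ R.mem (congrArg Subtype.val h)

end ResMap

theorem IsEZRes.nonempty_resMap {A : Arrangement K (n+1)} {m : (Fin (n+1) → K) → ℕ}
    {c₀ : Fin (n+1) → K} {B : Arrangement K n} {mB : (Fin n → K) → ℕ}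
    (h : IsEZRes A m c₀ B mB) : Nonempty (ResMap A m c₀ B mB) := by
  obtain ⟨hc₀, e, h1, h2⟩ := h
  obtain ⟨D, hD⟩ := exists_stepData (A.ne_zero _ hc₀) e
  choose! g hg using h1
  refine ⟨⟨D, g, hc₀, fun c hc => (hg c hc).1, fun c hc => ?_, fun c hc => ?_, fun b hb => ?_⟩⟩
  · obtain ⟨t, ht, h⟩ := (hg c hc).2.1
    exact ⟨t, ht, (hD c).trans h⟩
  · rw [(hg c hc).2.2, EZmult_eq A m hc₀]
    rfl
  · obtain ⟨c, hc, hp⟩ := h2 b hb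
    exact ⟨c, hc, eq_of_parallel B (hg c hc).1 hb (hg c hc).2.1 hp⟩

theorem exists_isEZRes (A : Arrangement K (n+1)) (m : (Fin (n+1) → K) → ℕ) {c₀ : Fin (n+1) → K}
    (hc₀ : c₀ ∈ A.hyps) : ∃ B mB, IsEZRes A m c₀ B mB := by
  obtain ⟨e⟩ := ker_toFunc_equiv (A.ne_zero _ hc₀)
  obtain ⟨D, hD⟩ := exists_stepData (A.ne_zero _ hc₀) e
  have hT : NonPar (insert c₀ (A.hyps.erase c₀)) := by
    rw [Finset.insert_erase hc₀]; exact A.nonPar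
  have hrep : ∀ U ∈ (A.hyps.erase c₀).image (plane c₀), ∃ c ∈ A.hyps.erase c₀, plane c₀ c = U :=
    fun U hU => Finset.mem_image.1 hU
  choose! ρ hρ using hrep
  let B : Arrangement K n :=
    { hyps := ((A.hyps.erase c₀).image (plane c₀)).image fun U => D.res (ρ U)
      ne_zero := by
        intro b hb
        obtain ⟨U, hU, rfl⟩ := Finset.mem_image.1 hb
        exact D.res_ne_zero hT (by simp) (hρ U hU).1
      nonparallel := by
        intro b hb b' hb' hne t ht
        obtain ⟨U, hU, rfl⟩ := Finset.mem_image.1 hb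
        obtain ⟨U', hU', rfl⟩ := Finset.mem_image.1 hb'
        have := D.plane_eq_of_res hT (by simp) (hρ U hU).1 (hρ U' hU').1 ht
        rw [(hρ U hU).2, (hρ U' hU').2] at this
        exact hne (by rw [this]) }
  have hpar : ∀ c ∈ A.hyps.erase c₀, ∀ c' ∈ A.hyps.erase c₀, plane c₀ c = plane c₀ c' →
      Parallel (D.res c) (D.res c') := by
    intro c hc c' hc' h
    obtain ⟨a, u, h'⟩ := mem_plane.1 (h ▸ right_mem_plane c₀ c')
    have hr : D.res c' = u • D.res c := by
      rw [← h', D.res_add, D.res_smul, D.res_smul, D.res_self, smul_zero, zero_add]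
    refine ⟨u, ?_, hr⟩
    rintro rfl
    exact D.res_ne_zero hT (by simp) hc' (by rw [hr, zero_smul])
  have hB : ∀ b ∈ B.hyps, ∃ c ∈ A.hyps.erase c₀, D.res c = b := by
    intro b hb
    obtain ⟨U, hU, rfl⟩ := Finset.mem_image.1 hb
    exact ⟨_, (hρ U hU).1, rfl⟩
  choose! σ hσ using hB
  refine ⟨B, fun b => EZmult A m c₀ (σ b), hc₀, e, fun c hc => ?_, fun b hb => ?_⟩
  · have hU := Finset.mem_image_of_mem (plane c₀) hc
    have hb : D.res (ρ (plane c₀ c)) ∈ B.hyps := Finset.mem_image_of_mem _ hU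
    refine ⟨_, hb, ?_, ?_⟩
    · rw [← hD]
      exact hpar _ (hρ _ hU).1 _ hc (hρ _ hU).2
    · have h1 : plane c₀ (σ (D.res (ρ (plane c₀ c)))) = plane c₀ c := by
        refine Eq.trans ?_ (hρ _ hU).2
        exact D.plane_eq_of_res (t := 1) hT (by simp) (hσ _ hb).1 (hρ _ hU).1
          (by rw [(hσ _ hb).2, one_smul])
      have h2 : ∀ c, EZmult A m c₀ c = (∑ c' ∈ A.hyps.filter (· ∈ plane c₀ c), m c') - m c₀ :=
        fun _ => rfl
      beta_reduce
      rw [h2, h2, h1]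
  · refine ⟨σ b, (hσ b hb).1, 1, one_ne_zero, ?_⟩
    rw [← hD, (hσ b hb).2, one_smul]

end

section

variable {n : ℕ}

/-! ### Combinatorial invariance -/

/-- A bijection between sets of covectors preserving the ranks of all subsets. -/
structure RankIso (T T' : Finset (Fin n → K)) (φ : (Fin n → K) → (Fin n → K)) : Prop where
  bijOn : Set.BijOn φ (T : Set (Fin n → K)) T'
  finrank_eq : ∀ X ⊆ T, Module.finrank K (Submodule.span K (X : Set (Fin n → K))) =
      Module.finrank K (Submodule.span K ((X.image φ : Finset (Fin n → K)) : Set (Fin n → K)))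

namespace RankIso

variable {T T' : Finset (Fin n → K)} {φ : (Fin n → K) → (Fin n → K)}

theorem map_mem (h : RankIso T T' φ) {c : Fin n → K} (hc : c ∈ T) : φ c ∈ T' :=
  h.bijOn.mapsTo hc

theorem ne (h : RankIso T T' φ) {c c' : Fin n → K} (hc : c ∈ T) (hc' : c' ∈ T) (hne : c ≠ c') :
    φ c ≠ φ c' := fun h' => hne (h.bijOn.injOn hc hc' h')

theorem mem_plane_iff (h : RankIso T T' φ) (hT : NonPar T) (hT' : NonPar T') {H c c' : Fin n → K}
    (hH : H ∈ T) (hc : c ∈ T) (hc' : c' ∈ T) (hne : H ≠ c) :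
    φ c' ∈ plane (φ H) (φ c) ↔ c' ∈ plane H c := by
  have hsub : ({H, c, c'} : Finset (Fin n → K)) ⊆ T := by
    intro x hx
    simp only [Finset.mem_insert, Finset.mem_singleton] at hx
    rcases hx with rfl | rfl | rfl <;> assumption
  rw [mem_plane_iff_finrank hT hH hc hne,
    mem_plane_iff_finrank hT' (h.map_mem hH) (h.map_mem hc) (h.ne hH hc hne),
    h.finrank_eq _ hsub, Finset.image_insert, Finset.image_insert, Finset.image_singleton]

theorem planeClass_eq (h : RankIso T T' φ) (hT : NonPar T) (hT' : NonPar T') {H c : Fin n → K}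
    (hH : H ∈ T) (hc : c ∈ T.erase H) :
    planeClass T' (φ H) (φ c) = (planeClass T H c).image φ := by
  obtain ⟨hne, hcT⟩ := Finset.mem_erase.1 hc
  ext x
  simp only [planeClass, Finset.mem_filter, Finset.mem_erase, Finset.mem_image]
  constructor
  · rintro ⟨⟨h1, h2⟩, h3⟩
    obtain ⟨c', hc', rfl⟩ := h.bijOn.surjOn h2
    exact ⟨c', ⟨⟨fun (e : c' = H) => h1 (by rw [e]), hc'⟩,
      (h.mem_plane_iff hT hT' hH hcT hc' hne.symm).1 h3⟩, rfl⟩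
  · rintro ⟨c', ⟨⟨h1, h2⟩, h3⟩, rfl⟩
    exact ⟨⟨h.ne h2 hH h1, h.map_mem h2⟩, (h.mem_plane_iff hT hT' hH hcT h2 hne.symm).2 h3⟩

theorem injOn_planeClass (h : RankIso T T' φ) (H c : Fin n → K) :
    Set.InjOn φ (planeClass T H c : Set (Fin n → K)) :=
  h.bijOn.injOn.mono fun _ hx => Finset.mem_of_mem_erase (Finset.mem_filter.1 hx).1

end RankIso

theorem card_image_le_card_image {α β γ : Type*} [DecidableEq β] [DecidableEq γ] {X : Finset α}
    {f : α → β} {g : α → γ} (h : ∀ x ∈ X, ∀ y ∈ X, f x = f y → g x = g y) :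
    (X.image g).card ≤ (X.image f).card := by
  have hs : ∀ u ∈ X.image f, ∃ x ∈ X, f x = u := fun u hu => Finset.mem_image.1 hu
  rcases X.eq_empty_or_nonempty with rfl | ⟨x₀, -⟩
  · simp
  have : Nonempty α := ⟨x₀⟩
  choose! s hs using hs
  refine (Finset.card_le_card ?_).trans (Finset.card_image_le (f := fun u => g (s u)))
  intro v hv
  obtain ⟨x, hx, rfl⟩ := Finset.mem_image.1 hv
  have hfx := Finset.mem_image_of_mem f hx
  exact Finset.mem_image.2 ⟨f x, hfx, h _ (hs _ hfx).1 _ hx (hs _ hfx).2⟩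

theorem RankIso.planeCount_eq {T T' : Finset (Fin n → K)} {φ : (Fin n → K) → (Fin n → K)}
    (h : RankIso T T' φ) (hT : NonPar T) (hT' : NonPar T') {H : Fin n → K}
    {X : Finset (Fin n → K)} (hH : H ∈ T) (hX : X ⊆ T) (hHX : H ∉ X) :
    planeCount (φ H) (X.image φ) = planeCount H X := by
  have key : ∀ x ∈ X, ∀ y ∈ X, (plane H x = plane H y ↔ plane (φ H) (φ x) = plane (φ H) (φ y)) := by
    intro x hx y hy
    have hx' : H ≠ x := fun (e : H = x) => hHX (e ▸ hx)
    have hy' : H ≠ y := fun (e : H = y) => hHX (e ▸ hy)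
    rw [plane_eq_iff hT hH (hX hx) (hX hy) hx' hy', plane_eq_iff hT' (h.map_mem hH)
      (h.map_mem (hX hx)) (h.map_mem (hX hy)) (h.ne hH (hX hx) hx') (h.ne hH (hX hy) hy'),
      h.mem_plane_iff hT hT' hH (hX hx) (hX hy) hx']
  rw [planeCount, planeCount, Finset.image_image]
  exact le_antisymm (card_image_le_card_image fun x hx y hy => (key x hx y hy).1)
    (card_image_le_card_image fun x hx y hy => (key x hx y hy).2)

theorem RankIso.b2F_image {T T' : Finset (Fin n → K)} {φ : (Fin n → K) → (Fin n → K)}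
    (h : RankIso T T' φ) (hT : NonPar T) (hT' : NonPar T') (X : Finset (Fin n → K)) (hX : X ⊆ T) :
    b2F (X.image φ) = b2F X := by
  induction X using Finset.induction_on with
  | empty => simp
  | insert H X hH ih =>
    have hXT := (Finset.subset_insert H X).trans hX
    have hHT := hX (Finset.mem_insert_self H X)
    have hsub : (insert H X).image φ ⊆ T' := by
      intro y hy
      obtain ⟨x, hx, rfl⟩ := Finset.mem_image.1 hy
      exact h.map_mem (hX hx)
    have hφ : φ H ∉ X.image φ := by
      intro h'
      obtain ⟨x, hx, hxH⟩ := Finset.mem_image.1 h'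
      exact hH (h.bijOn.injOn (hXT hx) hHT hxH ▸ hx)
    rw [Finset.image_insert] at hsub ⊢
    rw [b2F_insert (hT'.mono hsub) hφ, b2F_insert (hT.mono hX) hH, ih hXT,
      h.planeCount_eq hT hT' hHT hXT hH]

theorem RankIso.image_eq {T T' : Finset (Fin n → K)} {φ : (Fin n → K) → (Fin n → K)}
    (h : RankIso T T' φ) : T.image φ = T' := by
  apply Finset.coe_injective
  rw [Finset.coe_image, h.bijOn.image_eq]

theorem RankIso.b2F_eq {T T' : Finset (Fin n → K)} {φ : (Fin n → K) → (Fin n → K)}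
    (h : RankIso T T' φ) (hT : NonPar T) (hT' : NonPar T') : b2F T' = b2F T := by
  rw [← h.image_eq, h.b2F_image hT hT' T subset_rfl]

theorem isLocallyHeavy_iff (A : Arrangement K n) (m : (Fin n → K) → ℕ) (c₀ : Fin n → K) :
    IsLocallyHeavy A m c₀ ↔ c₀ ∈ A.hyps ∧ ∀ c ∈ A.hyps.erase c₀,
      2 ≤ (planeClass A.hyps c₀ c).card → ∑ c' ∈ planeClass A.hyps c₀ c, m c' ≤ m c₀ := by
  refine and_congr_right fun h0 => ?_
  have herase : ∀ U, (locHyps A U).erase c₀ = (A.hyps.erase c₀).filter (· ∈ U) := fun U => by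
    rw [locHyps]; ext x; simp only [Finset.mem_erase, Finset.mem_filter]; tauto
  constructor
  · intro h c hc hcard
    obtain ⟨hne, hcA⟩ := Finset.mem_erase.1 hc
    have h1 : c₀ ∈ locHyps A (plane c₀ c) := Finset.mem_filter.2 ⟨h0, left_mem_plane _ _⟩
    have h2 : c ∈ locHyps A (plane c₀ c) := Finset.mem_filter.2 ⟨hcA, right_mem_plane _ _⟩
    have := h (plane c₀ c) ⟨finrank_plane A.nonPar h0 hcA hne.symm, le_antisymm
      (Submodule.span_le.2 fun x hx => (Finset.mem_filter.1 hx).2)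
      (Submodule.span_mono (by rintro x (rfl | rfl) <;> assumption))⟩ (left_mem_plane _ _) (by
        have := Finset.card_erase_of_mem h1
        rw [herase] at this
        rw [planeClass] at hcard
        omega)
    rwa [herase] at this
  · intro h U hU hU0 hcard
    have h1 : c₀ ∈ locHyps A U := Finset.mem_filter.2 ⟨h0, hU0⟩
    have h2 := Finset.card_erase_of_mem h1
    obtain ⟨c, hc⟩ : ((locHyps A U).erase c₀).Nonempty := Finset.card_pos.1 (by omega)
    rw [herase] at h2 hc ⊢
    obtain ⟨hc, hcU⟩ := Finset.mem_filter.1 hc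
    obtain ⟨hne, hcA⟩ := Finset.mem_erase.1 hc
    have hp := plane_eq A.nonPar h0 hcA hne.symm hU.1 hU0 hcU
    have := h c hc
    rw [planeClass, hp] at this
    exact this (by omega)

theorem RankIso.sum_planeClass {T T' : Finset (Fin n → K)} {φ : (Fin n → K) → (Fin n → K)}
    (h : RankIso T T' φ) (hT : NonPar T) (hT' : NonPar T') {m m' : (Fin n → K) → ℕ}
    (hm : ∀ c ∈ T, m' (φ c) = m c) {H c : Fin n → K} (hH : H ∈ T) (hc : c ∈ T.erase H) :
    ∑ x ∈ planeClass T' (φ H) (φ c), m' x = ∑ x ∈ planeClass T H c, m x := by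
  rw [h.planeClass_eq hT hT' hH hc, Finset.sum_image (h.injOn_planeClass H c)]
  exact Finset.sum_congr rfl fun x hx =>
    hm x (Finset.mem_of_mem_erase (Finset.mem_filter.1 hx).1)

theorem RankIso.isLocallyHeavy {A A' : Arrangement K n} {φ : (Fin n → K) → (Fin n → K)}
    (h : RankIso A.hyps A'.hyps φ) {m m' : (Fin n → K) → ℕ}
    (hm : ∀ c ∈ A.hyps, m' (φ c) = m c) {c₀ : Fin n → K} (hl : IsLocallyHeavy A m c₀) :
    IsLocallyHeavy A' m' (φ c₀) := by
  obtain ⟨h0, hl⟩ := (isLocallyHeavy_iff A m c₀).1 hl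
  refine (isLocallyHeavy_iff A' m' (φ c₀)).2 ⟨h.map_mem h0, fun x hx hcard => ?_⟩
  obtain ⟨hne, hxA⟩ := Finset.mem_erase.1 hx
  obtain ⟨c, hc, rfl⟩ := h.bijOn.surjOn hxA
  have hc' : c ∈ A.hyps.erase c₀ := Finset.mem_erase.2 ⟨fun (e : c = c₀) => hne (by rw [e]), hc⟩
  rw [h.sum_planeClass A.nonPar A'.nonPar hm h0 hc', hm c₀ h0]
  refine hl c hc' ?_
  rwa [h.planeClass_eq A.nonPar A'.nonPar h0 hc',
    Finset.card_image_of_injOn (h.injOn_planeClass _ _)] at hcard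

theorem RankIso.restrict {A A' : Arrangement K (n+1)} {φ : (Fin (n+1) → K) → (Fin (n+1) → K)}
    (h : RankIso A.hyps A'.hyps φ) {m m' : (Fin (n+1) → K) → ℕ}
    (hm : ∀ c ∈ A.hyps, m' (φ c) = m c) {c₀ : Fin (n+1) → K} {B B' : Arrangement K n}
    {mB mB' : (Fin n → K) → ℕ} (R : ResMap A m c₀ B mB) (R' : ResMap A' m' (φ c₀) B' mB') :
    ∃ ψ, RankIso B.hyps B'.hyps ψ ∧ ∀ b ∈ B.hyps, mB' (ψ b) = mB b := by
  have hs := R.surj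
  choose! s hs using hs
  have hφ : ∀ c ∈ A.hyps.erase c₀, φ c ∈ A'.hyps.erase (φ c₀) := fun c hc => by
    obtain ⟨hne, hcA⟩ := Finset.mem_erase.1 hc
    exact Finset.mem_erase.2 ⟨h.ne hcA R.mem hne, h.map_mem hcA⟩
  have hg : ∀ c ∈ A.hyps.erase c₀, ∀ c' ∈ A.hyps.erase c₀,
      (R'.g (φ c') = R'.g (φ c) ↔ R.g c' = R.g c) := fun c hc c' hc' => by
    obtain ⟨hne, hcA⟩ := Finset.mem_erase.1 hc
    rw [R.eq_iff hc hc', R'.eq_iff (hφ c hc) (hφ c' hc'),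
      h.mem_plane_iff A.nonPar A'.nonPar R.mem hcA (Finset.mem_of_mem_erase hc') hne.symm]
  refine ⟨fun b => R'.g (φ (s b)), ⟨⟨fun b hb => R'.maps _ (hφ _ (hs b hb).1), ?_, ?_⟩, ?_⟩, ?_⟩
  · intro b hb b' hb' hbb
    have := (hg _ (hs b' hb').1 _ (hs b hb).1).1 hbb
    rwa [(hs b hb).2, (hs b' hb').2] at this
  · intro b' hb'
    obtain ⟨x, hx, rfl⟩ := R'.surj b' hb'
    obtain ⟨hne, hxA⟩ := Finset.mem_erase.1 hx
    obtain ⟨c, hc, rfl⟩ := h.bijOn.surjOn hxA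
    have hc' : c ∈ A.hyps.erase c₀ := Finset.mem_erase.2 ⟨fun (e : c = c₀) => hne (by rw [e]), hc⟩
    have hb := R.maps c hc'
    exact ⟨R.g c, hb, (hg c hc' _ (hs _ hb).1).2 (hs _ hb).2⟩
  · intro X hX
    have hsX : X.image s ⊆ A.hyps.erase c₀ := by
      intro c hc
      obtain ⟨b, hb, rfl⟩ := Finset.mem_image.1 hc
      exact (hs b (hX hb)).1
    have hφX : (X.image s).image φ ⊆ A'.hyps.erase (φ c₀) := by
      intro c hc
      obtain ⟨b, hb, rfl⟩ := Finset.mem_image.1 hc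
      exact hφ b (hsX hb)
    have h1 := R.finrank_image hsX
    have h2 := R'.finrank_image hφX
    have h3 := h.finrank_eq (insert c₀ (X.image s)) (Finset.insert_subset R.mem
      (hsX.trans (Finset.erase_subset _ _)))
    have h4 : (X.image s).image R.g = X := by
      rw [Finset.image_image]
      exact (Finset.image_congr fun b hb => (hs b (hX hb)).2).trans Finset.image_id
    have h5 : ((X.image s).image φ).image R'.g = X.image fun b => R'.g (φ (s b)) := by
      rw [Finset.image_image, Finset.image_image]; rfl
    rw [h4] at h1
    rw [h5] at h2
    rw [Finset.image_insert] at h3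
    omega
  · intro b hb
    have hsb := hs b hb
    rw [R'.mult _ (hφ _ hsb.1), h.sum_planeClass A.nonPar A'.nonPar hm R.mem hsb.1,
      ← R.mult _ hsb.1, hsb.2]

theorem Flag.of_rankIso : {n : ℕ} → {A A' : Arrangement K n} → {m m' : (Fin n → K) → ℕ} →
    {e : Fin n → ℕ} → {φ : (Fin n → K) → (Fin n → K)} → RankIso A.hyps A'.hyps φ →
    (∀ c ∈ A.hyps, m' (φ c) = m c) → Flag n A m e → Flag n A' m' e
  | 0, _, _, _, _, _, _, _, _, _ => trivial
  | n+1, A, A', m, m', e, φ, h, hm, ⟨c₀, B, mB, h1, h2, h3, h4, h5⟩ => by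
    obtain ⟨R⟩ := h1.nonempty_resMap
    obtain ⟨B', mB', h1'⟩ := exists_isEZRes A' m' (h.map_mem R.mem)
    obtain ⟨R'⟩ := h1'.nonempty_resMap
    obtain ⟨ψ, hψ, hψm⟩ := h.restrict hm R R'
    have hall : ∀ P : ℕ → Prop, (∀ c ∈ A.hyps, P (m c)) → ∀ c ∈ A'.hyps, P (m' c) := by
      intro P hP c hc
      obtain ⟨x, hx, rfl⟩ := h.bijOn.surjOn hc
      rw [hm x hx]
      exact hP x hx
    exact ⟨φ c₀, B', mB', h1', h2.imp (h.isLocallyHeavy hm) (hall (· = 1)),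
      (hm c₀ R.mem).trans h3, hall (0 < ·) h4, of_rankIso hψ hψm h5⟩

theorem CombEquiv.exists_rankIso {A A' : Arrangement K n} (h : CombEquiv A A') :
    ∃ φ, RankIso A.hyps A'.hyps φ := by
  obtain ⟨φ, h1, h2⟩ := h
  exact ⟨φ, h1, fun X hX => h2 X hX⟩

end

section

variable {n : ℕ}

/-! ### The second Betti number and freeness -/

theorem Flag.sum_eq : {n : ℕ} → {A : Arrangement K n} → {m : (Fin n → K) → ℕ} →
    {e : Fin n → ℕ} → Flag n A m e → ∑ i, e i = ∑ c ∈ A.hyps, m c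
  | 0, A, m, e, _ => by
    have : A.hyps = ∅ := Finset.eq_empty_of_forall_notMem fun c hc =>
      A.ne_zero c hc (Subsingleton.elim _ _)
    simp [this]
  | n+1, A, m, e, ⟨c₀, B, mB, h1, _, h3, _, h5⟩ => by
    obtain ⟨R⟩ := h1.nonempty_resMap
    rw [← R.sum_mult, ← h5.sum_eq, Fin.sum_univ_succ, h3]
    rfl

/-- The second elementary symmetric function. -/
def esymmTwo (e : Fin n → ℕ) : ℕ := ∑ i, ∑ j, if i < j then e i * e j else 0

theorem choose_two_sum : {n : ℕ} → (e : Fin n → ℕ) →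
    (∑ i, e i).choose 2 = ∑ i, (e i).choose 2 + esymmTwo e
  | 0, e => by simp [esymmTwo]
  | n+1, e => by
    have h1 : esymmTwo e = e 0 * ∑ i, Fin.tail e i + esymmTwo (Fin.tail e) := by
      simp [esymmTwo, Fin.sum_univ_succ, Fin.tail, Finset.mul_sum]
    have h2 : ∀ a b : ℕ, (a + b).choose 2 = a.choose 2 + b.choose 2 + a * b := by
      intro a b
      induction b with
      | zero => simp
      | succ b ih =>
        rw [← add_assoc, Nat.choose_succ_succ' (a + b), Nat.choose_succ_succ' b, ih]
        simp only [Nat.choose_one_right]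
        ring
    rw [h1, Fin.sum_univ_succ, Fin.sum_univ_succ, h2]
    change (e 0).choose 2 + (∑ i, Fin.tail e i).choose 2 + _ = _
    rw [choose_two_sum (Fin.tail e)]
    simp only [Fin.tail]
    ring

theorem Flag.err_dfct {A : Arrangement K (n+2)} {e : Fin (n+2) → ℕ}
    (h : Flag (n+2) A (fun _ => 1) e) :
    Err (fun d => dfct A.hyps (fun _ => 1) e d
      - ((b2Simple A : ℤ) - esymmTwo e) * n.multichoose d) (n - 1) := by
  have h1 := (Err.sum Finset.univ fun i _ => err_hs_sub_quadratic n (e i)).sub (err_HF A.nonPar)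
  have hsum : (∑ i, (e i : ℤ)) = A.hyps.card := by
    have := h.sum_eq
    rw [Finset.sum_const, smul_eq_mul, mul_one] at this
    exact_mod_cast this
  have hch : (A.hyps.card.choose 2 : ℤ) = ∑ i, ((e i).choose 2 : ℤ) + esymmTwo e := by
    have := choose_two_sum e
    rw [h.sum_eq, Finset.sum_const, smul_eq_mul, mul_one] at this
    exact_mod_cast this
  refine (congrArg (fun f => Err f (n-1)) (funext fun d => ?_)).mp h1
  rw [dfct, b2Simple_eq, Finset.sum_sub_distrib, Finset.sum_add_distrib, Finset.sum_sub_distrib,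
    ← Finset.sum_mul, ← Finset.sum_mul, hsum, hch]
  simp
  ring

theorem dfct_eq_zero {T : Finset (Fin n → K)} {m : (Fin n → K) → ℕ} {d e : Fin n → ℕ}
    {b : Fin n → Fin n → S K n} (hb : IsHBasis (Dm T m) d b)
    (hde : Finset.univ.val.map d = Finset.univ.val.map e) (k : ℕ) : dfct T m e k = 0 := by
  have h1 : ∑ i, hs n (d i) k = ∑ i, hs n (e i) k := by
    have := congrArg (fun s : Multiset ℕ => (s.map fun a => hs n a k).sum) hde
    simp only [Multiset.map_map] at this
    exact this
  rw [dfct, hb.HF_eq, ← Nat.cast_sum, h1, sub_self]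

/-- The three conditions are equivalent: `A` is free; `A` is free with exponents `e`; the second
Betti number of `A` is the second elementary symmetric function of `e`. -/
def FreeCriterion (A : Arrangement K n) (e : Fin n → ℕ) : Prop :=
  (IsFree A (fun _ => 1) → ∃ d, IsFreeWithExp A (fun _ => 1) d ∧
    Finset.univ.val.map d = Finset.univ.val.map e) ∧
  ((∃ d, IsFreeWithExp A (fun _ => 1) d ∧ Finset.univ.val.map d = Finset.univ.val.map e) →
    b2Simple A = esymmTwo e) ∧
  (b2Simple A = esymmTwo e → IsFreeWithExp A (fun _ => 1) e)

theorem b2Simple_eq_card_sub_one (A : Arrangement K 2) : b2Simple A = A.hyps.card - 1 := by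
  have h1 : {U : Submodule K (Fin 2 → K) | Module.finrank K U = 2} = {⊤} := by
    ext U
    simp only [Set.mem_ofPred_eq, Set.mem_singleton_iff]
    constructor
    · intro h
      exact Submodule.eq_top_of_finrank_eq (by rw [h]; simp)
    · rintro rfl
      simp
  rw [b2Simple_eq, b2F, h1, finsum_mem_singleton]
  simp

theorem b2Simple_eq_zero (A : Arrangement K 1) : b2Simple A = 0 := by
  have h1 : {U : Submodule K (Fin 1 → K) | Module.finrank K U = 2} = ∅ := by
    ext U
    simp only [Set.mem_ofPred_eq, Set.mem_empty_iff_false, iff_false]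
    have := U.finrank_le
    simp at this
    omega
  rw [b2Simple_eq, b2F, h1, finsum_mem_empty]

theorem isFreeWithExp_one_variable (A : Arrangement K 1) {c₀ : Fin 1 → K} (hc₀ : c₀ ∈ A.hyps)
    {e : Fin 1 → ℕ} (he : e 0 = 1) : IsFreeWithExp A (fun _ => 1) e := by
  have hlin : ∀ c : Fin 1 → K, linForm c = C (c 0) * X 0 := fun c => by simp [linForm]
  have hev : ∀ (c : Fin 1 → K) (θ : Fin 1 → S K 1), ev c θ = C (c 0) * θ 0 := fun c θ => by
    simp [ev_apply]
  refine (isFreeWithExp_iff _ _ _).2 ⟨fun _ _ => X 0, fun i => ⟨fun c _ => ?_, mem_homV.2 fun j => ?_⟩,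
    fun v hv => ?_⟩
  · rw [pow_one, hlin, hev]
  · rw [Subsingleton.elim i 0, he]
    exact isHomogeneous_X _ _
  · obtain ⟨f, hf⟩ := mem_Dm.1 hv c₀ hc₀
    have hne : c₀ 0 ≠ 0 := fun h0 => A.ne_zero c₀ hc₀ (funext fun i => by
      rw [Subsingleton.elim i 0, h0]; rfl)
    rw [pow_one, hlin, hev, mul_assoc] at hf
    have hf' := mul_left_cancel₀ (by simpa using hne) hf
    refine ⟨fun _ => f, ?_, fun g hg => ?_⟩
    · funext i
      rw [Subsingleton.elim i 0, hf']
      simp [mul_comm]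
    · funext i
      have := congrFun hg 0
      rw [hf'] at this
      simp only [Finset.univ_unique, Fin.default_eq_zero, Finset.sum_singleton, Pi.smul_apply,
        smul_eq_mul, mul_comm (X 0 : S K 1)] at this
      rw [Subsingleton.elim i 0]
      exact (mul_right_cancel₀ (X_ne_zero 0) this).symm

theorem Flag.freeCriterion {A : Arrangement K (n+1)} {e : Fin (n+1) → ℕ}
    (h : Flag (n+1) A (fun _ => 1) e) : FreeCriterion A e := by
  have he : e 0 = 1 := by
    obtain ⟨_, _, _, _, _, h3, _, _⟩ := h
    exact h3.symm
  rcases n with _ | _ | n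
  · have hfree : IsFreeWithExp A (fun _ => 1) e := by
      obtain ⟨c₀, _, _, h1, _⟩ := h
      exact isFreeWithExp_one_variable A h1.1 he
    exact ⟨fun _ => ⟨e, hfree, rfl⟩, fun _ => by simp [b2Simple_eq_zero, esymmTwo],
      fun _ => hfree⟩
  · have hbd : Bd (dfct A.hyps (fun _ => 1) e) 0 := by
      have := h.err_dfct.add ((err_hs 0 0).const_mul ((b2Simple A : ℤ) - esymmTwo e))
      simp only [hs_zero, sub_add_cancel] at this
      exact this.bd
    have hfree : IsFreeWithExp A (fun _ => 1) e := (isFreeWithExp_iff _ _ _).2 (h.free_of_bd hbd)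
    have hsum := h.sum_eq
    refine ⟨fun _ => ⟨e, hfree, rfl⟩, fun _ => ?_, fun _ => hfree⟩
    simp [Fin.sum_univ_succ, he] at hsum
    simp [b2Simple_eq_card_sub_one, esymmTwo, Fin.sum_univ_succ, he]
    omega
  · refine ⟨fun ⟨d, hd⟩ => ⟨d, hd, ?_⟩, fun ⟨d, hd, hde⟩ => ?_, fun hb2 => ?_⟩
    · obtain ⟨b, hb⟩ := (isFreeWithExp_iff _ _ _).1 hd
      refine h.exponents_eq ?_ hb
      have h1 := (h.err_dfct.mono (Nat.sub_le _ _)).add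
        ((err_hs (n+1) 0).const_mul ((b2Simple A : ℤ) - esymmTwo e))
      simp only [hs_zero, sub_add_cancel] at h1
      exact h1.bd
    · obtain ⟨b, hb⟩ := (isFreeWithExp_iff _ _ _).1 hd
      have h1 := h.err_dfct.const_mul (-1)
      simp only [dfct_eq_zero hb hde, zero_sub, neg_mul_neg, one_mul] at h1
      have := Err.eq_zero_of_const_mul h1
      omega
    · have h1 := h.err_dfct
      simp only [hb2, sub_self, zero_mul, sub_zero] at h1
      exact (isFreeWithExp_iff _ _ _).2 (h.free_of_bd h1.bd)

theorem FreeCriterion.isFree_iff {A : Arrangement K n} {e : Fin n → ℕ} (h : FreeCriterion A e) :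
    IsFree A (fun _ => 1) ↔ b2Simple A = esymmTwo e :=
  ⟨fun hf => h.2.1 (h.1 hf), fun hb => ⟨e, h.2.2 hb⟩⟩

theorem flag_of_chain {ℓ : ℕ} (B : (k : ℕ) → Arrangement K k) (mB : (k : ℕ) → (Fin k → K) → ℕ)
    (hc : (k : ℕ) → (Fin k → K)) (hmtop : ∀ c, mB ℓ c = 1) (htop : hc ℓ ∈ (B ℓ).hyps)
    (hchain : ∀ k : ℕ, 1 ≤ k → k < ℓ →
      IsEZRes (B (k+1)) (mB (k+1)) (hc (k+1)) (B k) (mB k))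
    (hlh : ∀ k : ℕ, 1 ≤ k → k < ℓ → IsLocallyHeavy (B k) (mB k) (hc k)) :
    ∀ k ≤ ℓ, Flag k (B k) (mB k) (fun i => mB (k - i.val) (hc (k - i.val))) := by
  have hpos : ∀ j k, 1 ≤ k → k + j = ℓ → ∀ c ∈ (B k).hyps, 0 < mB k c := by
    intro j
    induction j with
    | zero =>
      rintro k - rfl c -
      rw [show mB k c = 1 from hmtop c]
      exact one_pos
    | succ j ih =>
      intro k hk hkj c hc'
      obtain ⟨R⟩ := (hchain k hk (by omega)).nonempty_resMap
      exact R.mult_pos (ih (k+1) (by omega) (by omega)) hc'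
  intro k
  induction k with
  | zero => exact fun _ => trivial
  | succ k ih =>
    intro hk
    have hheavy : hc (k+1) ∈ (B (k+1)).hyps ∧ (IsLocallyHeavy (B (k+1)) (mB (k+1)) (hc (k+1)) ∨
        ∀ c ∈ (B (k+1)).hyps, mB (k+1) c = 1) := by
      rcases hk.lt_or_eq with h | rfl
      · have := hlh (k+1) (by omega) h
        exact ⟨this.1, Or.inl this⟩
      · exact ⟨htop, Or.inr fun c _ => hmtop c⟩
    have hpos' := hpos (ℓ - (k+1)) (k+1) (by omega) (by omega)
    rcases Nat.eq_zero_or_pos k with rfl | hk0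
    · obtain ⟨B', mB', h⟩ := exists_isEZRes (B 1) (mB 1) hheavy.1
      exact ⟨_, B', mB', h, hheavy.2, rfl, hpos', trivial⟩
    · refine ⟨_, B k, mB k, hchain k hk0 (by omega), hheavy.2, rfl, hpos', ?_⟩
      have : Fin.tail (fun i : Fin (k+1) => mB (k+1 - i.val) (hc (k+1 - i.val))) =
          fun i : Fin k => mB (k - i.val) (hc (k - i.val)) := by
        funext i
        rw [Fin.tail, Fin.val_succ, Nat.add_sub_add_right]
      rw [this]
      exact ih (by omega)

end

theorem stmt18 (A : Arrangement K ℓ) (hℓ : 1 ≤ ℓ)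
    (B : (k : ℕ) → Arrangement K k) (mB : (k : ℕ) → (Fin k → K) → ℕ)
    (hc : (k : ℕ) → (Fin k → K))
    (hBtop : B ℓ = A) (hmtop : ∀ c, mB ℓ c = 1) (htop : hc ℓ ∈ A.hyps)
    (hchain : ∀ k : ℕ, 1 ≤ k → k < ℓ →
      IsEZRes (B (k+1)) (mB (k+1)) (hc (k+1)) (B k) (mB k))
    (hlh : ∀ k : ℕ, 1 ≤ k → k < ℓ → IsLocallyHeavy (B k) (mB k) (hc k))
    (e : Fin ℓ → ℕ) (he : ∀ i : Fin ℓ, e i = mB (ℓ - i.val) (hc (ℓ - i.val))) :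
    ((∃ d : Fin ℓ → ℕ, IsFreeWithExp A (fun _ => 1) d ∧
        Finset.univ.val.map d = Finset.univ.val.map e) ↔
      b2Simple A = ∑ i : Fin ℓ, ∑ j : Fin ℓ, if i < j then e i * e j else 0) ∧
    (∀ A' : Arrangement K ℓ, CombEquiv A A' →
      (IsFree A (fun _ => 1) ↔ IsFree A' (fun _ => 1))) := by
  subst hBtop
  have hflag := flag_of_chain B mB hc hmtop htop hchain hlh ℓ le_rfl
  rw [← funext he, show mB ℓ = fun _ => 1 from funext hmtop] at hflag
  obtain ⟨n, rfl⟩ : ∃ n, ℓ = n + 1 := ⟨ℓ - 1, by omega⟩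
  have hcrit := hflag.freeCriterion
  refine ⟨⟨hcrit.2.1, fun hb => ⟨e, hcrit.2.2 hb, rfl⟩⟩, fun A' hA' => ?_⟩
  obtain ⟨φ, hφ⟩ := hA'.exists_rankIso
  have hcrit' := (hflag.of_rankIso (m' := fun _ => 1) hφ fun _ _ => rfl).freeCriterion
  rw [hcrit.isFree_iff, hcrit'.isFree_iff, b2Simple_eq, b2Simple_eq,
    hφ.b2F_eq (B (n+1)).nonPar A'.nonPar]

end ArrPaper
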